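/- Let n ≥ 3, and let the exponents satisfy q ≥ 2, 2 ≤ r < ∞, 2/q + (n−1)/r ≤ (n−1)/2, and σ = 1/q + n/r − (n−1)/2. There is a constant C > 0, depending only on n, q, r, such that for every function G : ℝ^n × ℝ → ℂ such that G(·,s) is a Schwartz function for each s, (x,s) ↦ G(x,s) is continuous, and G is compactly supported in s, ‖ (√−Δ)^{σ−1/2} ∫_ℝ e^{−is√−Δ} G(·,s) ds ‖_{L²(ℝ^n)} ≤ C ‖G‖_{L^{q'}_t L^{r'}_x}, where q', r' are the conjugate exponents of q, r. -/

import Mathlib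

noncomputable section

open MeasureTheory Metric Complex
open scoped ENNReal FourierTransform SchwartzMap

/-- The Fourier multiplier operator `m(√−Δ)` on `ℝⁿ`:
`m(√−Δ)h = 𝓕⁻¹(m(|ξ|) 𝓕h(ξ))`. -/
def mOp (n : ℕ) (m : ℝ → ℂ) (h : EuclideanSpace ℝ (Fin n) → ℂ) :
    EuclideanSpace ℝ (Fin n) → ℂ :=
  fun x => 𝓕⁻ (fun ξ : EuclideanSpace ℝ (Fin n) => m ‖ξ‖ * 𝓕 h ξ) x

/-- The multiplier of `e^{it√−Δ}`, i.e. `ρ ↦ e^{itρ}`. -/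
def expMult (t : ℝ) : ℝ → ℂ := fun ρ => Complex.exp (Complex.I * t * ρ)

/-- The multiplier of `cos(t√−Δ)`, i.e. `ρ ↦ cos (tρ)`. -/
def cosMult (t : ℝ) : ℝ → ℂ := fun ρ => ((Real.cos (t * ρ) : ℝ) : ℂ)

/-- The multiplier of `sin(t√−Δ)/√−Δ`, i.e. `ρ ↦ sin (tρ)/ρ`. -/
def sincMult (t : ℝ) : ℝ → ℂ := fun ρ => ((Real.sin (t * ρ) / ρ : ℝ) : ℂ)

/-- The multiplier of `sin(t√−Δ)`, i.e. `ρ ↦ sin (tρ)`. -/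
def sinMult (t : ℝ) : ℝ → ℂ := fun ρ => ((Real.sin (t * ρ) : ℝ) : ℂ)

/-- The multiplier of `(√−Δ)^γ`, i.e. `ρ ↦ ρ^γ`. -/
def powMult (γ : ℝ) : ℝ → ℂ := fun ρ => ((ρ ^ γ : ℝ) : ℂ)

/-- A function is Schwartz if it agrees pointwise with some Schwartz map. -/
def IsSchwartz {n : ℕ} (h : EuclideanSpace ℝ (Fin n) → ℂ) : Prop :=
  ∃ φ : 𝓢(EuclideanSpace ℝ (Fin n), ℂ), ∀ x, h x = φ x

/-- The Fefferman–Phong norm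
`‖V‖_{𝓕^p} = sup_{x, r>0} r^(2-n/p) (∫_{B_r(x)} |V|^p)^(1/p)`. -/
def fpNorm (n : ℕ) (p : ℝ) (V : EuclideanSpace ℝ (Fin n) → ℂ) : ℝ≥0∞ :=
  ⨆ (x : EuclideanSpace ℝ (Fin n)) (r : ℝ) (_ : 0 < r),
    ENNReal.ofReal (r ^ (2 - n / p)) *
      (∫⁻ y in ball x r, ENNReal.ofReal (‖V y‖ ^ p)) ^ (1 / p)

/-- The weak `L^{n/2}` quasinorm `sup_{λ>0} λ · |{|V| > λ}|^{2/n}`. -/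
def wkNorm (n : ℕ) (V : EuclideanSpace ℝ (Fin n) → ℂ) : ℝ≥0∞ :=
  ⨆ (l : ℝ) (_ : 0 < l),
    ENNReal.ofReal l * (volume {x : EuclideanSpace ℝ (Fin n) | l < ‖V x‖}) ^ ((2 : ℝ) / n)

/-- The mixed norm `‖F‖_{L^q_t L^r_x}` for `F : ℝⁿ × ℝ → ℂ`, curried as `F x t`. -/
def mixedNorm (n : ℕ) (q r : ℝ) (F : EuclideanSpace ℝ (Fin n) → ℝ → ℂ) : ℝ≥0∞ :=
  (∫⁻ t : ℝ, (∫⁻ x : EuclideanSpace ℝ (Fin n), (‖F x t‖₊ : ℝ≥0∞) ^ r) ^ (q / r)) ^ (1 / q)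

/-- The weighted norm `‖h‖_{L²_{x,t}(w)}` with weight `w : ℝⁿ → [0,∞]`. -/
def wtNorm (n : ℕ) (w : EuclideanSpace ℝ (Fin n) → ℝ≥0∞)
    (h : EuclideanSpace ℝ (Fin n) → ℝ → ℂ) : ℝ≥0∞ :=
  (∫⁻ t : ℝ, ∫⁻ x : EuclideanSpace ℝ (Fin n), (‖h x t‖₊ : ℝ≥0∞) ^ (2 : ℝ) * w x) ^ ((1 : ℝ) / 2)

/-- The homogeneous Sobolev norm `‖h‖_{Ḣ^γ} = ‖(√−Δ)^γ h‖_{L²}`. -/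
def sobNorm (n : ℕ) (γ : ℝ) (h : EuclideanSpace ℝ (Fin n) → ℂ) : ℝ≥0∞ :=
  eLpNorm (mOp n (powMult γ) h) 2 volume

/-- The point `x/|x|` of the unit sphere, for `x ≠ 0`. -/
def sphMap (n : ℕ) (x : EuclideanSpace ℝ (Fin n)) (hx : x ≠ 0) :
    Metric.sphere (0 : EuclideanSpace ℝ (Fin n)) 1 :=
  ⟨‖x‖⁻¹ • x, by
    rw [mem_sphere_zero_iff_norm, norm_smul, norm_inv, norm_norm,
      inv_mul_cancel₀ (norm_ne_zero_iff.mpr hx)]⟩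

namespace DS

section poisson
variable {V : Type*} [NormedAddCommGroup V] [InnerProductSpace ℝ V] [FiniteDimensional ℝ V]
  [MeasurableSpace V] [BorelSpace V]

lemma exp_neg_le (a : ℝ) (ha : 0 < a) (k : ℕ) (t : ℝ) (ht : 0 ≤ t) :
    Real.exp (-a * t) ≤ (Real.exp a * k.factorial / a ^ k) * (1 + t) ^ (-(k : ℝ)) := by
  have h := Real.pow_div_factorial_le_exp (a * (1 + t)) (by positivity) k
  have h1 : Real.exp (a * (1 + t)) = Real.exp a / Real.exp (-a * t) := by
    rw [← Real.exp_sub]; ring_nf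
  rw [h1, mul_pow, div_le_div_iff₀ (by positivity) (by positivity)] at h
  rw [Real.rpow_neg (by positivity), Real.rpow_natCast]
  rw [← div_eq_mul_inv, div_div, le_div_iff₀ (by positivity)]
  linarith

lemma integrable_exp_neg_norm (a : ℝ) (ha : 0 < a) :
    Integrable (fun ξ : V => Real.exp (-a * ‖ξ‖)) := by
  have h := (integrable_one_add_norm (E := V) (μ := volume)
    (r := ((Module.finrank ℝ V + 1 : ℕ) : ℝ)) (by push_cast; linarith)).const_mul
      (Real.exp a * (Module.finrank ℝ V + 1 : ℕ).factorial / a ^ (Module.finrank ℝ V + 1 : ℕ))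
  refine h.mono' (by fun_prop) (ae_of_all _ fun ξ => ?_)
  rw [Real.norm_of_nonneg (Real.exp_pos _).le]
  exact exp_neg_le a ha _ _ (norm_nonneg _)

lemma fourier_exp_abs (a : ℝ) (ha : 0 < a) (τ : ℝ) :
    𝓕 (fun ρ : ℝ => cexp (-(a * |ρ|))) τ = ((2 * a / (a ^ 2 + 4 * Real.pi ^ 2 * τ ^ 2) : ℝ) : ℂ) := by
  have h_intg : Integrable (fun v : ℝ => cexp (↑(-2 * Real.pi * inner ℝ v τ) * I) • cexp (-(a * |v|))) := by
    have := integrable_exp_neg_norm (V := ℝ) a ha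
    refine this.mono' (by fun_prop) (ae_of_all _ fun ξ => ?_)
    rw [norm_smul, norm_exp, norm_exp]
    simp
  rw [Real.fourier_eq', ← integral_add_compl (measurableSet_Ioi (a := (0:ℝ))) h_intg]
  have hc : (Set.Ioi (0:ℝ))ᶜ = Set.Iic 0 := by ext; simp
  rw [hc, ← neg_zero, ← integral_comp_neg_Ioi]
  have e1 : ∫ x in Set.Ioi (-(0:ℝ)), cexp (↑(-2 * Real.pi * inner ℝ x τ) * I) • cexp (-(a * |x|))
      = ∫ x in Set.Ioi (0:ℝ), cexp ((-a - 2 * Real.pi * τ * I) * x) := by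
    rw [neg_zero]
    refine setIntegral_congr_fun measurableSet_Ioi fun x hx => ?_
    simp only [smul_eq_mul]
    rw [← Complex.exp_add, abs_of_pos hx]
    congr 1
    simp
    ring
  have e2 : ∫ x in Set.Ioi (0:ℝ), cexp (↑(-2 * Real.pi * inner ℝ (-x) τ) * I) • cexp (-(a * |-x|))
      = ∫ x in Set.Ioi (0:ℝ), cexp ((-a + 2 * Real.pi * τ * I) * x) := by
    refine setIntegral_congr_fun measurableSet_Ioi fun x hx => ?_
    simp only [smul_eq_mul]
    rw [← Complex.exp_add, abs_neg, abs_of_pos hx]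
    congr 1
    simp
    ring
  rw [e1, e2, integral_exp_mul_complex_Ioi (by simp [ha]), integral_exp_mul_complex_Ioi (by simp [ha])]
  have h1 : (-a - 2 * Real.pi * τ * I : ℂ) ≠ 0 := by
    intro h; have := congrArg Complex.re h; simp at this; linarith
  have h2 : (-a + 2 * Real.pi * τ * I : ℂ) ≠ 0 := by
    intro h; have := congrArg Complex.re h; simp at this; linarith
  have h3 : (a ^ 2 + 4 * Real.pi ^ 2 * τ ^ 2 : ℂ) ≠ 0 := by
    have : (a ^ 2 + 4 * Real.pi ^ 2 * τ ^ 2 : ℝ) ≠ 0 := by positivity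
    exact_mod_cast this
  have h4 : (a ^ 2 + 4 * Real.pi ^ 2 * τ ^ 2 : ℂ) = (-a - 2 * Real.pi * τ * I) * (-a + 2 * Real.pi * τ * I) := by
    ring_nf; rw [I_sq]; ring
  push_cast
  rw [h4]
  simp only [ofReal_zero, mul_zero, Complex.exp_zero]
  field_simp
  ring

/-- subordination weight -/
def sg (a u : ℝ) : ℝ := 2 * a * Real.exp (-(u * a ^ 2)) * (4 * Real.pi * u) ^ (-(1/2) : ℝ)

lemma integrable_lor (a : ℝ) (ha : 0 < a) :
    Integrable (fun τ : ℝ => 2 * a / (a ^ 2 + 4 * Real.pi ^ 2 * τ ^ 2)) := by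
  have h := (integrable_inv_one_add_sq.comp_mul_left' (R := 2 * Real.pi / a) (by positivity)).const_mul (2 / a)
  refine h.congr (ae_of_all _ fun τ => ?_)
  simp only
  field_simp
  ring

lemma subord (a : ℝ) (ha : 0 < a) (ρ : ℝ) :
    ∫ u in Set.Ioi (0:ℝ), sg a u * Real.exp (-(ρ ^ 2 / (4 * u))) = Real.exp (-(a * |ρ|)) := by
  have hcont : Continuous (fun ρ : ℝ => cexp (-(a * |ρ|))) := by fun_prop
  have h_intg : Integrable (fun ρ : ℝ => cexp (-(a * |ρ|))) := by
    have := integrable_exp_neg_norm (V := ℝ) a ha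
    refine this.mono' (by fun_prop) (ae_of_all _ fun ξ => ?_)
    rw [norm_exp]; simp
  have hF : 𝓕 (fun ρ : ℝ => cexp (-(a * |ρ|))) =
      fun τ => ((2 * a / (a ^ 2 + 4 * Real.pi ^ 2 * τ ^ 2) : ℝ) : ℂ) := funext (fourier_exp_abs a ha)
  have hinv := congrFun (Continuous.fourierInv_fourier_eq hcont h_intg
    (by rw [hF]; exact (integrable_lor a ha).ofReal)) ρ
  rw [hF, Real.fourierInv_eq'] at hinv
  have hu : ∀ τ : ℝ, ∫ u in Set.Ioi (0:ℝ), 2 * a * Real.exp (-(a ^ 2 + 4 * Real.pi ^ 2 * τ ^ 2) * u)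
      = 2 * a / (a ^ 2 + 4 * Real.pi ^ 2 * τ ^ 2) := by
    intro τ
    rw [integral_const_mul, integral_exp_mul_Ioi (by nlinarith [sq_nonneg (Real.pi * τ), sq_pos_of_pos ha])]
    have : (a ^ 2 + 4 * Real.pi ^ 2 * τ ^ 2) ≠ 0 := by positivity
    simp only [mul_zero, Real.exp_zero]
    rw [neg_div_neg_eq]
    field_simp
  have hui : ∀ τ : ℝ, IntegrableOn (fun u => 2 * a * Real.exp (-(a ^ 2 + 4 * Real.pi ^ 2 * τ ^ 2) * u)) (Set.Ioi 0) := by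
    intro τ
    exact (integrableOn_exp_mul_Ioi (by nlinarith [sq_nonneg (Real.pi * τ), sq_pos_of_pos ha]) 0).const_mul _
  have hi2 : Integrable (Function.uncurry fun (τ u : ℝ) =>
      cexp (↑(2 * Real.pi * inner ℝ τ ρ) * I) * ((2 * a * Real.exp (-(a ^ 2 + 4 * Real.pi ^ 2 * τ ^ 2) * u) : ℝ) : ℂ))
      (volume.prod (volume.restrict (Set.Ioi 0))) := by
    rw [integrable_prod_iff (by fun_prop)]
    refine ⟨ae_of_all _ fun τ => ?_, ?_⟩
    · have h0 := ((hui τ).ofReal (𝕜 := ℂ)).const_mul (cexp (↑(2 * Real.pi * inner ℝ τ ρ) * I))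
      exact h0
    · refine (integrable_lor a ha).congr (ae_of_all _ fun τ => ?_)
      simp only [Function.uncurry]
      rw [← hu]
      refine integral_congr_ae (ae_of_all _ fun u => ?_)
      simp only
      rw [norm_mul, norm_exp_ofReal_mul_I, one_mul, Complex.norm_real, Real.norm_of_nonneg (by positivity)]
  have e1 : ∫ v : ℝ, cexp (↑(2 * Real.pi * inner ℝ v ρ) * I) • ((2 * a / (a ^ 2 + 4 * Real.pi ^ 2 * v ^ 2) : ℝ) : ℂ)
      = ∫ v : ℝ, ∫ u in Set.Ioi (0:ℝ), cexp (↑(2 * Real.pi * inner ℝ v ρ) * I) * ((2 * a * Real.exp (-(a ^ 2 + 4 * Real.pi ^ 2 * v ^ 2) * u) : ℝ) : ℂ) := by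
    refine integral_congr_ae (ae_of_all _ fun v => ?_)
    simp only
    rw [integral_const_mul, integral_complex_ofReal, hu, smul_eq_mul]
  rw [e1, integral_integral_swap hi2] at hinv
  have e2 : ∀ u ∈ Set.Ioi (0:ℝ), ∫ v : ℝ, cexp (↑(2 * Real.pi * inner ℝ v ρ) * I) * ((2 * a * Real.exp (-(a ^ 2 + 4 * Real.pi ^ 2 * v ^ 2) * u) : ℝ) : ℂ)
      = ((sg a u * Real.exp (-(ρ ^ 2 / (4 * u))) : ℝ) : ℂ) := by
    intro u hu0
    have hu0 : 0 < u := hu0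
    have hg := GaussianFourier.integral_cexp_neg_mul_sq_norm_add (V := ℝ) (b := ((4 * Real.pi ^ 2 * u : ℝ) : ℂ))
      (by rw [ofReal_re]; positivity) (2 * Real.pi * I) ρ
    have : ∀ v : ℝ, cexp (↑(2 * Real.pi * inner ℝ v ρ) * I) * ((2 * a * Real.exp (-(a ^ 2 + 4 * Real.pi ^ 2 * v ^ 2) * u) : ℝ) : ℂ)
       = (2 * a * cexp (-(u * a ^ 2))) * cexp (-((4 * Real.pi ^ 2 * u : ℝ) : ℂ) * ‖v‖ ^ 2 + 2 * Real.pi * I * (inner ℝ ρ v : ℝ)) := by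
      intro v
      have hv : ((‖v‖ : ℝ) : ℂ) ^ 2 = (v : ℂ) ^ 2 := by
        rw [← ofReal_pow, Real.norm_eq_abs, sq_abs, ofReal_pow]
      push_cast
      rw [hv, mul_comm, mul_assoc, ← Complex.exp_add, mul_assoc (2 * (a:ℂ)), ← Complex.exp_add]
      rw [real_inner_comm]
      congr 2
      ring
    simp_rw [this]
    rw [integral_const_mul, hg]
    have e3 : ((Real.pi : ℂ) / ((4 * Real.pi ^ 2 * u : ℝ) : ℂ)) ^ ((Module.finrank ℝ ℝ : ℂ) / 2) =
        (((4 * Real.pi * u) ^ (-(1/2) : ℝ) : ℝ) : ℂ) := by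
      rw [← ofReal_div]
      have : (Real.pi / (4 * Real.pi ^ 2 * u)) = (4 * Real.pi * u)⁻¹ := by field_simp
      rw [this, Module.finrank_self]
      have h2 : ((1 : ℕ) : ℂ) / 2 = (((1:ℝ)/2 : ℝ) : ℂ) := by push_cast; rfl
      rw [h2, ← ofReal_cpow (by positivity), Real.rpow_neg (by positivity), Real.inv_rpow (by positivity)]
    rw [e3]
    have e4 : (2 * Real.pi * I) ^ 2 * (‖ρ‖ : ℂ) ^ 2 / (4 * ((4 * Real.pi ^ 2 * u : ℝ) : ℂ)) = ((-(ρ ^ 2 / (4 * u)) : ℝ) : ℂ) := by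
      have hv : ((‖ρ‖ : ℝ) : ℂ) ^ 2 = (ρ : ℂ) ^ 2 := by
        rw [← ofReal_pow, Real.norm_eq_abs, sq_abs, ofReal_pow]
      rw [hv, mul_pow, I_sq]
      push_cast
      have : (Real.pi : ℂ) ≠ 0 := by exact_mod_cast Real.pi_ne_zero
      have : (u : ℂ) ≠ 0 := by exact_mod_cast hu0.ne'
      field_simp
      ring
    rw [e4, sg]
    push_cast
    ring
  rw [setIntegral_congr_fun measurableSet_Ioi e2, integral_complex_ofReal] at hinv
  have h5 : cexp (-(a * |ρ|)) = ((Real.exp (-(a * |ρ|)) : ℝ) : ℂ) := by push_cast; rfl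
  rw [h5] at hinv
  exact_mod_cast hinv

end poisson
end DS

namespace DS

section poisson2
variable {V : Type*} [NormedAddCommGroup V] [InnerProductSpace ℝ V] [FiniteDimensional ℝ V]
  [MeasurableSpace V] [BorelSpace V]

/-- the complex Poisson kernel -/
def PK (w : ℂ) (x : V) : ℂ := 𝓕⁻ (fun ξ : V => cexp (-(w * ‖ξ‖))) x

lemma subord_integrable (a : ℝ) (ha : 0 < a) (ρ : ℝ) :
    IntegrableOn (fun u => sg a u * Real.exp (-(ρ ^ 2 / (4 * u)))) (Set.Ioi 0) := by
  by_contra h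
  have h1 := subord a ha ρ
  rw [integral_undef h] at h1
  exact (Real.exp_pos _).ne h1

lemma sg_nonneg (a : ℝ) (ha : 0 < a) (u : ℝ) (hu : 0 < u) : 0 ≤ sg a u := by
  unfold sg; positivity

lemma sg_meas (a : ℝ) : Measurable (sg a) := by
  unfold sg; fun_prop

/-- the constant in the Poisson kernel -/
def cP (N : ℕ) : ℝ := 2 * (4 * Real.pi) ^ (((N : ℝ) - 1) / 2) * Real.Gamma (((N : ℝ) + 1) / 2)

lemma cP_pos (N : ℕ) : 0 < cP N := by
  unfold cP
  have := Real.Gamma_pos_of_pos (s := ((N : ℝ) + 1) / 2) (by positivity)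
  have := Real.pi_pos
  positivity

lemma PK_real (a : ℝ) (ha : 0 < a) (x : V) :
    PK (a : ℂ) x = ((cP (Module.finrank ℝ V) * a * (a ^ 2 + 4 * Real.pi ^ 2 * ‖x‖ ^ 2) ^
      (-(((Module.finrank ℝ V : ℕ) + 1 : ℝ) / 2)) : ℝ) : ℂ) := by
  set N := Module.finrank ℝ V with hN
  have hi2 : Integrable (Function.uncurry fun (ξ : V) (u : ℝ) =>
      cexp (↑(2 * Real.pi * inner ℝ ξ x) * I) * ((sg a u * Real.exp (-(‖ξ‖ ^ 2 / (4 * u))) : ℝ) : ℂ))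
      (volume.prod (volume.restrict (Set.Ioi 0))) := by
    have := sg_meas a
    rw [integrable_prod_iff (by unfold Function.uncurry; fun_prop)]
    refine ⟨ae_of_all _ fun τ => ?_, ?_⟩
    · have h0 := ((subord_integrable a ha ‖τ‖).ofReal (𝕜 := ℂ)).const_mul (cexp (↑(2 * Real.pi * inner ℝ τ x) * I))
      exact h0
    · refine (integrable_exp_neg_norm a ha).congr (ae_of_all _ fun τ => ?_)
      simp only [Function.uncurry]
      have h0 := subord a ha ‖τ‖
      rw [abs_norm] at h0
      rw [neg_mul, ← h0]
      refine setIntegral_congr_fun measurableSet_Ioi fun u hu => ?_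
      have := sg_nonneg a ha u hu
      beta_reduce
      rw [norm_mul, norm_exp_ofReal_mul_I, one_mul, Complex.norm_real, Real.norm_of_nonneg (by positivity)]
  have e1 : PK (a : ℂ) x = ∫ ξ : V, ∫ u in Set.Ioi (0:ℝ), cexp (↑(2 * Real.pi * inner ℝ ξ x) * I) * ((sg a u * Real.exp (-(‖ξ‖ ^ 2 / (4 * u))) : ℝ) : ℂ) := by
    rw [PK, Real.fourierInv_eq']
    refine integral_congr_ae (ae_of_all _ fun v => ?_)
    simp only
    rw [integral_const_mul, integral_complex_ofReal, subord a ha, smul_eq_mul, abs_norm]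
    push_cast
    rfl
  rw [e1, integral_integral_swap hi2]
  have e2 : ∀ u ∈ Set.Ioi (0:ℝ), ∫ ξ : V, cexp (↑(2 * Real.pi * inner ℝ ξ x) * I) * ((sg a u * Real.exp (-(‖ξ‖ ^ 2 / (4 * u))) : ℝ) : ℂ)
      = (((2 * a * (4 * Real.pi) ^ (((N : ℝ) - 1) / 2)) * (u ^ (((N : ℝ) + 1) / 2 - 1) * Real.exp (-((a ^ 2 + 4 * Real.pi ^ 2 * ‖x‖ ^ 2) * u))) : ℝ) : ℂ) := by
    intro u hu0
    have hu0 : 0 < u := hu0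
    have hg := GaussianFourier.integral_cexp_neg_mul_sq_norm_add (V := V) (b := ((1 / (4 * u) : ℝ) : ℂ))
      (by rw [ofReal_re]; positivity) (2 * Real.pi * I) x
    have : ∀ v : V, cexp (↑(2 * Real.pi * inner ℝ v x) * I) * ((sg a u * Real.exp (-(‖v‖ ^ 2 / (4 * u))) : ℝ) : ℂ)
       = (sg a u) * cexp (-((1 / (4 * u) : ℝ) : ℂ) * ‖v‖ ^ 2 + 2 * Real.pi * I * (inner ℝ x v : ℝ)) := by
      intro v
      push_cast
      rw [mul_comm, mul_assoc, ← Complex.exp_add]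
      rw [real_inner_comm]
      congr 2
      ring
    simp_rw [this]
    rw [integral_const_mul, hg]
    have e3 : ((Real.pi : ℂ) / ((1 / (4 * u) : ℝ) : ℂ)) ^ ((Module.finrank ℝ V : ℂ) / 2) =
        (((4 * Real.pi * u) ^ ((N : ℝ) / 2) : ℝ) : ℂ) := by
      rw [← ofReal_div]
      have : (Real.pi / (1 / (4 * u))) = (4 * Real.pi * u) := by field_simp
      rw [this, ← hN]
      have h2 : (N : ℂ) / 2 = (((N:ℝ)/2 : ℝ) : ℂ) := by push_cast; rfl
      rw [h2, ← ofReal_cpow (by positivity)]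
    rw [e3]
    have e4 : (2 * Real.pi * I) ^ 2 * (‖x‖ : ℂ) ^ 2 / (4 * ((1 / (4 * u) : ℝ) : ℂ)) = ((-(4 * Real.pi ^ 2 * ‖x‖ ^ 2 * u) : ℝ) : ℂ) := by
      rw [mul_pow, I_sq]
      push_cast
      have : (u : ℂ) ≠ 0 := by exact_mod_cast hu0.ne'
      field_simp
      ring
    rw [e4, ← ofReal_exp, ← ofReal_mul, ← ofReal_mul]
    congr 1
    have h6 : (4 * Real.pi * u) ^ (-(1/2) : ℝ) * (4 * Real.pi * u) ^ ((N : ℝ) / 2) =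
        (4 * Real.pi) ^ (((N : ℝ) - 1) / 2) * u ^ (((N : ℝ) + 1) / 2 - 1) := by
      rw [← Real.rpow_add (by positivity), Real.mul_rpow (by positivity) (by positivity)]
      congr 2 <;> ring
    have h7 : Real.exp (-(u * a ^ 2)) * Real.exp (-(4 * Real.pi ^ 2 * ‖x‖ ^ 2 * u)) =
      Real.exp (-((a ^ 2 + 4 * Real.pi ^ 2 * ‖x‖ ^ 2) * u)) := by
      rw [← Real.exp_add]; ring_nf
    unfold sg
    rw [← h7]
    linear_combination (2 * a * Real.exp (-(u * a ^ 2)) * Real.exp (-(4 * Real.pi ^ 2 * ‖x‖ ^ 2 * u))) * h6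
  rw [setIntegral_congr_fun measurableSet_Ioi e2, integral_complex_ofReal, integral_const_mul,
    Real.integral_rpow_mul_exp_neg_mul_Ioi (by positivity) (by positivity)]
  congr 1
  rw [one_div, Real.inv_rpow (by positivity), ← Real.rpow_neg (by positivity), cP]
  ring

lemma integrable_cexp (w : ℂ) (hw : 0 < w.re) : Integrable (fun ξ : V => cexp (-(w * ‖ξ‖))) := by
  refine (integrable_exp_neg_norm w.re hw).mono' (by fun_prop) (ae_of_all _ fun ξ => ?_)
  rw [norm_exp]; simp

lemma PK_eq (w : ℂ) (x : V) : PK w x = ∫ ξ : V, cexp (↑(2 * Real.pi * inner ℝ ξ x) * I - w * ‖ξ‖) := by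
  rw [PK, Real.fourierInv_eq']
  congr 1; ext ξ
  rw [smul_eq_mul, ← Complex.exp_add, sub_eq_add_neg]

lemma PK_differentiableOn (x : V) : DifferentiableOn ℂ (fun w => PK w x) {w | 0 < w.re} := by
  intro w hw
  have hw : 0 < w.re := hw
  refine DifferentiableAt.differentiableWithinAt ?_
  simp_rw [PK_eq]
  have hb : Integrable (fun ξ : V => (2 / w.re) * Real.exp (-(w.re / 4) * ‖ξ‖) * 2) := by
    exact ((integrable_exp_neg_norm (w.re / 4) (by positivity)).const_mul _).mul_const _
  refine (hasDerivAt_integral_of_dominated_loc_of_deriv_le (μ := volume)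
    (F := fun (w : ℂ) (ξ : V) => cexp (↑(2 * Real.pi * inner ℝ ξ x) * I - w * ‖ξ‖))
    (F' := fun (w : ℂ) (ξ : V) => cexp (↑(2 * Real.pi * inner ℝ ξ x) * I - w * ‖ξ‖) * (-(1 * (‖ξ‖ : ℂ))))
    (bound := fun ξ : V => (2 / w.re) * Real.exp (-(w.re / 4) * ‖ξ‖) * 2) (x₀ := w)
    (Metric.ball_mem_nhds w (ε := w.re / 2) (by positivity)) ?_ ?_ ?_ ?_ hb ?_).2.differentiableAt
  · exact Filter.Eventually.of_forall fun w' => by fun_prop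
  · refine (integrable_exp_neg_norm w.re hw).mono' (by fun_prop) (ae_of_all _ fun ξ => ?_)
    rw [norm_exp]; simp
  · fun_prop
  · refine ae_of_all _ fun ξ w' hw' => ?_
    rw [Metric.mem_ball, dist_eq_norm] at hw'
    have h1 : w.re / 2 ≤ w'.re := by
      have := (abs_re_le_norm (w' - w)).trans hw'.le
      rw [sub_re, abs_le] at this
      linarith
    rw [norm_mul, norm_exp]
    have h2 : (↑(2 * Real.pi * inner ℝ ξ x) * I - w' * ‖ξ‖ : ℂ).re = -(w'.re * ‖ξ‖) := by simp
    rw [h2, one_mul, norm_neg, norm_real, norm_norm]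
    have h3 : Real.exp (-(w'.re * ‖ξ‖)) ≤ Real.exp (-(w.re / 4) * ‖ξ‖) * Real.exp (-(w.re / 4) * ‖ξ‖) := by
      rw [← Real.exp_add]
      apply Real.exp_le_exp.2
      nlinarith [norm_nonneg ξ]
    have h4 : Real.exp (-(w.re / 4) * ‖ξ‖) * ‖ξ‖ ≤ 4 / w.re := by
      have := Real.add_one_le_exp ((w.re / 4) * ‖ξ‖)
      rw [neg_mul, Real.exp_neg, inv_mul_le_iff₀ (Real.exp_pos _)]
      rw [mul_div_assoc', le_div_iff₀ hw]
      nlinarith [norm_nonneg ξ]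
    calc _ ≤ Real.exp (-(w.re / 4) * ‖ξ‖) * Real.exp (-(w.re / 4) * ‖ξ‖) * ‖ξ‖ := by gcongr
      _ = Real.exp (-(w.re / 4) * ‖ξ‖) * (Real.exp (-(w.re / 4) * ‖ξ‖) * ‖ξ‖) := by ring
      _ ≤ Real.exp (-(w.re / 4) * ‖ξ‖) * (4 / w.re) := by gcongr
      _ = _ := by ring
  · refine ae_of_all _ fun ξ w' hw' => ?_
    exact (((hasDerivAt_id w').mul_const _).const_sub _).cexp

lemma PK_sq (w : ℂ) (hw : 0 < w.re) (x : V) :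
    PK w x ^ 2 * (w ^ 2 + 4 * Real.pi ^ 2 * ‖x‖ ^ 2) ^ (Module.finrank ℝ V + 1) =
      (cP (Module.finrank ℝ V)) ^ 2 * w ^ 2 := by
  set N := Module.finrank ℝ V with hN
  have hop : IsOpen {w : ℂ | 0 < w.re} := isOpen_lt continuous_const continuous_re
  have hd := PK_differentiableOn x
  have h1 : AnalyticOnNhd ℂ (fun w => PK w x ^ 2 * (w ^ 2 + 4 * Real.pi ^ 2 * ‖x‖ ^ 2) ^ (N + 1)) {w | 0 < w.re} := by
    refine DifferentiableOn.analyticOnNhd ?_ hop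
    fun_prop
  have h2 : AnalyticOnNhd ℂ (fun w => (cP N : ℂ) ^ 2 * w ^ 2) {w | 0 < w.re} := by
    refine DifferentiableOn.analyticOnNhd ?_ hop
    fun_prop
  have hpre : IsPreconnected {w : ℂ | 0 < w.re} := (convex_halfSpace_re_gt 0).isPreconnected
  refine h1.eqOn_of_preconnected_of_frequently_eq h2 hpre (z₀ := 1) (by simp) ?_ hw
  have hreal : ∀ a : ℝ, 0 < a → PK (a : ℂ) x ^ 2 * ((a : ℂ) ^ 2 + 4 * Real.pi ^ 2 * ‖x‖ ^ 2) ^ (N + 1) =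
      (cP N : ℂ) ^ 2 * (a : ℂ) ^ 2 := by
    intro a ha
    rw [PK_real a ha x]
    have : ((a ^ 2 + 4 * Real.pi ^ 2 * ‖x‖ ^ 2) ^ (-(((N : ℕ) + 1 : ℝ) / 2))) ^ 2 * (a ^ 2 + 4 * Real.pi ^ 2 * ‖x‖ ^ 2) ^ (N + 1) = 1 := by
      have hX : 0 < (a ^ 2 + 4 * Real.pi ^ 2 * ‖x‖ ^ 2) := by positivity
      generalize (a ^ 2 + 4 * Real.pi ^ 2 * ‖x‖ ^ 2) = X at hX
      rw [← Real.rpow_natCast, ← Real.rpow_natCast, ← Real.rpow_mul (by positivity), ← Real.rpow_add (by positivity)]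
      convert Real.rpow_zero _ using 2
      push_cast; ring
    have h3 : (cP N * a * (a ^ 2 + 4 * Real.pi ^ 2 * ‖x‖ ^ 2) ^ (-(((N : ℕ) + 1 : ℝ) / 2))) ^ 2 * (a ^ 2 + 4 * Real.pi ^ 2 * ‖x‖ ^ 2) ^ (N + 1) = cP N ^ 2 * a ^ 2 := by
      linear_combination cP N ^ 2 * a ^ 2 * this
    exact_mod_cast h3
  have ht : Filter.Tendsto (fun k : ℕ => ((1 + 1 / ((k : ℝ) + 1) : ℝ) : ℂ)) Filter.atTop (nhdsWithin 1 {1}ᶜ) := by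
    rw [tendsto_nhdsWithin_iff]
    constructor
    · have := (tendsto_one_div_add_atTop_nhds_zero_nat (𝕜 := ℝ)).const_add 1
      have := (Complex.continuous_ofReal.tendsto _).comp this
      simpa [Function.comp_def] using this
    · refine Filter.Eventually.of_forall fun k => ?_
      simp only [Set.mem_compl_iff, Set.mem_singleton_iff]
      intro h
      have h' : (1 + 1 / ((k : ℝ) + 1) : ℝ) = 1 := by exact_mod_cast h
      have : 0 < 1 / ((k : ℝ) + 1) := by positivity
      linarith
  refine ht.frequently (Filter.Eventually.frequently (Filter.Eventually.of_forall fun k => ?_))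
  exact hreal _ (by positivity)

end poisson2
end DS

namespace DS

section poisson3
variable {V : Type*} [NormedAddCommGroup V] [InnerProductSpace ℝ V] [FiniteDimensional ℝ V]
  [MeasurableSpace V] [BorelSpace V]

lemma PK_norm_sq (w : ℂ) (hw : 0 < w.re) (x : V) :
    ‖PK w x‖ ^ 2 * ‖w ^ 2 + 4 * Real.pi ^ 2 * ‖x‖ ^ 2‖ ^ (Module.finrank ℝ V + 1) =
      (cP (Module.finrank ℝ V)) ^ 2 * ‖w‖ ^ 2 := by
  have h := congrArg norm (PK_sq w hw x)
  rw [norm_mul, norm_mul, norm_pow, norm_pow, norm_pow, norm_pow, norm_real,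
    Real.norm_of_nonneg (cP_pos _).le] at h
  exact h

lemma norm_sq_add_ge (w : ℂ) (hw : 0 < w.re) (X : ℝ) (hX : 0 ≤ X) : w.re * ‖w‖ ≤ ‖w ^ 2 + X‖ := by
  have h0 : 0 ≤ w.re * ‖w‖ := by positivity
  rw [← sq_le_sq₀ h0 (norm_nonneg _), mul_pow, ← normSq_eq_norm_sq, ← normSq_eq_norm_sq, normSq_apply, normSq_apply]
  have h1 : (w ^ 2 + X).re = w.re ^ 2 - w.im ^ 2 + X := by simp [pow_two]
  have h2 : (w ^ 2 + X).im = 2 * w.re * w.im := by simp [pow_two]; ring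
  rw [h1, h2]
  generalize w.re = a at *
  generalize w.im = b at *
  rcases le_total (a ^ 2) (b ^ 2) with h | h
  · nlinarith [sq_nonneg (a ^ 2 - b ^ 2 + X), mul_le_mul_of_nonneg_left h (sq_nonneg a), sq_nonneg (a*b)]
  · nlinarith [mul_nonneg (sub_nonneg.2 h) hX, sq_nonneg X, sq_nonneg (a*b), sq_nonneg (b^2)]

lemma PK_bound (a τ d : ℝ) (ha : 0 < a) (hτ : τ ≠ 0) (hd : 0 ≤ d)
    (hd' : d ≤ ((Module.finrank ℝ V : ℝ) - 1) / 2) (x : V) :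
    ‖PK ((a : ℂ) + τ * I) x‖ ≤ cP (Module.finrank ℝ V) * a ^ (d - Module.finrank ℝ V) * |τ| ^ (-d) := by
  set N := Module.finrank ℝ V with hN
  set w : ℂ := (a : ℂ) + τ * I with hw
  have hre : w.re = a := by simp [hw]
  have him : w.im = τ := by simp [hw]
  have h := PK_norm_sq w (by rw [hre]; exact ha) x
  have hge := norm_sq_add_ge w (by rw [hre]; exact ha) (4 * Real.pi ^ 2 * ‖x‖ ^ 2) (by positivity)
  push_cast at hge
  rw [hre] at hge
  rw [← hN] at h
  have haw : a ≤ ‖w‖ := by have := abs_re_le_norm w; rw [hre] at this; exact (le_abs_self _).trans this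
  have htw : |τ| ≤ ‖w‖ := by have := abs_im_le_norm w; rwa [him] at this
  have hτ' : 0 < |τ| := abs_pos.2 hτ
  have hwp : 0 < ‖w‖ := ha.trans_le haw
  have h1 : ‖PK w x‖ ^ 2 * (a * ‖w‖) ^ (N + 1) ≤ cP N ^ 2 * ‖w‖ ^ 2 := by
    rw [← h]; gcongr
  have h2 : a ^ ((N:ℝ) - 1 - 2 * d) * |τ| ^ (2 * d) ≤ ‖w‖ ^ ((N : ℝ) - 1) := by
    calc _ ≤ ‖w‖ ^ ((N:ℝ) - 1 - 2 * d) * ‖w‖ ^ (2 * d) := by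
          have h3 : 0 ≤ (N:ℝ) - 1 - 2 * d := by linarith
          gcongr
      _ = _ := by rw [← Real.rpow_add hwp]; ring_nf
  have h3 : ‖PK w x‖ ^ 2 * (a ^ (N + 1) * (a ^ ((N:ℝ) - 1 - 2 * d) * |τ| ^ (2 * d))) ≤ cP N ^ 2 := by
    have e : ‖w‖ ^ (N + 1) = ‖w‖ ^ ((N:ℝ) - 1) * ‖w‖ ^ 2 := by
      rw [← Real.rpow_natCast, ← Real.rpow_natCast, ← Real.rpow_add hwp]; push_cast; ring_nf
    rw [mul_pow, e] at h1
    have h4 : (‖PK w x‖ ^ 2 * (a ^ (N + 1) * ‖w‖ ^ ((N : ℝ) - 1))) * ‖w‖ ^ 2 ≤ cP N ^ 2 * ‖w‖ ^ 2 := by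
      linarith
    have h5 := le_of_mul_le_mul_right h4 (by positivity)
    refine le_trans ?_ h5
    gcongr
  have hc := cP_pos N
  rw [← sq_le_sq₀ (norm_nonneg _) (by positivity)]
  have h6 : (a ^ (d - N) * |τ| ^ (-d)) ^ 2 * (a ^ (N + 1) * (a ^ ((N:ℝ) - 1 - 2 * d) * |τ| ^ (2 * d))) = 1 := by
    rw [mul_pow, ← Real.rpow_natCast, ← Real.rpow_natCast, ← Real.rpow_mul ha.le, ← Real.rpow_mul hτ'.le, ← Real.rpow_natCast a]
    have e1 : a ^ ((d - N) * (2:ℕ)) * a ^ ((N + 1 : ℕ) : ℝ) * a ^ ((N:ℝ) - 1 - 2 * d) = 1 := by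
      rw [← Real.rpow_add ha, ← Real.rpow_add ha]
      convert Real.rpow_zero _ using 2
      push_cast; ring
    have e2 : |τ| ^ ((-d) * (2:ℕ)) * |τ| ^ (2 * d) = 1 := by
      rw [← Real.rpow_add hτ']
      convert Real.rpow_zero _ using 2
      push_cast; ring
    calc _ = (a ^ ((d - N) * (2:ℕ)) * a ^ ((N + 1 : ℕ) : ℝ) * a ^ ((N:ℝ) - 1 - 2 * d)) * (|τ| ^ ((-d) * (2:ℕ)) * |τ| ^ (2 * d)) := by ring
      _ = 1 := by rw [e1, e2, one_mul]
  have hpos : 0 < a ^ (N + 1) * (a ^ ((N:ℝ) - 1 - 2 * d) * |τ| ^ (2 * d)) := by positivity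
  refine le_of_mul_le_mul_right (h3.trans (le_of_eq ?_)) hpos
  rw [mul_assoc (cP N), mul_pow, mul_assoc, h6, mul_one]

lemma PK_far (w : ℂ) (hw : 0 < w.re) (hw1 : w.re ≤ 1) (S : ℝ) (hS : |w.im| ≤ S) (x : V) (hx : S + 1 ≤ ‖x‖) :
    ‖PK w x‖ ≤ cP (Module.finrank ℝ V) * (1 + S) * (1 / ‖x‖) ^ (Module.finrank ℝ V + 1) := by
  set N := Module.finrank ℝ V with hN
  have h := PK_norm_sq w hw x
  rw [← hN] at h
  have hS0 : 0 ≤ S := (abs_nonneg _).trans hS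
  have hxp : 0 < ‖x‖ := by linarith
  have hge : ‖x‖ ^ 2 ≤ ‖w ^ 2 + 4 * Real.pi ^ 2 * ‖x‖ ^ 2‖ := by
    refine le_trans ?_ (re_le_norm _)
    have h1 : (w ^ 2 + 4 * Real.pi ^ 2 * ‖x‖ ^ 2 : ℂ).re = w.re ^ 2 - w.im ^ 2 + 4 * Real.pi ^ 2 * ‖x‖ ^ 2 := by
      have : (4 * Real.pi ^ 2 * ‖x‖ ^ 2 : ℂ) = ((4 * Real.pi ^ 2 * ‖x‖ ^ 2 : ℝ) : ℂ) := by push_cast; rfl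
      rw [this, add_re, ofReal_re]; simp [pow_two]
    rw [h1]
    have h2 : w.im ^ 2 ≤ ‖x‖ ^ 2 := by rw [← sq_abs w.im]; gcongr; linarith
    have h3 : 2 ≤ 4 * Real.pi ^ 2 := by nlinarith [Real.pi_gt_three]
    nlinarith [sq_nonneg w.re, sq_nonneg ‖x‖]
  have hwn : ‖w‖ ≤ 1 + S := by
    refine (norm_le_abs_re_add_abs_im w).trans ?_
    rw [abs_of_pos hw]; linarith
  have hc := cP_pos N
  rw [← sq_le_sq₀ (norm_nonneg _) (by positivity)]
  have h1 : ‖PK w x‖ ^ 2 * (‖x‖ ^ 2) ^ (N + 1) ≤ cP N ^ 2 * (1 + S) ^ 2 := by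
    calc _ ≤ cP N ^ 2 * ‖w‖ ^ 2 := by rw [← h]; gcongr
      _ ≤ _ := by gcongr
  have hpos : 0 < (‖x‖ ^ 2) ^ (N + 1) := by positivity
  refine le_of_mul_le_mul_right (h1.trans (le_of_eq ?_)) hpos
  rw [mul_pow, mul_pow, ← pow_mul (1 / ‖x‖), mul_comm (N+1) 2, pow_mul, mul_assoc, ← mul_pow]
  field_simp
  simp only [one_div, inv_pow]
  try rw [inv_mul_cancel₀ hpos.ne']

end poisson3
end DS

namespace DS

section planch
variable {V : Type*} [NormedAddCommGroup V] [InnerProductSpace ℝ V] [FiniteDimensional ℝ V]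
  [MeasurableSpace V] [BorelSpace V]

lemma fourier_mul_flip (f g : V → ℂ) (hf : Integrable f) (hg : Integrable g) :
    ∫ ξ, 𝓕 f ξ * g ξ = ∫ x, f x * 𝓕 g x := by
  have := VectorFourier.integral_fourierIntegral_smul_eq_flip (L := innerₗ V) (μ := volume) (ν := volume)
    Real.continuous_fourierChar continuous_inner hf hg
  rw [flip_innerₗ] at this
  exact this

lemma fourierInv_mul_flip (f g : V → ℂ) (hf : Integrable f) (hg : Integrable g) :
    ∫ ξ, 𝓕⁻ f ξ * g ξ = ∫ x, f x * 𝓕⁻ g x := by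
  have h := fourier_mul_flip f (fun x => g (-x)) hf hg.comp_neg
  rw [← integral_neg_eq_self] at h
  simp only [neg_neg] at h
  have e1 : ∀ ξ, 𝓕⁻ f ξ = 𝓕 f (-ξ) := fun ξ => Real.fourierInv_eq_fourier_neg f ξ
  have e2 : ∀ ξ, 𝓕⁻ g ξ = 𝓕 (fun x => g (-x)) ξ := fun ξ => by
    rw [Real.fourierInv_eq_fourier_comp_neg]
  simp_rw [e1, e2]
  exact h

lemma continuous_fourier' (f : V → ℂ) (hf : Integrable f) : Continuous (𝓕 f) := by
  exact VectorFourier.fourierIntegral_continuous Real.continuous_fourierChar continuous_inner hf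

lemma continuous_fourierInv' (f : V → ℂ) (hf : Integrable f) : Continuous (𝓕⁻ f) := by
  have e1 : 𝓕⁻ f = fun ξ => 𝓕 f (-ξ) := funext fun ξ => Real.fourierInv_eq_fourier_neg f ξ
  rw [e1]
  exact (continuous_fourier' f hf).comp continuous_neg

lemma norm_fourier_le (f : V → ℂ) (ξ : V) : ‖𝓕 f ξ‖ ≤ ∫ x, ‖f x‖ :=
  VectorFourier.norm_fourierIntegral_le_integral_norm _ _ _ _ _

lemma plancherel (f : V → ℂ) (hf : Integrable f) (h2 : MemLp f 2) :
    eLpNorm (𝓕 f) 2 volume = eLpNorm f 2 volume := by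
  set g : Lp ℂ 2 (volume : Measure V) := h2.toLp f with hg
  have hae : ∀ᵐ x, (𝓕 g : Lp ℂ 2 (volume : Measure V)) x = 𝓕 f x := by
    refine ae_eq_of_integral_contDiff_smul_eq ?_ ?_ ?_
    · exact (Lp.memLp _).locallyIntegrable (by norm_num)
    · exact (continuous_fourier' f hf).locallyIntegrable
    · intro φ hφ hφc
      have hc : HasCompactSupport (fun x => (φ x : ℂ)) := hφc.comp_left (g := Complex.ofReal) rfl
      have hs : ContDiff ℝ ((⊤ : ℕ∞) : WithTop ℕ∞) (fun x => (φ x : ℂ)) := Complex.ofRealCLM.contDiff.comp hφ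
      set Φ : 𝓢(V, ℂ) := hc.toSchwartzMap hs with hΦ
      have hΦx : ∀ x, Φ x = (φ x : ℂ) := fun x => rfl
      have h1 := Lp.toTemperedDistribution_apply (𝓕 g : Lp ℂ 2 (volume : Measure V)) Φ
      rw [← Lp.fourier_toTemperedDistribution_eq, TemperedDistribution.fourier_apply, Lp.toTemperedDistribution_apply] at h1
      have e1 : ∀ x, φ x • (𝓕 g : Lp ℂ 2 (volume : Measure V)) x = Φ x • (𝓕 g : Lp ℂ 2 (volume : Measure V)) x := by
        intro x; rw [hΦx]; simp
      have e2 : ∀ x, φ x • 𝓕 f x = Φ x * 𝓕 f x := by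
        intro x; rw [hΦx]; simp
      simp_rw [e1, e2]
      rw [← h1, ← fourier_mul_flip _ _ Φ.integrable hf]
      refine integral_congr_ae ?_
      filter_upwards [h2.coeFn_toLp] with x hx
      rw [hg, hx, smul_eq_mul, SchwartzMap.fourier_coe]
  rw [← eLpNorm_congr_ae hae, ← eLpNorm_congr_ae h2.coeFn_toLp]
  have := Lp.norm_fourier_eq g
  rw [Lp.norm_def, Lp.norm_def] at this
  exact (ENNReal.toReal_eq_toReal_iff' (Lp.eLpNorm_ne_top _) (Lp.eLpNorm_ne_top _)).1 this

lemma plancherel_le (f : V → ℂ) (hf : Integrable f) :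
    eLpNorm (𝓕 f) 2 volume ≤ eLpNorm f 2 volume := by
  by_cases h : eLpNorm f 2 volume = ⊤
  · rw [h]; exact le_top
  · exact (plancherel f hf ⟨hf.1, lt_top_iff_ne_top.2 h⟩).le

lemma plancherel_inv_le (f : V → ℂ) (hf : Integrable f) :
    eLpNorm (𝓕⁻ f) 2 volume ≤ eLpNorm f 2 volume := by
  have e1 : 𝓕⁻ f = fun ξ => 𝓕 f (-ξ) := funext fun ξ => Real.fourierInv_eq_fourier_neg f ξ
  have := eLpNorm_comp_measurePreserving (p := 2) (continuous_fourier' f hf).aestronglyMeasurable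
    (Measure.measurePreserving_neg (volume : Measure V))
  rw [e1]
  exact (le_of_eq this).trans (plancherel_le f hf)

end planch
end DS

namespace DS

lemma convex_1d (p : ℝ) (hp1 : 1 < p) (hp2 : p ≤ 2) (M : ℝ) (hM : 0 < M) :
    ConvexOn ℝ (Set.Icc 0 M) (fun t : ℝ => t ^ p - p * (p - 1) / 2 * M ^ (p - 2) * t ^ 2) := by
  have hd : ∀ t : ℝ, 0 < t → HasDerivAt (fun t : ℝ => t ^ p - p * (p - 1) / 2 * M ^ (p - 2) * t ^ 2)
      (p * t ^ (p - 1) - p * (p - 1) / 2 * M ^ (p - 2) * (2 * t)) t := by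
    intro t ht
    have h1 := Real.hasDerivAt_rpow_const (x := t) (p := p) (Or.inl ht.ne')
    have h2 := (hasDerivAt_pow 2 t).const_mul (p * (p - 1) / 2 * M ^ (p - 2))
    have h3 := h1.fun_sub h2
    simp only [Nat.cast_ofNat, Nat.add_one_sub_one, pow_one] at h3
    exact h3
  have hd2 : ∀ t : ℝ, 0 < t → HasDerivAt (fun t : ℝ => p * t ^ (p - 1) - p * (p - 1) / 2 * M ^ (p - 2) * (2 * t))
      (p * ((p - 1) * t ^ (p - 1 - 1)) - p * (p - 1) / 2 * M ^ (p - 2) * (2 * 1)) t := by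
    intro t ht
    have h1 := (Real.hasDerivAt_rpow_const (x := t) (p := p - 1) (Or.inl ht.ne')).const_mul p
    have h2 := ((hasDerivAt_id t).const_mul 2).const_mul (p * (p - 1) / 2 * M ^ (p - 2))
    exact h1.sub h2
  refine convexOn_of_hasDerivWithinAt2_nonneg (convex_Icc 0 M)
    (f' := fun t => p * t ^ (p - 1) - p * (p - 1) / 2 * M ^ (p - 2) * (2 * t))
    (f'' := fun t => p * ((p - 1) * t ^ (p - 1 - 1)) - p * (p - 1) / 2 * M ^ (p - 2) * (2 * 1)) ?_ ?_ ?_ ?_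
  · have : Continuous (fun t : ℝ => t ^ p) := Real.continuous_rpow_const (by linarith)
    fun_prop
  · intro t ht
    rw [interior_Icc] at ht
    exact (hd t ht.1).hasDerivWithinAt
  · intro t ht
    rw [interior_Icc] at ht
    exact (hd2 t ht.1).hasDerivWithinAt
  · intro t ht
    rw [interior_Icc] at ht
    have h1 : M ^ (p - 2) ≤ t ^ (p - 2) := Real.rpow_le_rpow_of_nonpos ht.1 ht.2.le (by linarith)
    have e : p - 1 - 1 = p - 2 := by ring
    rw [e]
    have : 0 ≤ p * (p - 1) * (t ^ (p - 2) - M ^ (p - 2)) := by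
      refine mul_nonneg (mul_nonneg (by linarith) (by linarith)) (by linarith)
    linarith

lemma tangent_1d (p : ℝ) (hp1 : 1 < p) (hp2 : p ≤ 2) (α β : ℝ) (hα : 0 ≤ α) (hβ : 0 < β) :
    β ^ p + p * β ^ (p - 1) * (α - β) + p * (p - 1) / 2 * (α - β) ^ 2 * (α + β) ^ (p - 2) ≤ α ^ p := by
  rcases hα.eq_or_lt with rfl | hα
  · have h1 : β ^ (p - 1) * β = β ^ p := by rw [← Real.rpow_add_one hβ.ne']; ring_nf
    have h2 : β ^ (p - 2) * β ^ 2 = β ^ p := by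
      rw [← Real.rpow_natCast β 2, ← Real.rpow_add hβ]; push_cast; ring_nf
    have h3 : (0:ℝ) ^ p = 0 := Real.zero_rpow (by linarith)
    rw [h3, zero_add, zero_sub]
    have h0 : 0 < β ^ p := by positivity
    have : β ^ p + p * β ^ (p - 1) * (-β) + p * (p - 1) / 2 * (-β) ^ 2 * β ^ (p - 2) = β ^ p * (1 - p + p * (p-1)/2) := by
      linear_combination (-p) * h1 + (p * (p - 1) / 2) * h2
    rw [this]
    exact mul_nonpos_of_nonneg_of_nonpos h0.le (by nlinarith)
  have hM : 0 < α + β := by positivity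
  have hc := convex_1d p hp1 hp2 (α + β) hM
  have hder : HasDerivAt (fun t : ℝ => t ^ p - p * (p - 1) / 2 * (α + β) ^ (p - 2) * t ^ 2)
      (p * β ^ (p - 1) - p * (p - 1) / 2 * (α + β) ^ (p - 2) * (2 * β)) β := by
    have h1 := Real.hasDerivAt_rpow_const (x := β) (p := p) (Or.inl hβ.ne')
    have h2 := (hasDerivAt_pow 2 β).const_mul (p * (p - 1) / 2 * (α + β) ^ (p - 2))
    have h3 := h1.fun_sub h2
    simp only [Nat.cast_ofNat, Nat.add_one_sub_one, pow_one] at h3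
    exact h3
  rcases lt_trichotomy α β with h | h | h
  · have := hc.slope_le_of_hasDerivAt (x := α) (y := β) ⟨hα.le, by linarith⟩ ⟨hβ.le, by linarith⟩ h hder
    rw [slope_def_field, div_le_iff₀ (by linarith)] at this
    linear_combination this
  · subst h; simp
  · have := hc.le_slope_of_hasDerivAt (x := β) (y := α) ⟨hβ.le, by linarith⟩ ⟨hα.le, by linarith⟩ h hder
    rw [slope_def_field, le_div_iff₀ (by linarith)] at this
    linear_combination this

lemma unif_conv (p : ℝ) (hp1 : 1 < p) (hp2 : p ≤ 2) (a b : ℂ) :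
    ‖b‖ ^ p + p * ‖b‖ ^ (p - 2) * ((starRingEnd ℂ) b * (a - b)).re +
      p * (p - 1) / 2 * (‖a - b‖ ^ 2 * (‖a‖ + ‖b‖) ^ (p - 2)) ≤ ‖a‖ ^ p := by
  rcases eq_or_ne b 0 with rfl | hb
  · have h3 : (0:ℝ) ^ p = 0 := Real.zero_rpow (by linarith)
    simp only [norm_zero, h3, map_zero, zero_mul, zero_re, mul_zero, zero_add, sub_zero, add_zero]
    rcases eq_or_ne a 0 with rfl | ha
    · simp [h3]
    · have ha' : 0 < ‖a‖ := norm_pos_iff.2 ha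
      have h2 : ‖a‖ ^ 2 * ‖a‖ ^ (p - 2) = ‖a‖ ^ p := by
        rw [← Real.rpow_natCast ‖a‖ 2, ← Real.rpow_add ha']; push_cast; ring_nf
      rw [h2]
      have : 0 < ‖a‖ ^ p := by positivity
      have h1 : p * (p - 1) / 2 ≤ 1 := by nlinarith
      nlinarith
  have hb' : 0 < ‖b‖ := norm_pos_iff.2 hb
  have ht := tangent_1d p hp1 hp2 ‖a‖ ‖b‖ (norm_nonneg _) hb'
  have hs : ((starRingEnd ℂ) b * a).re ≤ ‖a‖ * ‖b‖ := by
    refine (re_le_norm _).trans ?_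
    rw [norm_mul, RCLike.norm_conj, mul_comm]
  have e1 : ((starRingEnd ℂ) b * (a - b)).re = ((starRingEnd ℂ) b * a).re - ‖b‖ ^ 2 := by
    rw [mul_sub, sub_re, ← normSq_eq_conj_mul_self, ofReal_re, normSq_eq_norm_sq]
  have e2 : ‖a - b‖ ^ 2 = ‖a‖ ^ 2 + ‖b‖ ^ 2 - 2 * ((starRingEnd ℂ) b * a).re := by
    rw [← normSq_eq_norm_sq, normSq_sub, normSq_eq_norm_sq, normSq_eq_norm_sq, mul_comm a]
  rw [e1, e2]
  generalize ((starRingEnd ℂ) b * a).re = s at *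
  have h4 : ‖b‖ ^ (p - 1) = ‖b‖ ^ (p - 2) * ‖b‖ := by rw [← Real.rpow_add_one hb'.ne']; ring_nf
  rw [h4] at ht
  have h5 : (‖a‖ + ‖b‖) ^ (p - 2) ≤ ‖b‖ ^ (p - 2) :=
    Real.rpow_le_rpow_of_nonpos hb' (by linarith [norm_nonneg a]) (by linarith)
  have h6 : 0 ≤ (‖a‖ + ‖b‖) ^ (p - 2) := by positivity
  have h7 : 0 ≤ (‖a‖ * ‖b‖ - s) * (p * ‖b‖ ^ (p - 2) - p * (p - 1) * (‖a‖ + ‖b‖) ^ (p - 2)) := by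
    refine mul_nonneg (by linarith) ?_
    have : p * (p - 1) * (‖a‖ + ‖b‖) ^ (p - 2) ≤ p * 1 * ‖b‖ ^ (p - 2) := by
      gcongr; linarith
    linarith
  nlinarith

end DS

namespace DS

section avg
variable {V : Type*} [NormedAddCommGroup V] [InnerProductSpace ℝ V] [FiniteDimensional ℝ V]
  [MeasurableSpace V] [BorelSpace V]

/-- bounded measurable integrable functions -/
structure Nice (f : V → ℂ) : Prop where
  meas : Measurable f
  bdd : ∃ M : ℝ, ∀ x, ‖f x‖ ≤ M
  int : Integrable f

/-- averaging against a probability measure -/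
def Bop (μ : Measure V) (f : V → ℂ) (x : V) : ℂ := ∫ y, f (x - y) ∂μ

lemma ofReal_norm_rpow (z : ℂ) (p : ℝ) (hp : 0 ≤ p) : ENNReal.ofReal (‖z‖ ^ p) = ‖z‖ₑ ^ p := by
  rw [← ENNReal.ofReal_rpow_of_nonneg (norm_nonneg _) hp, ofReal_norm]

lemma jensen_ennreal {α : Type*} [MeasurableSpace α] (μ : Measure α) [IsProbabilityMeasure μ] (p : ℝ)
    (hp : 1 ≤ p) (g : α → ℝ≥0∞) (hg : Measurable g) : (∫⁻ a, g a ∂μ) ^ p ≤ ∫⁻ a, g a ^ p ∂μ := by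
  have h := ENNReal.lintegral_mul_norm_pow_le (μ := μ) (f := fun a => g a ^ p) (g := fun _ => 1)
    (by fun_prop) (by fun_prop) (p := 1 / p) (q := 1 - 1 / p) (by positivity)
    (by rw [sub_nonneg, div_le_one (by linarith)]; exact hp) (by ring)
  simp only [ENNReal.one_rpow, mul_one, lintegral_const, measure_univ] at h
  have e : ∀ a, (g a ^ p) ^ (1 / p) = g a := fun a => by
    rw [← ENNReal.rpow_mul, mul_one_div_cancel (by linarith), ENNReal.rpow_one]
  simp_rw [e] at h
  calc _ ≤ ((∫⁻ a, g a ^ p ∂μ) ^ (1 / p)) ^ p := by gcongr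
    _ = _ := by rw [← ENNReal.rpow_mul, one_div_mul_cancel (by linarith), ENNReal.rpow_one]

variable (μ : Measure V) [IsProbabilityMeasure μ]

lemma shift_lintegral (φ : V → ℝ≥0∞) (hφ : Measurable φ) :
    ∫⁻ x, ∫⁻ y, φ (x - y) ∂μ = ∫⁻ x, φ x := by
  rw [lintegral_lintegral_swap (by unfold Function.uncurry; fun_prop)]
  simp_rw [lintegral_sub_right_eq_self (fun x => φ x)]
  simp

lemma Bop_meas {f : V → ℂ} (hf : Measurable f) : Measurable (Bop μ f) := by
  have : StronglyMeasurable (fun z : V × V => f (z.1 - z.2)) :=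
    (hf.comp (measurable_fst.sub measurable_snd)).stronglyMeasurable
  exact this.integral_prod_right'.measurable

lemma integrable_shift {f : V → ℂ} (hf : Nice f) (x : V) : Integrable (fun y => f (x - y)) μ := by
  obtain ⟨M, hM⟩ := hf.bdd
  have := hf.meas
  exact Integrable.of_bound (Measurable.aestronglyMeasurable (by fun_prop)) M (ae_of_all _ fun y => hM _)

lemma Bop_nice {f : V → ℂ} (hf : Nice f) : Nice (Bop μ f) := by
  refine ⟨Bop_meas μ hf.meas, ?_, ?_⟩
  · obtain ⟨M, hM⟩ := hf.bdd
    refine ⟨M, fun x => ?_⟩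
    have := norm_integral_le_of_norm_le_const (μ := μ) (f := fun y => f (x - y)) (C := M) (ae_of_all _ fun y => hM _)
    simpa [Bop] using this
  · refine ⟨(Bop_meas μ hf.meas).aestronglyMeasurable, ?_⟩
    rw [HasFiniteIntegral]
    have hm : Measurable (fun x => ‖f x‖ₑ) := hf.meas.enorm
    calc _ ≤ ∫⁻ x, ∫⁻ y, ‖f (x - y)‖ₑ ∂μ := by
          gcongr with x
          exact enorm_integral_le_lintegral_enorm _
      _ = ∫⁻ x, ‖f x‖ₑ := shift_lintegral μ _ hm
      _ < ⊤ := hf.int.2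

/-- the defect functional -/
def Df (μ : Measure V) (p : ℝ) (u : V → ℂ) : ℝ≥0∞ :=
  ∫⁻ x, ∫⁻ y, ENNReal.ofReal (‖u (x - y) - Bop μ u x‖ ^ 2 * (‖u (x - y)‖ + ‖Bop μ u x‖) ^ (p - 2)) ∂μ

lemma step_one (p : ℝ) (hp1 : 1 < p) (hp2 : p ≤ 2) {u : V → ℂ} (hu : Nice u) :
    ENNReal.ofReal (p * (p - 1) / 2) * Df μ p u + ∫⁻ x, ‖Bop μ u x‖ₑ ^ p ≤ ∫⁻ x, ‖u x‖ₑ ^ p := by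
  have hBm := Bop_meas μ hu.meas
  have hum := hu.meas
  have hc : 0 ≤ p * (p - 1) / 2 := by
    have : 0 ≤ p * (p - 1) := mul_nonneg (by linarith) (by linarith)
    linarith
  obtain ⟨M, hM⟩ := hu.bdd
  have key : ∀ x, ENNReal.ofReal (p * (p - 1) / 2) * (∫⁻ y, ENNReal.ofReal (‖u (x - y) - Bop μ u x‖ ^ 2 * (‖u (x - y)‖ + ‖Bop μ u x‖) ^ (p - 2)) ∂μ)
      + ‖Bop μ u x‖ₑ ^ p ≤ ∫⁻ y, ‖u (x - y)‖ₑ ^ p ∂μ := by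
    intro x
    set b := Bop μ u x with hb
    have hui := integrable_shift μ hu x
    have hup : Integrable (fun y => ‖u (x - y)‖ ^ p) μ := by
      refine Integrable.of_bound (Measurable.aestronglyMeasurable (by fun_prop)) (M ^ p) (ae_of_all _ fun y => ?_)
      rw [Real.norm_of_nonneg (by positivity)]
      gcongr
      exact hM _
    have hlin : Integrable (fun y => ((starRingEnd ℂ) b * (u (x - y) - b)).re) μ :=
      ((hui.sub (integrable_const b)).const_mul _).re
    have hlin0 : ∫ y, ((starRingEnd ℂ) b * (u (x - y) - b)).re ∂μ = 0 := by
      have h1 := integral_re (((hui.sub (integrable_const b)).const_mul ((starRingEnd ℂ) b)))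
      simp only [Pi.sub_apply, RCLike.re_eq_complex_re] at h1
      refine h1.trans ?_
      rw [integral_const_mul, integral_sub hui (integrable_const b)]
      have : ∫ y, u (x - y) ∂μ = b := rfl
      rw [this]
      simp
    have hR : Integrable (fun y => ‖u (x - y)‖ ^ p - ‖b‖ ^ p - p * ‖b‖ ^ (p - 2) * ((starRingEnd ℂ) b * (u (x - y) - b)).re) μ :=
      (hup.sub (integrable_const _)).sub (hlin.const_mul _)
    have hpt : ∀ y, p * (p - 1) / 2 * (‖u (x - y) - b‖ ^ 2 * (‖u (x - y)‖ + ‖b‖) ^ (p - 2)) ≤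
        ‖u (x - y)‖ ^ p - ‖b‖ ^ p - p * ‖b‖ ^ (p - 2) * ((starRingEnd ℂ) b * (u (x - y) - b)).re := by
      intro y
      have := unif_conv p hp1 hp2 (u (x - y)) b
      linarith
    have h0 : ∀ y, 0 ≤ ‖u (x - y)‖ ^ p - ‖b‖ ^ p - p * ‖b‖ ^ (p - 2) * ((starRingEnd ℂ) b * (u (x - y) - b)).re :=
      fun y => le_trans (by positivity) (hpt y)
    have hI : ∫ y, (‖u (x - y)‖ ^ p - ‖b‖ ^ p - p * ‖b‖ ^ (p - 2) * ((starRingEnd ℂ) b * (u (x - y) - b)).re) ∂μ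
        = (∫ y, ‖u (x - y)‖ ^ p ∂μ) - ‖b‖ ^ p := by
      have hs : Integrable (fun y => ‖u (x - y)‖ ^ p - ‖b‖ ^ p) μ := hup.sub (integrable_const _)
      rw [integral_sub hs (hlin.const_mul _), integral_sub hup (integrable_const _),
        integral_const_mul, hlin0]
      simp
    have hI0 : 0 ≤ (∫ y, ‖u (x - y)‖ ^ p ∂μ) - ‖b‖ ^ p := by
      rw [← hI]; exact integral_nonneg h0
    rw [← lintegral_const_mul _ (by fun_prop)]
    calc _ ≤ (∫⁻ y, ENNReal.ofReal (‖u (x - y)‖ ^ p - ‖b‖ ^ p - p * ‖b‖ ^ (p - 2) * ((starRingEnd ℂ) b * (u (x - y) - b)).re) ∂μ) + ‖b‖ₑ ^ p := by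
          gcongr with y
          rw [← ENNReal.ofReal_mul hc]
          exact ENNReal.ofReal_le_ofReal (hpt y)
      _ = ENNReal.ofReal ((∫ y, ‖u (x - y)‖ ^ p ∂μ) - ‖b‖ ^ p) + ENNReal.ofReal (‖b‖ ^ p) := by
          rw [← hI, ofReal_integral_eq_lintegral_ofReal hR (ae_of_all _ h0), ofReal_norm_rpow _ _ (by linarith)]
      _ = ENNReal.ofReal (∫ y, ‖u (x - y)‖ ^ p ∂μ) := by
          rw [← ENNReal.ofReal_add hI0 (by positivity)]; congr 1; ring
      _ = ∫⁻ y, ENNReal.ofReal (‖u (x - y)‖ ^ p) ∂μ :=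
          ofReal_integral_eq_lintegral_ofReal hup (ae_of_all _ fun y => by positivity)
      _ = _ := by simp_rw [ofReal_norm_rpow _ p (by linarith : 0 ≤ p)]
  have hm : Measurable (fun x => ‖u x‖ₑ ^ p) := by fun_prop
  rw [Df, ← shift_lintegral μ (fun x => ‖u x‖ₑ ^ p) hm, ← lintegral_const_mul, ← lintegral_add_right _ (by fun_prop)]
  · exact lintegral_mono key
  · exact Measurable.lintegral_prod_right' (f := fun z : V × V => ENNReal.ofReal (‖u (z.1 - z.2) - Bop μ u z.1‖ ^ 2 * (‖u (z.1 - z.2)‖ + ‖Bop μ u z.1‖) ^ (p - 2))) (by fun_prop)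

lemma Bop_Lp (p : ℝ) (hp1 : 1 < p) (hp2 : p ≤ 2) {u : V → ℂ} (hu : Nice u) :
    ∫⁻ x, ‖Bop μ u x‖ₑ ^ p ≤ ∫⁻ x, ‖u x‖ₑ ^ p :=
  le_trans (le_add_self) (step_one μ p hp1 hp2 hu)

lemma step_two (hμ : μ.map (fun y => -y) = μ) (p : ℝ) (hp1 : 1 < p) (hp2 : p ≤ 2) {u : V → ℂ} (hu : Nice u) :
    ∫⁻ x, ‖u x - Bop μ (Bop μ u) x‖ₑ ^ p ≤ (Df μ p u) ^ (p / 2) * (2 ^ p * ∫⁻ x, ‖u x‖ₑ ^ p) ^ (1 - p / 2) := by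
  have hB := Bop_nice μ hu
  have hBm := hB.meas
  have hum := hu.meas
  have h1 : ∀ x, ‖u x - Bop μ (Bop μ u) x‖ₑ ^ p ≤ ∫⁻ y, ‖u x - Bop μ u (x - y)‖ₑ ^ p ∂μ := by
    intro x
    have e : u x - Bop μ (Bop μ u) x = ∫ y, (u x - Bop μ u (x - y)) ∂μ := by
      rw [integral_sub (integrable_const _) (integrable_shift μ hB x)]
      simp [Bop]
    rw [e]
    calc _ ≤ (∫⁻ y, ‖u x - Bop μ u (x - y)‖ₑ ∂μ) ^ p := by
          gcongr; exact enorm_integral_le_lintegral_enorm _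
      _ ≤ _ := jensen_ennreal μ p hp1.le _ (by fun_prop)
  have h2 : ∫⁻ x, ∫⁻ y, ‖u x - Bop μ u (x - y)‖ₑ ^ p ∂μ = ∫⁻ x, ∫⁻ y, ‖u (x - y) - Bop μ u x‖ₑ ^ p ∂μ := by
    rw [lintegral_lintegral_swap (f := fun x y => ‖u x - Bop μ u (x - y)‖ₑ ^ p) (by unfold Function.uncurry; fun_prop),
      lintegral_lintegral_swap (f := fun x y => ‖u (x - y) - Bop μ u x‖ₑ ^ p) (by unfold Function.uncurry; fun_prop)]
    have e1 : ∀ y, ∫⁻ x, ‖u x - Bop μ u (x - y)‖ₑ ^ p = ∫⁻ x, ‖u (x - -y) - Bop μ u x‖ₑ ^ p := by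
      intro y
      rw [← lintegral_sub_right_eq_self (fun x => ‖u x - Bop μ u (x - y)‖ₑ ^ p) (-y)]
      simp
    rw [lintegral_congr e1]
    have hm : Measurable (fun y => ∫⁻ x, ‖u (x - y) - Bop μ u x‖ₑ ^ p) :=
      Measurable.lintegral_prod_left' (f := fun z : V × V => ‖u (z.1 - z.2) - Bop μ u z.1‖ₑ ^ p) (by fun_prop)
    have h3 := lintegral_map (μ := μ) hm (measurable_neg (G := V))
    have h4 : μ.map (Neg.neg : V → V) = μ := hμ
    rw [h4] at h3
    exact h3.symm
  have hw : ∫⁻ z, ENNReal.ofReal ((‖u (z.1 - z.2)‖ + ‖Bop μ u z.1‖) ^ p) ∂(volume.prod μ) ≤ 2 ^ p * ∫⁻ x, ‖u x‖ₑ ^ p := by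
    calc _ ≤ ∫⁻ z, 2 ^ (p - 1) * (‖u (z.1 - z.2)‖ₑ ^ p + ‖Bop μ u z.1‖ₑ ^ p) ∂(volume.prod μ) := by
          gcongr with z
          rw [← ENNReal.ofReal_rpow_of_nonneg (by positivity) (by linarith), ENNReal.ofReal_add (by positivity) (by positivity),
            ofReal_norm, ofReal_norm]
          exact ENNReal.rpow_add_le_mul_rpow_add_rpow _ _ hp1.le
      _ = 2 ^ (p - 1) * ((∫⁻ z, ‖u (z.1 - z.2)‖ₑ ^ p ∂(volume.prod μ)) + ∫⁻ z, ‖Bop μ u z.1‖ₑ ^ p ∂(volume.prod μ)) := by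
          rw [lintegral_const_mul _ (by fun_prop), lintegral_add_right _ (by fun_prop)]
      _ ≤ 2 ^ (p - 1) * ((∫⁻ x, ‖u x‖ₑ ^ p) + ∫⁻ x, ‖u x‖ₑ ^ p) := by
          gcongr
          · rw [lintegral_prod _ (by fun_prop)]
            exact (shift_lintegral μ (fun x => ‖u x‖ₑ ^ p) (by fun_prop)).le
          · rw [lintegral_prod _ (by fun_prop)]
            simp only [lintegral_const, measure_univ, mul_one]
            exact Bop_Lp μ p hp1 hp2 hu
      _ = _ := by
          rw [← two_mul, ← mul_assoc]
          congr 1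
          nth_rw 2 [← ENNReal.rpow_one 2]
          rw [← ENNReal.rpow_add _ _ (by norm_num) (by norm_num)]
          ring_nf
  calc _ ≤ ∫⁻ x, ∫⁻ y, ‖u x - Bop μ u (x - y)‖ₑ ^ p ∂μ := lintegral_mono h1
    _ = ∫⁻ x, ∫⁻ y, ‖u (x - y) - Bop μ u x‖ₑ ^ p ∂μ := h2
    _ = ∫⁻ z, ‖u (z.1 - z.2) - Bop μ u z.1‖ₑ ^ p ∂(volume.prod μ) := by
        rw [lintegral_prod _ (by fun_prop)]
    _ ≤ ∫⁻ z, (ENNReal.ofReal (‖u (z.1 - z.2) - Bop μ u z.1‖ ^ 2 * (‖u (z.1 - z.2)‖ + ‖Bop μ u z.1‖) ^ (p - 2))) ^ (p / 2) *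
          (ENNReal.ofReal ((‖u (z.1 - z.2)‖ + ‖Bop μ u z.1‖) ^ p)) ^ (1 - p / 2) ∂(volume.prod μ) := by
        gcongr with z
        generalize hA : u (z.1 - z.2) = A
        generalize hB' : Bop μ u z.1 = B
        have hd : ‖A - B‖ ≤ ‖A‖ + ‖B‖ := norm_sub_le _ _
        rcases (by positivity : 0 ≤ ‖A‖ + ‖B‖).eq_or_lt with h | h
        · rw [← h] at hd
          have : A - B = 0 := norm_eq_zero.1 (le_antisymm hd (norm_nonneg _))
          rw [this]
          simp only [enorm_zero]
          rw [ENNReal.zero_rpow_of_pos (by linarith)]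
          exact zero_le
        · rw [ENNReal.ofReal_rpow_of_nonneg (by positivity) (by linarith), ENNReal.ofReal_rpow_of_nonneg (by positivity) (by linarith),
            ← ENNReal.ofReal_mul (by positivity), ← ofReal_norm_rpow _ _ (by linarith)]
          apply ENNReal.ofReal_le_ofReal
          rw [Real.mul_rpow (by positivity) (by positivity), ← Real.rpow_natCast, ← Real.rpow_mul (norm_nonneg _),
            ← Real.rpow_mul h.le, ← Real.rpow_mul h.le, mul_assoc, ← Real.rpow_add h]
          have e1 : ((2:ℕ):ℝ) * (p / 2) = p := by push_cast; ring
          have e2 : (p - 2) * (p / 2) + p * (1 - p / 2) = 0 := by ring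
          rw [e1, e2, Real.rpow_zero, mul_one]
    _ ≤ (∫⁻ z, (ENNReal.ofReal (‖u (z.1 - z.2) - Bop μ u z.1‖ ^ 2 * (‖u (z.1 - z.2)‖ + ‖Bop μ u z.1‖) ^ (p - 2))) ∂(volume.prod μ)) ^ (p / 2) *
          (∫⁻ z, (ENNReal.ofReal ((‖u (z.1 - z.2)‖ + ‖Bop μ u z.1‖) ^ p)) ∂(volume.prod μ)) ^ (1 - p / 2) :=
        ENNReal.lintegral_mul_norm_pow_le (by fun_prop) (by fun_prop) (by linarith) (by linarith) (by ring)
    _ ≤ _ := by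
        rw [Df, lintegral_prod _ (by fun_prop)]
        have : 0 ≤ 1 - p / 2 := by linarith
        gcongr

end avg
end DS

namespace DS

section gauss
variable {V : Type*} [NormedAddCommGroup V] [InnerProductSpace ℝ V] [FiniteDimensional ℝ V]
  [MeasurableSpace V] [BorelSpace V]

/-- centred Gaussian with characteristic function `exp (-a ‖t‖²)` -/
def gm (V : Type*) [NormedAddCommGroup V] [InnerProductSpace ℝ V] [FiniteDimensional ℝ V]
  [MeasurableSpace V] [BorelSpace V] (a : ℝ) : Measure V :=
  (ProbabilityTheory.stdGaussian V).map (fun x => Real.sqrt (2 * a) • x)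

instance gm_prob (a : ℝ) : IsProbabilityMeasure (gm V a) :=
  Measure.isProbabilityMeasure_map (Measurable.aemeasurable (by fun_prop))

lemma gm_charFun (a : ℝ) (ha : 0 ≤ a) (t : V) : charFun (gm V a) t = cexp (-(a * ‖t‖ ^ 2 : ℝ)) := by
  rw [gm, charFun_map_smul, ProbabilityTheory.charFun_stdGaussian, norm_smul]
  congr 1
  rw [Real.norm_of_nonneg (Real.sqrt_nonneg _), ← ofReal_pow, mul_pow, Real.sq_sqrt (by linarith)]
  push_cast
  ring

lemma gm_symm (a : ℝ) (ha : 0 ≤ a) : (gm V a).map (fun y => -y) = gm V a := by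
  apply Measure.ext_of_charFun
  ext t
  have : (fun y : V => -y) = fun y => (-1 : ℝ) • y := by ext; simp
  rw [this, charFun_map_smul, gm_charFun a ha, gm_charFun a ha]
  simp

lemma gm_conv (a b : ℝ) (ha : 0 ≤ a) (hb : 0 ≤ b) : (gm V a) ∗ (gm V b) = gm V (a + b) := by
  apply Measure.ext_of_charFun
  ext t
  rw [charFun_conv, gm_charFun a ha, gm_charFun b hb, gm_charFun _ (by linarith), ← Complex.exp_add]
  congr 1
  push_cast
  ring

lemma Bop_comp (a b : ℝ) (ha : 0 ≤ a) (hb : 0 ≤ b) {f : V → ℂ} (hf : Nice f) :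
    Bop (gm V a) (Bop (gm V b) f) = Bop (gm V (a + b)) f := by
  ext x
  unfold Bop
  rw [← gm_conv a b ha hb, integral_conv]
  · simp_rw [sub_sub]
  · rw [gm_conv a b ha hb]
    exact integrable_shift _ hf x

lemma Bop_fourier (a : ℝ) (ha : 0 ≤ a) {f : V → ℂ} (hf : Nice f) (ξ : V) :
    𝓕 (Bop (gm V a) f) ξ = (Real.exp (-(4 * Real.pi ^ 2 * a * ‖ξ‖ ^ 2)) : ℝ) * 𝓕 f ξ := by
  have hfm := hf.meas
  have hc : (∫ y, cexp (-(2 * Real.pi * inner ℝ y ξ * I : ℂ)) ∂(gm V a)) = (Real.exp (-(4 * Real.pi ^ 2 * a * ‖ξ‖ ^ 2)) : ℝ) := by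
    have := gm_charFun a ha ((-(2 * Real.pi)) • ξ)
    rw [charFun_apply, norm_smul] at this
    rw [Complex.ofReal_exp]
    refine Eq.trans ?_ (this.trans ?_)
    · congr 1; ext y; rw [inner_smul_right]; congr 1; push_cast; ring
    · congr 1
      rw [mul_pow, Real.norm_eq_abs, sq_abs]
      push_cast; ring
  rw [← hc, Real.fourier_eq']
  simp_rw [Real.fourier_eq', smul_eq_mul]
  unfold Bop
  have h_intg : Integrable (fun z : V × V => cexp (↑(-2 * Real.pi * inner ℝ z.1 ξ) * I) * f (z.1 - z.2)) (volume.prod (gm V a)) := by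
    have h1 : Integrable (fun z : V × V => f (z.1 - z.2)) (volume.prod (gm V a)) := by
      refine ⟨Measurable.aestronglyMeasurable (by fun_prop), ?_⟩
      rw [HasFiniteIntegral, lintegral_prod _ (by fun_prop), shift_lintegral (gm V a) (fun x => ‖f x‖ₑ) (by fun_prop)]
      exact hf.int.2
    refine h1.bdd_mul (c := 1) (Measurable.aestronglyMeasurable (by fun_prop)) (ae_of_all _ fun z => ?_)
    rw [Complex.norm_exp_ofReal_mul_I]
  have e0 : ∀ v, cexp (↑(-2 * Real.pi * inner ℝ v ξ) * I) * ∫ y, f (v - y) ∂(gm V a) =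
      ∫ y, cexp (↑(-2 * Real.pi * inner ℝ v ξ) * I) * f (v - y) ∂(gm V a) := fun v => (integral_const_mul _ _).symm
  simp_rw [e0]
  rw [integral_integral_swap h_intg, ← integral_mul_const]
  congr 1
  ext y
  rw [← integral_const_mul, ← integral_sub_right_eq_self (fun x => cexp (-(2 * Real.pi * inner ℝ y ξ * I : ℂ)) * (cexp (↑(-2 * Real.pi * inner ℝ x ξ) * I) * f x)) y]
  congr 1
  ext x
  rw [← mul_assoc, ← Complex.exp_add, inner_sub_left]
  congr 2
  push_cast
  ring

/-- scale parameters -/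
def aj (j : ℤ) : ℝ := (4 : ℝ) ^ (-j)
lemma aj_pos (j : ℤ) : 0 < aj j := by unfold aj; positivity
lemma aj_succ (j : ℤ) : aj j = 4 * aj (j + 1) := by
  unfold aj
  rw [neg_add, zpow_add₀ (by norm_num)]
  norm_num
  ring
/-- Littlewood–Paley pieces -/
def LPu (j : ℤ) (f : V → ℂ) : V → ℂ := Bop (gm V (aj (j + 1))) f
def LP (j : ℤ) (f : V → ℂ) (x : V) : ℂ :=
  LPu j f x - Bop (gm V (3 * aj (j + 1))) (Bop (gm V (3 * aj (j + 1))) (LPu j f)) x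

/-- multiplier of the pieces -/
def LPm (j : ℤ) (ρ : ℝ) : ℝ := Real.exp (-(4 * Real.pi ^ 2 * aj (j + 1) * ρ ^ 2)) *
  (1 - Real.exp (-(4 * Real.pi ^ 2 * (6 * aj (j + 1)) * ρ ^ 2)))

lemma LPu_nice (j : ℤ) {f : V → ℂ} (hf : Nice f) : Nice (LPu j f) := Bop_nice _ hf

lemma Bop_LPu (j : ℤ) {f : V → ℂ} (hf : Nice f) : Bop (gm V (3 * aj (j + 1))) (LPu j f) = LPu (j - 1) f := by
  have := aj_pos (j + 1)
  rw [LPu, Bop_comp _ _ (by linarith) (by linarith) hf, LPu]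
  congr 2
  rw [sub_add_cancel, aj_succ j]; ring

lemma Nice.sub {f g : V → ℂ} (hf : Nice f) (hg : Nice g) : Nice (fun x => f x - g x) := by
  obtain ⟨M, hM⟩ := hf.bdd
  obtain ⟨M', hM'⟩ := hg.bdd
  exact ⟨hf.meas.sub hg.meas, ⟨M + M', fun x => (norm_sub_le _ _).trans (add_le_add (hM x) (hM' x))⟩, hf.int.sub hg.int⟩

lemma LP_nice (j : ℤ) {f : V → ℂ} (hf : Nice f) : Nice (LP j f) :=
  (LPu_nice j hf).sub (Bop_nice _ (Bop_nice _ (LPu_nice j hf)))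

lemma LP_fourier (j : ℤ) {f : V → ℂ} (hf : Nice f) (ξ : V) : 𝓕 (LP j f) ξ = (LPm j ‖ξ‖ : ℝ) * 𝓕 f ξ := by
  have ha := aj_pos (j + 1)
  have h1 := LPu_nice j hf
  have h2 := Bop_nice (gm V (3 * aj (j + 1))) h1
  have h3 := Bop_nice (gm V (3 * aj (j + 1))) h2
  have e : 𝓕 (LP j f) ξ = 𝓕 (LPu j f) ξ - 𝓕 (Bop (gm V (3 * aj (j + 1))) (Bop (gm V (3 * aj (j + 1))) (LPu j f))) ξ := by
    simp_rw [Real.fourier_eq']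
    rw [← integral_sub]
    · congr 1; ext x; simp only [LP, smul_eq_mul]; ring
    · refine h1.int.bdd_mul (c := 1) (Measurable.aestronglyMeasurable (by fun_prop)) (ae_of_all _ fun z => ?_)
      rw [Complex.norm_exp_ofReal_mul_I]
    · refine h3.int.bdd_mul (c := 1) (Measurable.aestronglyMeasurable (by fun_prop)) (ae_of_all _ fun z => ?_)
      rw [Complex.norm_exp_ofReal_mul_I]
  rw [e, Bop_comp _ _ (by linarith) (by linarith) h1, Bop_fourier _ (by linarith) h1, LPu, Bop_fourier _ ha.le hf, LPm]
  push_cast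
  ring_nf

lemma LP_Lp_fin (p : ℝ) (hp1 : 1 < p) {f : V → ℂ} (hf : Nice f) : ∫⁻ x, ‖f x‖ₑ ^ p < ⊤ := by
  obtain ⟨M, hM⟩ := hf.bdd
  calc _ ≤ ∫⁻ x, (ENNReal.ofReal M) ^ (p - 1) * ‖f x‖ₑ := by
        gcongr with x
        have e : ‖f x‖ₑ ^ p = ‖f x‖ₑ ^ (p - 1) * ‖f x‖ₑ := by
          conv_rhs => rw [← ENNReal.rpow_one (‖f x‖ₑ), ← ENNReal.rpow_mul, ← ENNReal.rpow_add_of_nonneg _ _ (by linarith) (by linarith)]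
          ring_nf
        rw [e]
        have hp0 : 0 ≤ p - 1 := by linarith
        gcongr
        · rw [← ofReal_norm]; exact ENNReal.ofReal_le_ofReal (hM x)
    _ < ⊤ := by
        rw [lintegral_const_mul _ hf.meas.enorm]
        exact ENNReal.mul_lt_top (ENNReal.rpow_lt_top_of_nonneg (by linarith) ENNReal.ofReal_ne_top) hf.int.2

lemma LP_tele (p : ℝ) (hp1 : 1 < p) (hp2 : p ≤ 2) {f : V → ℂ} (hf : Nice f) (J : ℤ) (K : ℕ) :
    (∑ k ∈ Finset.range K, ENNReal.ofReal (p * (p - 1) / 2) * Df (gm V (3 * aj (J + k + 1))) p (LPu (J + k) f))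
      + ∫⁻ x, ‖LPu (J - 1) f x‖ₑ ^ p ≤ ∫⁻ x, ‖LPu (J + K - 1) f x‖ₑ ^ p := by
  induction K with
  | zero => simp
  | succ K ih =>
    rw [Finset.sum_range_succ]
    have h := step_one (gm V (3 * aj (J + K + 1))) p hp1 hp2 (LPu_nice (J + K) hf)
    rw [Bop_LPu _ hf] at h
    have e : J + ((K + 1 : ℕ) : ℤ) - 1 = J + K := by push_cast; ring
    rw [e]
    refine le_trans ?_ h
    rw [add_assoc, add_comm (ENNReal.ofReal _ * _), ← add_assoc, add_comm]
    gcongr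

lemma LP_square (p : ℝ) (hp1 : 1 < p) (hp2 : p ≤ 2) : ∃ C : ℝ≥0∞, C ≠ ⊤ ∧ ∀ {f : V → ℂ}, Nice f → ∀ (J : ℤ) (K : ℕ),
    ∑ k ∈ Finset.range K, (∫⁻ x, ‖LP (J + k) f x‖ₑ ^ p) ^ (2 / p) ≤ C * (∫⁻ x, ‖f x‖ₑ ^ p) ^ (2 / p) := by
  have hc : 0 < p * (p - 1) / 2 := by have := mul_pos (by linarith : 0 < p) (by linarith : 0 < p - 1); linarith
  refine ⟨(ENNReal.ofReal (p * (p - 1) / 2))⁻¹ * (2 ^ p) ^ ((1 - p / 2) * (2 / p)), ?_, ?_⟩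
  · refine ENNReal.mul_ne_top (by simpa using hc) (ENNReal.rpow_ne_top_of_nonneg ?_ ?_)
    · exact mul_nonneg (by linarith) (by positivity)
    · exact ENNReal.rpow_ne_top_of_nonneg (by linarith) (by simp)
  intro f hf J K
  set N := ∫⁻ x, ‖f x‖ₑ ^ p with hN
  have hNt : N < ⊤ := LP_Lp_fin p hp1 hf
  have hu : ∀ j, ∫⁻ x, ‖LPu j f x‖ₑ ^ p ≤ N := fun j => Bop_Lp _ p hp1 hp2 hf
  have hE : 0 ≤ (1 - p / 2) * (2 / p) := mul_nonneg (by linarith) (by positivity)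
  have h1 : ∀ k : ℕ, (∫⁻ x, ‖LP (J + k) f x‖ₑ ^ p) ^ (2 / p) ≤
      Df (gm V (3 * aj (J + k + 1))) p (LPu (J + k) f) * ((2 ^ p) ^ ((1 - p / 2) * (2 / p)) * N ^ ((1 - p / 2) * (2 / p))) := by
    intro k
    have ha := aj_pos (J + k + 1)
    have h := step_two _ (gm_symm (V := V) (3 * aj (J + k + 1)) (by linarith)) p hp1 hp2 (LPu_nice (J + k) hf)
    calc _ ≤ ((Df (gm V (3 * aj (J + k + 1))) p (LPu (J + k) f)) ^ (p / 2) * (2 ^ p * N) ^ (1 - p / 2)) ^ (2 / p) := by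
          have : 0 ≤ 1 - p / 2 := by linarith
          gcongr
          refine h.trans ?_
          gcongr
          exact hu _
      _ = _ := by
          rw [ENNReal.mul_rpow_of_nonneg _ _ (by positivity), ← ENNReal.rpow_mul, ← ENNReal.rpow_mul]
          rw [ENNReal.mul_rpow_of_nonneg _ _ hE]
          congr 1
          have : p / 2 * (2 / p) = 1 := by field_simp
          rw [this, ENNReal.rpow_one]
  have ht := (le_trans le_self_add (LP_tele p hp1 hp2 hf J K)).trans (hu _)
  rw [← Finset.mul_sum] at ht
  have ht2 : (∑ k ∈ Finset.range K, Df (gm V (3 * aj (J + k + 1))) p (LPu (J + k) f)) ≤ (ENNReal.ofReal (p * (p - 1) / 2))⁻¹ * N := by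
    rw [← ENNReal.div_eq_inv_mul, ENNReal.le_div_iff_mul_le (by simp [hc]) (by simp), mul_comm]
    exact ht
  calc _ ≤ ∑ k ∈ Finset.range K, Df (gm V (3 * aj (J + k + 1))) p (LPu (J + k) f) * ((2 ^ p) ^ ((1 - p / 2) * (2 / p)) * N ^ ((1 - p / 2) * (2 / p))) :=
        Finset.sum_le_sum fun k _ => h1 k
    _ ≤ ((ENNReal.ofReal (p * (p - 1) / 2))⁻¹ * N) * ((2 ^ p) ^ ((1 - p / 2) * (2 / p)) * N ^ ((1 - p / 2) * (2 / p))) := by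
        rw [← Finset.sum_mul]; gcongr
    _ = (ENNReal.ofReal (p * (p - 1) / 2))⁻¹ * (2 ^ p) ^ ((1 - p / 2) * (2 / p)) * (N ^ (1:ℝ) * N ^ ((1 - p / 2) * (2 / p))) := by
        rw [ENNReal.rpow_one]; ring
    _ = _ := by
        rw [← ENNReal.rpow_add_of_nonneg _ _ (by norm_num) hE]
        congr 2
        field_simp
        ring

end gauss
end DS

namespace DS

section KT

/-- `L^{c}` norm on a set (or the line) -/
def lq (c : ℝ) (A : Set ℝ) (e : ℝ → ℝ≥0∞) : ℝ≥0∞ := (∫⁻ s in A, e s ^ c) ^ (1 / c)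

/-- grid cells -/
def cell (L : ℝ) (k : ℤ) : Set ℝ := {s | ⌊s / L⌋ = k}

lemma cell_meas (L : ℝ) (k : ℤ) : MeasurableSet (cell L k) := by
  have : Measurable (fun s : ℝ => ⌊s / L⌋) := Int.measurable_floor.comp (by fun_prop)
  exact this (measurableSet_singleton k)

lemma cell_disj (L : ℝ) : Pairwise (Function.onFun Disjoint (cell L)) := by
  intro i j hij
  rw [Function.onFun, Set.disjoint_left]
  intro s h1 h2
  exact hij (h1.symm.trans h2)

lemma cell_union (L : ℝ) : (⋃ k, cell L k) = Set.univ := by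
  ext s; simp [cell]

lemma cell_vol (L : ℝ) (hL : 0 < L) (k : ℤ) : volume (cell L k) ≤ ENNReal.ofReal L := by
  have : cell L k ⊆ Set.Ico (k * L) ((k + 1) * L) := by
    intro s hs
    have hs' : ⌊s / L⌋ = k := hs
    rw [Int.floor_eq_iff] at hs'
    rw [le_div_iff₀ hL, div_lt_iff₀ hL] at hs'
    exact hs'
  refine (measure_mono this).trans ?_
  rw [Real.volume_Ico]
  exact ENNReal.ofReal_le_ofReal (by linarith)

lemma cs_tsum {ι : Type*} [Countable ι] (x y : ι → ℝ≥0∞) : ∑' k, x k * y k ≤ (∑' k, x k ^ (2:ℝ)) ^ (1/2:ℝ) * (∑' k, y k ^ (2:ℝ)) ^ (1/2:ℝ) := by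
  letI : MeasurableSpace ι := ⊤
  have h := ENNReal.lintegral_mul_norm_pow_le (μ := (Measure.count : Measure ι)) (f := fun k => x k ^ (2:ℝ)) (g := fun k => y k ^ (2:ℝ))
    (measurable_from_top).aemeasurable (measurable_from_top).aemeasurable (p := 1/2) (q := 1/2) (by norm_num) (by norm_num) (by norm_num)
  rw [lintegral_count' measurable_from_top, lintegral_count' measurable_from_top, lintegral_count' measurable_from_top] at h
  refine le_trans (le_of_eq ?_) h
  congr 1
  ext k
  rw [← ENNReal.rpow_mul, ← ENNReal.rpow_mul]
  norm_num

lemma sum_cells (c : ℝ) (hc : 0 < c) (hc2 : c ≤ 2) (L : ℝ) (e : ℝ → ℝ≥0∞) :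
    ∑' k, lq c (cell L k) e ^ (2:ℝ) ≤ lq c Set.univ e ^ (2:ℝ) := by
  unfold lq
  have hs : ∑' k, ∫⁻ s in cell L k, e s ^ c = ∫⁻ s in Set.univ, e s ^ c := by
    rw [← cell_union L, lintegral_iUnion (cell_meas L) (cell_disj L)]
  set E := ∫⁻ s in Set.univ, e s ^ c
  have h2 : 1 ≤ 1 / c * 2 := by rw [one_div_mul_eq_div, le_div_iff₀ hc]; linarith
  simp_rw [← ENNReal.rpow_mul]
  have e1 : ∀ z : ℝ≥0∞, z ^ (1 / c * 2) = z ^ (1 / c * 2 - 1) * z := fun z => by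
    conv_rhs => rw [← ENNReal.rpow_one z, ← ENNReal.rpow_mul, ← ENNReal.rpow_add_of_nonneg _ _ (by linarith) (by linarith)]
    ring_nf
  simp_rw [e1]
  have h3 : 0 ≤ 1 / c * 2 - 1 := by linarith
  calc _ ≤ ∑' k, E ^ (1 / c * 2 - 1) * ∫⁻ s in cell L k, e s ^ c := by
        gcongr with k
        exact lintegral_mono_set (Set.subset_univ _)
    _ = _ := by rw [ENNReal.tsum_mul_left, hs]

lemma near_sum (c : ℝ) (hc : 0 < c) (hc2 : c ≤ 2) (L : ℝ) (e e' : ℝ → ℝ≥0∞) (j : ℤ) :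
    ∑' k, lq c (cell L k) e * lq c (cell L (k + j)) e' ≤ lq c Set.univ e * lq c Set.univ e' := by
  refine (cs_tsum _ _).trans ?_
  have e1 : ∀ z : ℝ≥0∞, z = (z ^ (2:ℝ)) ^ (1/2:ℝ) := fun z => by rw [← ENNReal.rpow_mul]; norm_num
  rw [e1 (lq c Set.univ e), e1 (lq c Set.univ e')]
  have h2 := (Equiv.addRight j).tsum_eq (fun k => lq c (cell L k) e' ^ (2:ℝ))
  simp only [Equiv.coe_addRight] at h2
  gcongr
  · exact sum_cells c hc hc2 L e
  · rw [h2]; exact sum_cells c hc hc2 L e'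

lemma far_kernel (m L : ℝ) (hm : 1 < m) (hL : 0 < L) :
    ∫⁻ u : ℝ, (if L ≤ |u| then ENNReal.ofReal (|u| ^ (-m)) else 0) ≤ ENNReal.ofReal (2 / (m - 1) * L ^ (1 - m)) := by
  have hI : ∫⁻ u in Set.Ioi L, ENNReal.ofReal (u ^ (-m)) = ENNReal.ofReal (1 / (m - 1) * L ^ (1 - m)) := by
    rw [← ofReal_integral_eq_lintegral_ofReal]
    · rw [integral_Ioi_rpow_of_lt (by linarith) hL]
      congr 1
      rw [show -m + 1 = -(m - 1) by ring, show 1 - m = -(m-1) by ring, neg_div_neg_eq]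
      ring
    · exact integrableOn_Ioi_rpow_of_lt (by linarith) hL
    · refine (ae_restrict_mem measurableSet_Ioi).mono fun u hu => ?_
      have : 0 < u := hL.trans hu
      positivity
  have hI' : ∫⁻ u in Set.Ici L, ENNReal.ofReal (|u| ^ (-m)) = ENNReal.ofReal (1 / (m - 1) * L ^ (1 - m)) := by
    rw [← hI, setLIntegral_congr Ioi_ae_eq_Ici.symm]
    refine setLIntegral_congr_fun measurableSet_Ioi fun u hu => ?_
    have : 0 < u := hL.trans hu
    simp only [abs_of_pos this]
  have hneg : ∫⁻ u in Set.Iic (-L), ENNReal.ofReal (|u| ^ (-m)) = ∫⁻ u in Set.Ici L, ENNReal.ofReal (|u| ^ (-m)) := by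
    rw [← lintegral_indicator measurableSet_Iic, ← lintegral_indicator measurableSet_Ici,
      ← lintegral_neg_eq_self (fun u => (Set.Ici L).indicator (fun u => ENNReal.ofReal (|u| ^ (-m))) u)]
    congr 1; ext u
    simp only [Set.indicator, Set.mem_Iic, Set.mem_Ici, abs_neg]
    congr 1
    exact propext le_neg
  calc _ ≤ ∫⁻ u : ℝ, ((Set.Iic (-L)).indicator (fun u => ENNReal.ofReal (|u| ^ (-m))) u + (Set.Ici L).indicator (fun u => ENNReal.ofReal (|u| ^ (-m))) u) := by
        gcongr with u
        split_ifs with h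
        · rcases le_abs.1 h with h' | h'
          · rw [Set.indicator_of_mem (s := Set.Ici L) h']; exact le_add_self
          · rw [Set.indicator_of_mem (s := Set.Iic (-L)) (by simp; linarith)]; exact le_self_add
        · exact zero_le
    _ = _ := by
        rw [lintegral_add_left (Measurable.indicator (by fun_prop) measurableSet_Iic), lintegral_indicator measurableSet_Iic, lintegral_indicator measurableSet_Ici, hneg, hI',
          ← ENNReal.ofReal_add]
        · congr 1; ring
        all_goals
          have : 0 < m - 1 := by linarith
          positivity

/-- truncated kernel -/
def fk (d L : ℝ) (u : ℝ) : ℝ≥0∞ := if L ≤ |u| then ENNReal.ofReal (|u| ^ (-d)) else 0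

lemma fk_meas (d L : ℝ) : Measurable (fk d L) := by
  unfold fk
  exact Measurable.ite (measurableSet_le measurable_const (by fun_prop)) (by fun_prop) measurable_const

lemma far_sum (q q' d L : ℝ) (hq : 2 ≤ q) (hqq : 1 / q + 1 / q' = 1) (hd : 2 < d * q) (hL : 0 < L) (e e' : ℝ → ℝ≥0∞)
    (he : Measurable e) (he' : Measurable e') :
    ∫⁻ z : ℝ × ℝ, e z.1 * e' z.2 * fk d L (z.1 - z.2) ≤
      ENNReal.ofReal ((2 / (d * q / 2 - 1)) ^ (2 / q) * L ^ (2 / q - d)) * (lq q' Set.univ e * lq q' Set.univ e') := by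
  have hq0 : 0 < q := by linarith
  have hk := fk_meas d L
  have hq'0 : q' ≠ 0 := by rintro rfl; simp at hqq; rw [hqq] at hq; norm_num at hq
  have hq'e : 1 / q' = 1 - 1 / q := by linarith
  have h1q : 1 / q ≤ 1 / 2 := one_div_le_one_div_of_le (by norm_num) hq
  have hq'p : 0 < q' := by
    have : 0 < 1 / q' := by linarith
    exact one_div_pos.1 this
  set K := ∫⁻ u : ℝ, fk d L u ^ (q / 2) with hK
  have hKb : K ≤ ENNReal.ofReal (2 / (d * q / 2 - 1) * L ^ (1 - d * q / 2)) := by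
    refine le_trans (le_of_eq ?_) (far_kernel (d * q / 2) L (by linarith) hL)
    rw [hK]
    congr 1; ext u
    unfold fk
    split_ifs with h
    · rw [ENNReal.ofReal_rpow_of_nonneg (by positivity) (by positivity), ← Real.rpow_mul (abs_nonneg _)]
      congr 2; ring
    · exact ENNReal.zero_rpow_of_pos (by positivity)
  have hKb2 : K ^ (2 / q) ≤ ENNReal.ofReal ((2 / (d * q / 2 - 1)) ^ (2 / q) * L ^ (2 / q - d)) := by
    have hpos : 0 < 2 / (d * q / 2 - 1) := by
      have : 0 < d * q / 2 - 1 := by linarith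
      positivity
    refine (ENNReal.rpow_le_rpow hKb (by positivity)).trans (le_of_eq ?_)
    rw [ENNReal.ofReal_rpow_of_nonneg (by positivity) (by positivity), Real.mul_rpow (by positivity) (by positivity), ← Real.rpow_mul hL.le]
    congr 3
    field_simp
  set E := ∫⁻ s, e s ^ q' with hE
  set E' := ∫⁻ s, e' s ^ q' with hE'
  have i1 : ∫⁻ z : ℝ × ℝ, e z.1 ^ q' * e' z.2 ^ q' = E * E' := by
    rw [Measure.volume_eq_prod, lintegral_prod _ (by fun_prop)]
    simp_rw [lintegral_const_mul _ (he'.pow_const q')]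
    rw [lintegral_mul_const _ (by fun_prop)]
  have i2 : ∫⁻ z : ℝ × ℝ, e z.1 ^ q' * fk d L (z.1 - z.2) ^ (q / 2) = E * K := by
    rw [Measure.volume_eq_prod, lintegral_prod _ (by fun_prop)]
    have : ∀ x, ∫⁻ y, e x ^ q' * fk d L (x - y) ^ (q / 2) = e x ^ q' * K := fun x => by
      rw [lintegral_const_mul _ (by fun_prop), lintegral_sub_left_eq_self (fun u => fk d L u ^ (q/2)) x]
    simp_rw [this]
    rw [lintegral_mul_const _ (by fun_prop)]
  have i3 : ∫⁻ z : ℝ × ℝ, e' z.2 ^ q' * fk d L (z.1 - z.2) ^ (q / 2) = E' * K := by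
    rw [Measure.volume_eq_prod, lintegral_prod_symm _ (by fun_prop)]
    have : ∀ y, ∫⁻ x, e' y ^ q' * fk d L (x - y) ^ (q / 2) = e' y ^ q' * K := fun y => by
      rw [lintegral_const_mul _ (by fun_prop), lintegral_sub_right_eq_self (fun u => fk d L u ^ (q/2)) y]
    simp_rw [this]
    rw [lintegral_mul_const _ (by fun_prop)]
  have hH := ENNReal.lintegral_prod_norm_pow_le (μ := (volume : Measure (ℝ × ℝ))) (Finset.univ : Finset (Fin 3))
    (f := ![fun z => e z.1 ^ q' * e' z.2 ^ q', fun z => e z.1 ^ q' * fk d L (z.1 - z.2) ^ (q / 2), fun z => e' z.2 ^ q' * fk d L (z.1 - z.2) ^ (q / 2)])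
    (by intro i _; fin_cases i <;> simp <;> fun_prop) (p := ![1 - 2 / q, 1 / q, 1 / q])
    (by simp [Fin.sum_univ_three]; ring)
    (by
      have h2 : 2 / q = 2 * (1 / q) := by ring
      intro i _; fin_cases i <;> simp
      · rw [← mul_one_div]; linarith
      · positivity
      · positivity)
  simp only [Fin.prod_univ_three, Matrix.cons_val_zero, Matrix.cons_val_one, Matrix.cons_val_two, Matrix.tail_cons, Matrix.head_cons, Matrix.cons_val] at hH
  rw [i1, i2, i3] at hH
  have h12 : 0 ≤ 1 - 2 / q := by rw [← mul_one_div]; linarith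
  have hq1 : 0 ≤ 1 / q := by positivity
  calc _ = ∫⁻ z : ℝ × ℝ, (e z.1 ^ q' * e' z.2 ^ q') ^ (1 - 2 / q) * (e z.1 ^ q' * fk d L (z.1 - z.2) ^ (q / 2)) ^ (1 / q) *
            (e' z.2 ^ q' * fk d L (z.1 - z.2) ^ (q / 2)) ^ (1 / q) := by
        congr 1; ext z
        generalize e z.1 = A
        generalize e' z.2 = B
        generalize fk d L (z.1 - z.2) = k
        simp only [ENNReal.mul_rpow_of_nonneg _ _ h12, ENNReal.mul_rpow_of_nonneg _ _ hq1, ← ENNReal.rpow_mul]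
        have ex : ∀ X : ℝ≥0∞, X = X ^ (q' * (1 - 2 / q)) * X ^ (q' * (1 / q)) := fun X => by
          rw [← ENNReal.rpow_add_of_nonneg _ _ (by positivity) (by positivity)]
          have : q' * (1 - 2 / q) + q' * (1 / q) = 1 := by
            have : q' * (1 - 2 / q) + q' * (1 / q) = q' * (1 / q') := by rw [hq'e]; ring
            rw [this]; field_simp
          rw [this, ENNReal.rpow_one]
        have ek : k = k ^ (q / 2 * (1 / q)) * k ^ (q / 2 * (1 / q)) := by
          rw [← ENNReal.rpow_add_of_nonneg _ _ (by positivity) (by positivity)]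
          have : q / 2 * (1 / q) + q / 2 * (1 / q) = 1 := by field_simp; norm_num
          rw [this, ENNReal.rpow_one]
        conv_lhs => rw [ex A, ex B, ek]
        ring
    _ ≤ _ := hH
    _ = K ^ (2 / q) * (lq q' Set.univ e * lq q' Set.univ e') := by
        simp only [lq, Measure.restrict_univ, ← hE, ← hE', ENNReal.mul_rpow_of_nonneg _ _ h12, ENNReal.mul_rpow_of_nonneg _ _ hq1]
        have ex : ∀ X : ℝ≥0∞, X ^ (1 / q') = X ^ (1 - 2 / q) * X ^ (1 / q) := fun X => by
          rw [← ENNReal.rpow_add_of_nonneg _ _ h12 hq1, hq'e]; ring_nf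
        have ek : K ^ (2 / q) = K ^ (1 / q) * K ^ (1 / q) := by
          rw [← ENNReal.rpow_add_of_nonneg _ _ hq1 hq1]; ring_nf
        rw [ex E, ex E', ek]; ring
    _ ≤ _ := by gcongr

lemma far_dist (L : ℝ) (hL : 0 < L) (s t : ℝ) (h : 2 ≤ |⌊t / L⌋ - ⌊s / L⌋|) : L ≤ |s - t| := by
  have a1 := Int.floor_le (t / L)
  have a2 := Int.lt_floor_add_one (t / L)
  have b1 := Int.floor_le (s / L)
  have b2 := Int.lt_floor_add_one (s / L)
  have e : |s - t| = L * |s / L - t / L| := by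
    rw [← sub_div, abs_div, abs_of_pos hL]; field_simp
  rw [e]
  have : 1 ≤ |s / L - t / L| := by
    rcases le_abs.1 h with h | h
    · have : (2:ℝ) ≤ ⌊t / L⌋ - ⌊s / L⌋ := by exact_mod_cast h
      rw [abs_sub_comm]
      exact le_trans (by linarith) (le_abs_self _)
    · have : (2:ℝ) ≤ -(⌊t / L⌋ - ⌊s / L⌋) := by exact_mod_cast h
      exact le_trans (by linarith) (le_abs_self _)
  nlinarith

/-- diagonal strips -/
def strip (L : ℝ) (j : ℤ) : Set (ℝ × ℝ) := {z | ⌊z.2 / L⌋ - ⌊z.1 / L⌋ = j}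

lemma strip_eq (L : ℝ) (j : ℤ) : strip L j = ⋃ k, cell L k ×ˢ cell L (k + j) := by
  ext z
  simp only [strip, cell, Set.mem_setOf_eq, Set.mem_iUnion, Set.mem_prod]
  constructor
  · intro h; exact ⟨_, rfl, by omega⟩
  · rintro ⟨k, h1, h2⟩; omega

lemma strip_meas (L : ℝ) (j : ℤ) : MeasurableSet (strip L j) := by
  rw [strip_eq]
  exact MeasurableSet.iUnion fun k => (cell_meas _ _).prod (cell_meas _ _)

lemma near_strip (c : ℝ) (hc : 0 < c) (hc2 : c ≤ 2) (L : ℝ) (e e' : ℝ → ℝ≥0∞) (Q : ℝ × ℝ → ℂ) (hQ : Integrable Q) (a : ℝ≥0∞)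
    (j : ℤ) (hn : ∀ k, ‖∫ z in cell L k ×ˢ cell L (k + j), Q z‖ₑ ≤ a * (lq c (cell L k) e * lq c (cell L (k + j)) e')) :
    ‖∫ z in strip L j, Q z‖ₑ ≤ a * (lq c Set.univ e * lq c Set.univ e') := by
  have hd : Pairwise (Function.onFun Disjoint (fun k : ℤ => cell L k ×ˢ cell L (k + j))) := by
    intro k k' hk
    exact Set.disjoint_prod.2 (Or.inl (cell_disj L hk))
  have hs := hasSum_integral_iUnion (μ := (volume : Measure (ℝ × ℝ))) (fun k => (cell_meas L k).prod (cell_meas L (k + j))) hd (f := Q) hQ.integrableOn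
  rw [strip_eq, ← hs.tsum_eq]
  calc _ ≤ ∑' k, ‖∫ z in cell L k ×ˢ cell L (k + j), Q z‖ₑ := enorm_tsum_le_tsum_enorm
    _ ≤ ∑' k, a * (lq c (cell L k) e * lq c (cell L (k + j)) e') := ENNReal.tsum_le_tsum hn
    _ ≤ _ := by rw [ENNReal.tsum_mul_left]; gcongr; exact near_sum c hc hc2 L e e' j

/-- near/far splitting -/
lemma near_far (q q' d L : ℝ) (hq : 2 ≤ q) (hqq : 1 / q + 1 / q' = 1) (hd : 2 < d * q) (hL : 0 < L) (e e' : ℝ → ℝ≥0∞)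
    (he : Measurable e) (he' : Measurable e') (Q : ℝ × ℝ → ℂ) (hQ : Integrable Q) (a b : ℝ≥0∞)
    (hn : ∀ k k', ‖∫ z in cell L k ×ˢ cell L k', Q z‖ₑ ≤ a * (lq q' (cell L k) e * lq q' (cell L k') e'))
    (hf : ∀ z : ℝ × ℝ, z.1 ≠ z.2 → ‖Q z‖ₑ ≤ b * (ENNReal.ofReal (|z.1 - z.2| ^ (-d)) * (e z.1 * e' z.2))) :
    ‖∫ z, Q z‖ₑ ≤ (3 * a + b * ENNReal.ofReal ((2 / (d * q / 2 - 1)) ^ (2 / q) * L ^ (2 / q - d))) * (lq q' Set.univ e * lq q' Set.univ e') := by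
  have hq0 : 0 < q := by linarith
  have hq'e : 1 / q' = 1 - 1 / q := by linarith
  have h1q : 1 / q ≤ 1 / 2 := one_div_le_one_div_of_le (by norm_num) hq
  have hq'p : 0 < q' := one_div_pos.1 (by linarith)
  have hq'2 : q' ≤ 2 := by
    have : 1 / 2 ≤ 1 / q' := by linarith
    exact (one_div_le_one_div (by norm_num) hq'p).1 this
  have hk := fk_meas d L
  set X := lq q' Set.univ e * lq q' Set.univ e'
  have hN := fun j => near_strip q' hq'p hq'2 L e e' Q hQ a j (fun k => hn _ _)
  set Nr := strip L (-1) ∪ (strip L 0 ∪ strip L 1) with hNr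
  have hNm : MeasurableSet Nr := (strip_meas _ _).union ((strip_meas _ _).union (strip_meas _ _))
  have dj : ∀ i j : ℤ, i ≠ j → Disjoint (strip L i) (strip L j) := by
    intro i j hij
    rw [Set.disjoint_left]
    intro z h1 h2
    exact hij (h1.symm.trans h2)
  have hsplit : ∫ z, Q z = ((∫ z in strip L (-1), Q z) + ((∫ z in strip L 0, Q z) + ∫ z in strip L 1, Q z)) + ∫ z in Nrᶜ, Q z := by
    rw [← integral_add_compl hNm hQ, hNr, setIntegral_union _ ((strip_meas _ _).union (strip_meas _ _)) hQ.integrableOn hQ.integrableOn,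
      setIntegral_union (dj _ _ (by norm_num)) (strip_meas _ _) hQ.integrableOn hQ.integrableOn]
    exact Set.disjoint_union_right.2 ⟨dj _ _ (by norm_num), dj _ _ (by norm_num)⟩
  have hfar : ‖∫ z in Nrᶜ, Q z‖ₑ ≤ b * ENNReal.ofReal ((2 / (d * q / 2 - 1)) ^ (2 / q) * L ^ (2 / q - d)) * X := by
    calc _ ≤ ∫⁻ z in Nrᶜ, ‖Q z‖ₑ := enorm_integral_le_lintegral_enorm _
      _ ≤ ∫⁻ z in Nrᶜ, b * (e z.1 * e' z.2 * fk d L (z.1 - z.2)) := by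
          refine setLIntegral_mono' hNm.compl fun z hz => ?_
          have h2 : 2 ≤ |⌊z.2 / L⌋ - ⌊z.1 / L⌋| := by
            by_contra hlt
            push Not at hlt
            apply hz
            rw [hNr]
            simp only [strip, Set.mem_union, Set.mem_setOf_eq]
            rw [abs_lt] at hlt
            omega
          have h3 := far_dist L hL z.1 z.2 h2
          have hne : z.1 ≠ z.2 := by
            intro h; rw [h, sub_self, abs_zero] at h3; linarith
          refine (hf z hne).trans (le_of_eq ?_)
          rw [fk, if_pos h3]; ring
      _ ≤ ∫⁻ z : ℝ × ℝ, b * (e z.1 * e' z.2 * fk d L (z.1 - z.2)) := setLIntegral_le_lintegral _ _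
      _ = b * ∫⁻ z : ℝ × ℝ, (e z.1 * e' z.2 * fk d L (z.1 - z.2)) := lintegral_const_mul _ (by fun_prop)
      _ ≤ b * (ENNReal.ofReal ((2 / (d * q / 2 - 1)) ^ (2 / q) * L ^ (2 / q - d)) * X) := by
          gcongr
          exact far_sum q q' d L hq hqq hd hL e e' he he'
      _ = _ := by ring
  rw [hsplit]
  calc _ ≤ (‖∫ z in strip L (-1), Q z‖ₑ + (‖∫ z in strip L 0, Q z‖ₑ + ‖∫ z in strip L 1, Q z‖ₑ)) + ‖∫ z in Nrᶜ, Q z‖ₑ := by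
        refine (enorm_add_le _ _).trans ?_
        gcongr
        refine (enorm_add_le _ _).trans ?_
        gcongr
        exact enorm_add_le _ _
    _ ≤ (a * X + (a * X + a * X)) + b * ENNReal.ofReal ((2 / (d * q / 2 - 1)) ^ (2 / q) * L ^ (2 / q - d)) * X := by
        gcongr <;> exact hN _
    _ = _ := by ring

end KT
end DS

namespace DS

section KT2

lemma int_cell (q q' L : ℝ) (hq : 2 ≤ q) (hqq : 1 / q + 1 / q' = 1) (hL : 0 < L) (e : ℝ → ℝ≥0∞) (he : Measurable e) (k : ℤ) :
    ∫⁻ s in cell L k, e s ≤ ENNReal.ofReal (L ^ (1 / q)) * lq q' (cell L k) e := by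
  have hq0 : 0 < q := by linarith
  have h1q : 1 / q ≤ 1 / 2 := one_div_le_one_div_of_le (by norm_num) hq
  have hq'p : 0 < q' := one_div_pos.1 (by linarith)
  have h := ENNReal.lintegral_mul_norm_pow_le (μ := volume.restrict (cell L k)) (f := fun s => e s ^ q') (g := fun _ => 1)
    (by fun_prop) (by fun_prop) (p := 1 / q') (q := 1 / q) (by positivity) (by positivity) (by linarith)
  simp only [ENNReal.one_rpow, mul_one, lintegral_const, one_mul, Measure.restrict_apply_univ] at h
  have e1 : ∀ s, (e s ^ q') ^ (1 / q') = e s := fun s => by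
    rw [← ENNReal.rpow_mul, mul_one_div_cancel hq'p.ne', ENNReal.rpow_one]
  simp_rw [e1] at h
  refine h.trans ?_
  rw [mul_comm, lq]
  gcongr
  rw [← ENNReal.ofReal_rpow_of_nonneg hL.le (by positivity)]
  gcongr
  exact cell_vol L hL k

lemma enorm_prod_le (Q : ℝ × ℝ → ℂ) (e e' : ℝ → ℝ≥0∞) (he : Measurable e) (he' : Measurable e') (a : ℝ≥0∞) (A A' : Set ℝ)
    (h : ∀ z, ‖Q z‖ₑ ≤ a * (e z.1 * e' z.2)) :
    ‖∫ z in A ×ˢ A', Q z‖ₑ ≤ a * ((∫⁻ s in A, e s) * ∫⁻ s in A', e' s) := by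
  calc _ ≤ ∫⁻ z in A ×ˢ A', ‖Q z‖ₑ := enorm_integral_le_lintegral_enorm _
    _ ≤ ∫⁻ z in A ×ˢ A', a * (e z.1 * e' z.2) := lintegral_mono h
    _ = _ := by
      rw [lintegral_const_mul _ (by fun_prop), Measure.volume_eq_prod, ← Measure.prod_restrict, lintegral_prod _ (by fun_prop)]
      simp_rw [lintegral_const_mul _ he']
      rw [lintegral_mul_const _ he]

lemma lq_indicator (c : ℝ) (hc : 0 < c) (A : Set ℝ) (hA : MeasurableSet A) (e : ℝ → ℝ≥0∞) :
    lq c Set.univ (A.indicator e) = lq c A e := by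
  unfold lq
  rw [Measure.restrict_univ, ← lintegral_indicator hA]
  congr 2; ext s
  by_cases h : s ∈ A
  · simp [h]
  · simp [h, hc]

/-- far constant -/
def K0 (q d : ℝ) : ℝ := (2 / (d * q / 2 - 1)) ^ (2 / q)

lemma K0_nonneg (q d : ℝ) (hd : 2 < d * q) : 0 ≤ K0 q d := by
  unfold K0
  have : 0 < d * q / 2 - 1 := by linarith
  positivity

lemma kt_diag (q q' d θ : ℝ) (hq : 2 ≤ q) (hqq : 1 / q + 1 / q' = 1) (hθ0 : 0 < θ) (hθ : θ < 1 / 2) (hd : 1 / q = d * θ)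
    (M : ℝ≥0∞) (l : ℝ) (e : ℝ → ℝ≥0∞) (he : Measurable e) (Q : ℝ × ℝ → ℂ) (hQ : Integrable Q)
    (h1 : ∀ z, ‖Q z‖ₑ ≤ M * ENNReal.ofReal (2 ^ (-(2 * θ * l))) * (e z.1 * e z.2))
    (h2 : ∀ z : ℝ × ℝ, z.1 ≠ z.2 → ‖Q z‖ₑ ≤ M * ENNReal.ofReal (2 ^ ((1 - 2 * θ) * l)) * (ENNReal.ofReal (|z.1 - z.2| ^ (-d)) * (e z.1 * e z.2)))
    (A : Set ℝ) (hA : MeasurableSet A) :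
    ‖∫ z in A ×ˢ A, Q z‖ₑ ≤ M * ENNReal.ofReal (3 + K0 q d) * (lq q' A e * lq q' A e) := by
  have hq0 : 0 < q := by linarith
  have h1q : 1 / q ≤ 1 / 2 := one_div_le_one_div_of_le (by norm_num) hq
  have hq'p : 0 < q' := one_div_pos.1 (by linarith)
  have hdq : 2 < d * q := by
    have h3 : d * q * θ = 1 := by
      have : d * q * θ = (d * θ) * q := by ring
      rw [this, ← hd]; field_simp
    by_contra hlt
    push Not at hlt
    nlinarith
  have hd0 : 0 < d := by
    by_contra h; push Not at h; nlinarith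
  set L : ℝ := 2 ^ (l / d) with hLdef
  have hL : 0 < L := by positivity
  have hLp : ∀ x : ℝ, L ^ x = 2 ^ (l / d * x) := fun x => by rw [hLdef, ← Real.rpow_mul (by norm_num)]
  set e1 := A.indicator e
  have he1 : Measurable e1 := he.indicator hA
  set Q1 := (A ×ˢ A).indicator Q
  have hQ1 : Integrable Q1 := hQ.indicator (hA.prod hA)
  have hb : ∀ z : ℝ × ℝ, ∀ c : ℝ≥0∞, (‖Q z‖ₑ ≤ c * (e z.1 * e z.2)) → ‖Q1 z‖ₑ ≤ c * (e1 z.1 * e1 z.2) := by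
    intro z c h
    by_cases hz : z ∈ A ×ˢ A
    · simp only [Q1, e1, Set.indicator_of_mem hz, Set.indicator_of_mem hz.1, Set.indicator_of_mem hz.2]; exact h
    · simp only [Q1, Set.indicator_of_notMem hz, enorm_zero]; exact zero_le
  have key := near_far q q' d L hq hqq hdq hL e1 e1 he1 he1 Q1 hQ1 (M * ENNReal.ofReal (2 ^ (-(2 * θ * l))) * ENNReal.ofReal (L ^ (2 / q)))
    (M * ENNReal.ofReal (2 ^ ((1 - 2 * θ) * l))) (by
      intro k k'
      refine (enorm_prod_le Q1 e1 e1 he1 he1 _ _ _ (fun z => hb z _ (h1 z))).trans ?_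
      rw [mul_assoc (M * _)]
      refine mul_le_mul_right ?_ _
      calc _ ≤ (ENNReal.ofReal (L ^ (1 / q)) * lq q' (cell L k) e1) * (ENNReal.ofReal (L ^ (1 / q)) * lq q' (cell L k') e1) := by
            gcongr
            · exact int_cell q q' L hq hqq hL e1 he1 k
            · exact int_cell q q' L hq hqq hL e1 he1 k'
        _ = _ := by
          have : L ^ (2 / q) = L ^ (1 / q) * L ^ (1 / q) := by rw [← Real.rpow_add hL]; ring_nf
          rw [this, ENNReal.ofReal_mul (by positivity)]; ring)
    (by
      intro z hz
      have := hb z (M * ENNReal.ofReal (2 ^ ((1 - 2 * θ) * l)) * (ENNReal.ofReal (|z.1 - z.2| ^ (-d)))) (by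
        refine (h2 z hz).trans (le_of_eq ?_); ring)
      refine this.trans (le_of_eq ?_); ring)
  rw [integral_indicator (hA.prod hA), lq_indicator q' hq'p A hA] at key
  refine key.trans (le_of_eq ?_)
  congr 1
  have hK := K0_nonneg q d hdq
  have ea : (2:ℝ) ^ (-(2 * θ * l)) * L ^ (2 / q) = 1 := by
    rw [hLp, ← Real.rpow_add (by norm_num)]
    have : -(2 * θ * l) + l / d * (2 / q) = 0 := by
      have : 2 / q = 2 * (d * θ) := by rw [← hd]; ring
      rw [this]; field_simp; ring
    rw [this, Real.rpow_zero]
  have eb : (2:ℝ) ^ ((1 - 2 * θ) * l) * (K0 q d * L ^ (2 / q - d)) = K0 q d := by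
    rw [hLp, mul_left_comm, ← Real.rpow_add (by norm_num)]
    have : (1 - 2 * θ) * l + l / d * (2 / q - d) = 0 := by
      have : 2 / q = 2 * (d * θ) := by rw [← hd]; ring
      rw [this]; field_simp; ring
    rw [this, Real.rpow_zero, mul_one]
  rw [mul_assoc M, ← ENNReal.ofReal_mul (by positivity), ea, mul_assoc M, ← ENNReal.ofReal_mul (by positivity)]
  change 3 * (M * _) + M * ENNReal.ofReal (_ * (K0 q d * _)) = _
  rw [eb, ENNReal.ofReal_add (by norm_num) hK]
  simp
  ring

lemma kt_off (q q' d θ : ℝ) (hq : 2 ≤ q) (hqq : 1 / q + 1 / q' = 1) (hθ0 : 0 < θ) (hθ : θ < 1 / 2) (hd : 1 / q = d * θ)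
    (M : ℝ≥0∞) (l l' : ℝ) (hl : l' ≤ l) (e e' : ℝ → ℝ≥0∞) (he : Measurable e) (he' : Measurable e') (Q : ℝ × ℝ → ℂ) (hQ : Integrable Q)
    (D D' : Set ℝ → ℝ≥0∞)
    (hCS : ∀ A A', MeasurableSet A → MeasurableSet A' → ‖∫ z in A ×ˢ A', Q z‖ₑ ^ 2 ≤ D A * D' A')
    (hD : ∀ A, MeasurableSet A → D A ≤ M * ENNReal.ofReal (2 ^ (-(2 * θ * l))) * ((∫⁻ s in A, e s) * ∫⁻ s in A, e s))
    (hD' : ∀ A, MeasurableSet A → D' A ≤ M * ENNReal.ofReal (3 + K0 q d) * (lq q' A e' * lq q' A e'))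
    (h2 : ∀ z : ℝ × ℝ, z.1 ≠ z.2 → ‖Q z‖ₑ ≤ M * ENNReal.ofReal (2 ^ ((1 / 2 - θ) * (l + l'))) * (ENNReal.ofReal (|z.1 - z.2| ^ (-d)) * (e z.1 * e' z.2))) :
    ‖∫ z, Q z‖ₑ ≤ M * ENNReal.ofReal (3 * Real.sqrt (3 + K0 q d) + K0 q d) * ENNReal.ofReal (2 ^ (-(min (θ / 4) ((1 / 2 - θ) / 2) * (l - l')))) * (lq q' Set.univ e * lq q' Set.univ e') := by
  have hq0 : 0 < q := by linarith
  have h1q : 1 / q ≤ 1 / 2 := one_div_le_one_div_of_le (by norm_num) hq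
  have hq'p : 0 < q' := one_div_pos.1 (by linarith)
  have hdq : 2 < d * q := by
    have h3 : d * q * θ = 1 := by
      have : d * q * θ = (d * θ) * q := by ring
      rw [this, ← hd]; field_simp
    by_contra hlt
    push Not at hlt
    nlinarith
  have hd0 : 0 < d := by
    by_contra h; push Not at h; nlinarith
  have hK := K0_nonneg q d hdq
  set L : ℝ := 2 ^ ((3 * l + l') / 4 / d) with hLdef
  have hL : 0 < L := by positivity
  have hLp : ∀ x : ℝ, L ^ x = 2 ^ ((3 * l + l') / 4 / d * x) := fun x => by rw [hLdef, ← Real.rpow_mul (by norm_num)]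
  have e2q : 2 / q = 2 * (d * θ) := by rw [← hd]; ring
  have key := near_far q q' d L hq hqq hdq hL e e' he he' Q hQ (M * ENNReal.ofReal (Real.sqrt (3 + K0 q d) * 2 ^ (-(θ / 4 * (l - l')))))
    (M * ENNReal.ofReal (2 ^ ((1 / 2 - θ) * (l + l')))) (by
      intro k k'
      have hsq : ‖∫ z in cell L k ×ˢ cell L k', Q z‖ₑ ^ 2 ≤ ((M * ENNReal.ofReal (Real.sqrt (3 + K0 q d) * 2 ^ (-(θ / 4 * (l - l'))))) * (lq q' (cell L k) e * lq q' (cell L k') e')) ^ 2 := by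
        refine (hCS _ _ (cell_meas _ _) (cell_meas _ _)).trans ?_
        calc _ ≤ (M * ENNReal.ofReal (2 ^ (-(2 * θ * l))) * ((ENNReal.ofReal (L ^ (1 / q)) * lq q' (cell L k) e) * (ENNReal.ofReal (L ^ (1 / q)) * lq q' (cell L k) e))) * (M * ENNReal.ofReal (3 + K0 q d) * (lq q' (cell L k') e' * lq q' (cell L k') e')) := by
              have := int_cell q q' L hq hqq hL e he k
              gcongr
              · refine (hD _ (cell_meas _ _)).trans ?_
                gcongr
              · exact hD' _ (cell_meas _ _)
          _ = M ^ 2 * (ENNReal.ofReal (2 ^ (-(2 * θ * l)) * (L ^ (1 / q) * L ^ (1 / q)) * (3 + K0 q d))) * (lq q' (cell L k) e * lq q' (cell L k') e') ^ 2 := by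
              rw [ENNReal.ofReal_mul (by positivity), ENNReal.ofReal_mul (by positivity), ENNReal.ofReal_mul (by positivity)]; ring
          _ = _ := by
              rw [mul_pow (M * _), mul_pow M, ← ENNReal.ofReal_pow (by positivity), mul_pow (Real.sqrt _), Real.sq_sqrt (by linarith)]
              congr 3
              rw [mul_comm]
              congr 1
              rw [← Real.rpow_add hL, hLp, ← Real.rpow_add (by norm_num), ← Real.rpow_natCast, ← Real.rpow_mul (by norm_num)]
              congr 1
              rw [hd]; push_cast; field_simp; ring
      exact (ENNReal.pow_le_pow_left_iff (two_ne_zero)).1 hsq)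
    h2
  refine key.trans ?_
  gcongr
  have eb : (2:ℝ) ^ ((1 / 2 - θ) * (l + l')) * (K0 q d * L ^ (2 / q - d)) = K0 q d * 2 ^ (-((1 / 2 - θ) / 2 * (l - l'))) := by
    rw [hLp, mul_left_comm, ← Real.rpow_add (by norm_num)]
    congr 2
    rw [e2q]; field_simp; ring
  rw [mul_assoc M, mul_assoc M, ← ENNReal.ofReal_mul (by positivity)]
  change 3 * (M * _) + M * ENNReal.ofReal (_ * (K0 q d * _)) ≤ _
  rw [eb, mul_left_comm, ← mul_add, ← ENNReal.ofReal_mul (by positivity)]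
  have e3 : (3 : ℝ≥0∞) = ENNReal.ofReal 3 := by norm_num
  rw [e3, ← ENNReal.ofReal_mul (by norm_num), ← ENNReal.ofReal_add (by positivity) (by positivity)]
  gcongr
  rw [add_mul, ← mul_assoc]
  have h12 : 0 ≤ 1 / 2 - θ := by linarith
  gcongr
  all_goals first | norm_num; done | exact min_le_left _ _ | exact min_le_right _ _ | linarith

lemma schur (c : ℤ → ℝ≥0∞) (x : ℤ → ℝ≥0∞) (H : Finset ℤ) :
    ∑ h ∈ H, ∑ h' ∈ H, c (h - h') * (x h * x h') ≤ 2 * (∑' m, c m) * ∑ h ∈ H, x h * x h := by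
  have hxy : ∀ a b : ℝ≥0∞, a * b ≤ a * a + b * b := by
    intro a b
    rcases le_total a b with h | h
    · exact le_trans (by gcongr) le_add_self
    · exact le_trans (by gcongr) le_self_add
  have s1 : ∀ h, ∑ h' ∈ H, c (h - h') ≤ ∑' m, c m := fun h => by
    have := (Equiv.subLeft h).tsum_eq c
    simp only [Equiv.subLeft_apply] at this
    rw [← this]
    exact ENNReal.sum_le_tsum H
  have s2 : ∀ h', ∑ h ∈ H, c (h - h') ≤ ∑' m, c m := fun h' => by
    have := (Equiv.subRight h').tsum_eq c
    simp only [Equiv.subRight_apply] at this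
    rw [← this]
    exact ENNReal.sum_le_tsum H
  calc _ ≤ ∑ h ∈ H, ∑ h' ∈ H, (c (h - h') * (x h * x h) + c (h - h') * (x h' * x h')) := by
        gcongr with h _ h' _
        rw [← mul_add]
        gcongr
        exact hxy _ _
    _ = ∑ h ∈ H, (∑ h' ∈ H, c (h - h')) * (x h * x h) + ∑ h' ∈ H, (∑ h ∈ H, c (h - h')) * (x h' * x h') := by
        simp_rw [Finset.sum_add_distrib, Finset.sum_mul]
        congr 1
        exact Finset.sum_comm
    _ ≤ ∑ h ∈ H, (∑' m, c m) * (x h * x h) + ∑ h' ∈ H, (∑' m, c m) * (x h' * x h') := by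
        gcongr
        · exact s1 _
        · exact s2 _
    _ = _ := by rw [← Finset.mul_sum]; ring

lemma geom_int (ε : ℝ) (hε : 0 < ε) : ∑' m : ℤ, ENNReal.ofReal (2 ^ (-(ε * |(m : ℝ)|))) ≠ ⊤ := by
  have hs : Summable (fun n : ℕ => (2:ℝ) ^ (-(ε * (n:ℝ)))) := by
    have : (fun n : ℕ => (2:ℝ) ^ (-(ε * (n:ℝ)))) = fun n : ℕ => ((2:ℝ) ^ (-ε)) ^ n := by
      ext n
      rw [← Real.rpow_natCast, ← Real.rpow_mul (by norm_num)]
      ring_nf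
    rw [this]
    exact summable_geometric_of_lt_one (by positivity) (Real.rpow_lt_one_of_one_lt_of_neg (by norm_num) (by linarith))
  have : Summable (fun m : ℤ => (2:ℝ) ^ (-(ε * |(m : ℝ)|))) := by
    apply Summable.of_nat_of_neg
    · simpa using hs
    · simpa using hs
  exact this.tsum_ofReal_ne_top

lemma kt_sum (q q' d θ p : ℝ) (hq : 2 ≤ q) (hqq : 1 / q + 1 / q' = 1) (hθ0 : 0 < θ) (hθ : θ < 1 / 2) (hd : 1 / q = d * θ) (hp : 0 < p) :
    ∃ C : ℝ≥0∞, C ≠ ⊤ ∧ ∀ (M : ℝ≥0∞) (α : ℝ) (H : Finset ℤ) (e : ℤ → ℝ → ℝ≥0∞) (Q : ℤ → ℤ → ℝ × ℝ → ℂ),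
      (∀ h, Measurable (e h)) → (∀ h h', Integrable (Q h h')) →
      (∀ h h', ‖∫ z, Q h h' z‖ₑ = ‖∫ z, Q h' h z‖ₑ) →
      (∀ h h' A A', MeasurableSet A → MeasurableSet A' → ‖∫ z in A ×ˢ A', Q h h' z‖ₑ ^ 2 ≤ ‖∫ z in A ×ˢ A, Q h h z‖ₑ * ‖∫ z in A' ×ˢ A', Q h' h' z‖ₑ) →
      (∀ h z, ‖Q h h z‖ₑ ≤ M * ENNReal.ofReal (2 ^ (-(2 * θ * (α - h * p)))) * (e h z.1 * e h z.2)) →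
      (∀ h h' (z : ℝ × ℝ), z.1 ≠ z.2 → ‖Q h h' z‖ₑ ≤ M * ENNReal.ofReal (2 ^ ((1 / 2 - θ) * ((α - h * p) + (α - h' * p)))) * (ENNReal.ofReal (|z.1 - z.2| ^ (-d)) * (e h z.1 * e h' z.2))) →
      ∑ h ∈ H, ∑ h' ∈ H, ‖∫ z, Q h h' z‖ₑ ≤ C * M * ∑ h ∈ H, lq q' Set.univ (e h) * lq q' Set.univ (e h) := by
  set ε := min (θ / 4) ((1 / 2 - θ) / 2) with hεd
  have hε : 0 < ε := lt_min (by linarith) (by linarith)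
  refine ⟨2 * (∑' m : ℤ, ENNReal.ofReal (2 ^ (-(ε * p * |(m : ℝ)|)))) * ENNReal.ofReal (3 * Real.sqrt (3 + K0 q d) + K0 q d), ?_, ?_⟩
  · exact ENNReal.mul_ne_top (ENNReal.mul_ne_top (by norm_num) (geom_int _ (by positivity))) ENNReal.ofReal_ne_top
  intro M α H e Q he hQ hsym hCS h1 h2
  have hdiag : ∀ h A, MeasurableSet A → ‖∫ z in A ×ˢ A, Q h h z‖ₑ ≤ M * ENNReal.ofReal (3 + K0 q d) * (lq q' A (e h) * lq q' A (e h)) := by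
    intro h A hA
    refine kt_diag q q' d θ hq hqq hθ0 hθ hd M (α - h * p) (e h) (he h) (Q h h) (hQ h h) (h1 h) (fun z hz => ?_) A hA
    refine (h2 h h z hz).trans (le_of_eq ?_)
    congr 4; ring
  have hpair0 : ∀ h h' : ℤ, h ≤ h' → ‖∫ z, Q h h' z‖ₑ ≤ M * ENNReal.ofReal (3 * Real.sqrt (3 + K0 q d) + K0 q d) * ENNReal.ofReal (2 ^ (-(ε * p * |((h - h' : ℤ) : ℝ)|))) * (lq q' Set.univ (e h) * lq q' Set.univ (e h')) := by
    intro h h' hh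
    have hh' : (h : ℝ) ≤ h' := by exact_mod_cast hh
    have := kt_off q q' d θ hq hqq hθ0 hθ hd M (α - h * p) (α - h' * p) (by nlinarith) (e h) (e h') (he h) (he h') (Q h h') (hQ h h')
      (fun A => ‖∫ z in A ×ˢ A, Q h h z‖ₑ) (fun A => ‖∫ z in A ×ˢ A, Q h' h' z‖ₑ) (fun A A' hA hA' => hCS h h' A A' hA hA')
      (fun A _ => enorm_prod_le (Q h h) (e h) (e h) (he h) (he h) _ A A (h1 h)) (fun A hA => hdiag h' A hA) (h2 h h')
    refine this.trans (le_of_eq ?_)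
    congr 5
    push_cast
    rw [abs_sub_comm, abs_of_nonneg (by linarith : (0:ℝ) ≤ h' - h)]
    ring
  have hpair : ∀ h h' : ℤ, ‖∫ z, Q h h' z‖ₑ ≤ M * ENNReal.ofReal (3 * Real.sqrt (3 + K0 q d) + K0 q d) * ENNReal.ofReal (2 ^ (-(ε * p * |((h - h' : ℤ) : ℝ)|))) * (lq q' Set.univ (e h) * lq q' Set.univ (e h')) := by
    intro h h'
    rcases le_total h h' with hh | hh
    · exact hpair0 h h' hh
    · rw [hsym]
      refine (hpair0 h' h hh).trans (le_of_eq ?_)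
      rw [mul_comm (lq _ _ (e h'))]
      push_cast
      rw [abs_sub_comm]
  have hS := schur (fun m => ENNReal.ofReal (2 ^ (-(ε * p * |(m : ℝ)|)))) (fun h => lq q' Set.univ (e h)) H
  calc _ ≤ ∑ h ∈ H, ∑ h' ∈ H, M * ENNReal.ofReal (3 * Real.sqrt (3 + K0 q d) + K0 q d) * (ENNReal.ofReal (2 ^ (-(ε * p * |((h - h' : ℤ) : ℝ)|))) * (lq q' Set.univ (e h) * lq q' Set.univ (e h'))) := by
        gcongr with h _ h' _
        refine (hpair h h').trans (le_of_eq ?_); ring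
    _ = M * ENNReal.ofReal (3 * Real.sqrt (3 + K0 q d) + K0 q d) * ∑ h ∈ H, ∑ h' ∈ H, (ENNReal.ofReal (2 ^ (-(ε * p * |((h - h' : ℤ) : ℝ)|))) * (lq q' Set.univ (e h) * lq q' Set.univ (e h'))) := by
        simp_rw [← Finset.mul_sum]
    _ ≤ _ := by
        refine (mul_le_mul_right hS _).trans (le_of_eq ?_)
        ring

end KT2
end DS

namespace DS

lemma l2mink (c : ℝ) (hc : 0 < c) (hc2 : c ≤ 2) {ι : Type*} (H : Finset ι) (e : ι → ℝ → ℝ≥0∞) (N : ℝ → ℝ≥0∞) (B : ℝ≥0∞)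
    (he : ∀ h, Measurable (e h)) (hN : Measurable N) (hNt : ∀ s, N s ≠ ⊤)
    (hs : ∀ s, ∑ h ∈ H, e h s * e h s ≤ B * (N s * N s)) :
    ∑ h ∈ H, lq c Set.univ (e h) * lq c Set.univ (e h) ≤ B * (lq c Set.univ N * lq c Set.univ N) := by
  have sq : ∀ z : ℝ≥0∞, z ^ (1 / c) * z ^ (1 / c) = z ^ (2 / c) := fun z => by
    rw [← ENNReal.rpow_add_of_nonneg _ _ (by positivity) (by positivity)]; ring_nf
  simp only [lq, Measure.restrict_univ, sq]
  have h1 : ∀ h ∈ H, (∫⁻ s, e h s ^ c) ^ (2 / c) ≤ (∫⁻ s, e h s * e h s * N s ^ (c - 2)) * (∫⁻ s, N s ^ c) ^ (2 / c - 1) := by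
    intro h hh
    have he' := he h
    have hp : 0 ≤ 1 - c / 2 := by linarith
    have hH := ENNReal.lintegral_mul_norm_pow_le (μ := (volume : Measure ℝ)) (f := fun s => e h s * e h s * N s ^ (c - 2)) (g := fun s => N s ^ c)
      (by fun_prop) (by fun_prop) (p := c / 2) (q := 1 - c / 2) (by positivity) hp (by ring)
    have hpt : ∀ s, e h s ^ c ≤ (e h s * e h s * N s ^ (c - 2)) ^ (c / 2) * (N s ^ c) ^ (1 - c / 2) := by
      intro s
      by_cases hN0 : N s = 0
      · have h0 : e h s * e h s ≤ B * (N s * N s) := le_trans (Finset.single_le_sum (f := fun h => e h s * e h s) (fun _ _ => zero_le) hh) (hs s)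
        rw [hN0] at h0
        simp at h0
        rw [h0, ENNReal.zero_rpow_of_pos hc]
        exact zero_le
      · rw [ENNReal.mul_rpow_of_nonneg _ _ (by positivity), ← ENNReal.rpow_mul, ← ENNReal.rpow_mul, mul_assoc, ← ENNReal.rpow_add _ _ hN0 (hNt s)]
        have e1 : (c - 2) * (c / 2) + c * (1 - c / 2) = 0 := by ring
        rw [e1, ENNReal.rpow_zero, mul_one, ENNReal.mul_rpow_of_nonneg _ _ (by positivity), ← ENNReal.rpow_add_of_nonneg _ _ (by positivity) (by positivity)]
        ring_nf; rfl
    calc _ ≤ ((∫⁻ s, e h s * e h s * N s ^ (c - 2)) ^ (c / 2) * (∫⁻ s, N s ^ c) ^ (1 - c / 2)) ^ (2 / c) := by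
          gcongr
          exact (lintegral_mono hpt).trans hH
      _ = _ := by
          rw [ENNReal.mul_rpow_of_nonneg _ _ (by positivity), ← ENNReal.rpow_mul, ← ENNReal.rpow_mul]
          have e1 : c / 2 * (2 / c) = 1 := by field_simp
          have e2 : (1 - c / 2) * (2 / c) = 2 / c - 1 := by field_simp
          rw [e1, e2, ENNReal.rpow_one]
  have h2c : 0 ≤ 2 / c - 1 := by rw [sub_nonneg, le_div_iff₀ hc]; linarith
  calc _ ≤ ∑ h ∈ H, (∫⁻ s, e h s * e h s * N s ^ (c - 2)) * (∫⁻ s, N s ^ c) ^ (2 / c - 1) := Finset.sum_le_sum h1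
    _ = (∫⁻ s, (∑ h ∈ H, e h s * e h s) * N s ^ (c - 2)) * (∫⁻ s, N s ^ c) ^ (2 / c - 1) := by
        rw [← Finset.sum_mul, ← lintegral_finsetSum _ (fun h _ => by have := he h; fun_prop)]
        simp_rw [Finset.sum_mul]
    _ ≤ (∫⁻ s, B * N s ^ c) * (∫⁻ s, N s ^ c) ^ (2 / c - 1) := by
        refine mul_le_mul_left (lintegral_mono fun s => ?_) _
        refine (mul_le_mul_left (hs s) _).trans ?_
        rw [mul_assoc]
        gcongr
        by_cases hN0 : N s = 0
        · rw [hN0]; simp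
        · nth_rw 1 [← ENNReal.rpow_one (N s)]
          nth_rw 2 [← ENNReal.rpow_one (N s)]
          rw [← ENNReal.rpow_add _ _ hN0 (hNt s), ← ENNReal.rpow_add _ _ hN0 (hNt s)]
          ring_nf; rfl
    _ = _ := by
        rw [lintegral_const_mul _ (by fun_prop), mul_assoc]
        congr 1
        nth_rw 1 [← ENNReal.rpow_one (∫⁻ s, N s ^ c)]
        rw [← ENNReal.rpow_add_of_nonneg _ _ (by norm_num) h2c]
        ring_nf

section gram
variable {V : Type*} [NormedAddCommGroup V] [InnerProductSpace ℝ V] [FiniteDimensional ℝ V]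
  [MeasurableSpace V] [BorelSpace V]

/-- Gram kernel -/
def GQ (φ ψ : ℝ → V → ℂ) (z : ℝ × ℝ) : ℂ := ∫ ξ, φ z.1 ξ * (starRingEnd ℂ) (ψ z.2 ξ)

/-- domination -/
structure Dom (g : V → ℝ) (φ : ℝ → V → ℂ) (m : ℝ → ℝ) : Prop where
  meas : Measurable (fun z : ℝ × V => φ z.1 z.2)
  bd : ∀ s ξ, ‖φ s ξ‖ ≤ g ξ * m s
  mint : Integrable m
  mnn : ∀ s, 0 ≤ m s


lemma gram_tri {g : V → ℝ} (hg0 : ∀ ξ, 0 ≤ g ξ) (hgg : Integrable (fun ξ => g ξ * g ξ))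
    {φ ψ : ℝ → V → ℂ} {m m' : ℝ → ℝ} (hφ : Dom g φ m) (hψ : Dom g ψ m') : Integrable (fun w : (ℝ × ℝ) × V => φ w.1.1 w.2 * (starRingEnd ℂ) (ψ w.1.2 w.2)) := by
  have h1 : Measurable (fun w : (ℝ × ℝ) × V => φ w.1.1 w.2) := hφ.meas.comp (by fun_prop : Measurable (fun w : (ℝ × ℝ) × V => (w.1.1, w.2)))
  have h2 : Measurable (fun w : (ℝ × ℝ) × V => ψ w.1.2 w.2) := hψ.meas.comp (by fun_prop : Measurable (fun w : (ℝ × ℝ) × V => (w.1.2, w.2)))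
  have hm : Integrable (fun w : (ℝ × ℝ) × V => (m w.1.1 * m' w.1.2) * (g w.2 * g w.2)) :=
    Integrable.mul_prod (hφ.mint.mul_prod hψ.mint) hgg
  refine hm.mono' ?_ (ae_of_all _ fun w => ?_)
  · exact (h1.mul (Complex.continuous_conj.measurable.comp h2)).aestronglyMeasurable
  · rw [norm_mul, RCLike.norm_conj]
    calc _ ≤ (g w.2 * m w.1.1) * (g w.2 * m' w.1.2) := by
          gcongr
          · exact mul_nonneg (hg0 _) (hφ.mnn _)
          · exact hφ.bd _ _
          · exact hψ.bd _ _
      _ = _ := by ring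

lemma gram_int {g : V → ℝ} (hg0 : ∀ ξ, 0 ≤ g ξ) (hgg : Integrable (fun ξ => g ξ * g ξ))
    {φ ψ : ℝ → V → ℂ} {m m' : ℝ → ℝ} (hφ : Dom g φ m) (hψ : Dom g ψ m') : Integrable (GQ φ ψ) := by
  have := (gram_tri hg0 hgg hφ hψ).integral_prod_left
  exact this

lemma gram_eq {g : V → ℝ} (hg0 : ∀ ξ, 0 ≤ g ξ) (hgg : Integrable (fun ξ => g ξ * g ξ))
    {φ ψ : ℝ → V → ℂ} {m m' : ℝ → ℝ} (hφ : Dom g φ m) (hψ : Dom g ψ m') (A A' : Set ℝ) :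
    ∫ z in A ×ˢ A', GQ φ ψ z = ∫ ξ, (∫ s in A, φ s ξ) * (starRingEnd ℂ) (∫ s in A', ψ s ξ) := by
  have h := gram_tri hg0 hgg hφ hψ
  have h' : Integrable (Function.uncurry fun (z : ℝ × ℝ) (ξ : V) => φ z.1 ξ * (starRingEnd ℂ) (ψ z.2 ξ)) (((volume : Measure (ℝ × ℝ)).restrict (A ×ˢ A')).prod volume) := by
    refine h.mono_measure ?_
    have := Measure.prod_restrict (μ := (volume : Measure (ℝ × ℝ))) (ν := (volume : Measure V)) (A ×ˢ A') Set.univ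
    rw [Measure.restrict_univ] at this
    rw [this]
    exact Measure.restrict_le_self
  unfold GQ
  rw [integral_integral_swap h']
  congr 1; ext ξ
  rw [Measure.volume_eq_prod, ← integral_conj]
  exact setIntegral_prod_mul (fun s => φ s ξ) (fun t => (starRingEnd ℂ) (ψ t ξ)) A A'

end gram

lemma cs_int {α : Type*} [MeasurableSpace α] (μ : Measure α) (f g : α → ℂ) (hf : AEMeasurable f μ) (hg : AEMeasurable g μ) :
    ‖∫ a, f a * (starRingEnd ℂ) (g a) ∂μ‖ₑ ^ 2 ≤ (∫⁻ a, ‖f a‖ₑ ^ 2 ∂μ) * ∫⁻ a, ‖g a‖ₑ ^ 2 ∂μ := by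
  have h := ENNReal.lintegral_mul_norm_pow_le (μ := μ) (f := fun a => ‖f a‖ₑ ^ 2) (g := fun a => ‖g a‖ₑ ^ 2)
    (by fun_prop) (by fun_prop) (p := 1/2) (q := 1/2) (by norm_num) (by norm_num) (by norm_num)
  have e1 : ∀ z : ℝ≥0∞, (z ^ 2) ^ (1/2 : ℝ) = z := fun z => by
    rw [← ENNReal.rpow_natCast, ← ENNReal.rpow_mul]; norm_num
  have e2 : ∀ z : ℝ≥0∞, (z ^ (1/2 : ℝ)) ^ 2 = z := fun z => by
    rw [← ENNReal.rpow_natCast, ← ENNReal.rpow_mul]; norm_num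
  simp_rw [e1] at h
  calc _ ≤ (∫⁻ a, ‖f a‖ₑ * ‖g a‖ₑ ∂μ) ^ 2 := by
        gcongr
        refine (enorm_integral_le_lintegral_enorm _).trans (lintegral_mono fun a => ?_)
        rw [enorm_mul]
        gcongr
        exact le_of_eq (by rw [← ofReal_norm, RCLike.norm_conj, ofReal_norm])
    _ ≤ _ := by
        refine (pow_le_pow_left' h 2).trans (le_of_eq ?_)
        rw [mul_pow, e2, e2]

section gram2
variable {V : Type*} [NormedAddCommGroup V] [InnerProductSpace ℝ V] [FiniteDimensional ℝ V]
  [MeasurableSpace V] [BorelSpace V]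

lemma gram_meas {g : V → ℝ} (hg0 : ∀ ξ, 0 ≤ g ξ) (hgg : Integrable (fun ξ => g ξ * g ξ))
    {φ : ℝ → V → ℂ} {m : ℝ → ℝ} (hφ : Dom g φ m) (A : Set ℝ) : Measurable (fun ξ => ∫ s in A, φ s ξ) := by
  have := hφ.meas.stronglyMeasurable
  exact (StronglyMeasurable.integral_prod_left (f := fun s ξ => φ s ξ) (μ := volume.restrict A) this).measurable

lemma gram_sq {g : V → ℝ} (hg0 : ∀ ξ, 0 ≤ g ξ) (hgg : Integrable (fun ξ => g ξ * g ξ))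
    {φ : ℝ → V → ℂ} {m : ℝ → ℝ} (hφ : Dom g φ m) (A : Set ℝ) : ‖∫ z in A ×ˢ A, GQ φ φ z‖ₑ = ∫⁻ ξ, ‖∫ s in A, φ s ξ‖ₑ ^ 2 := by
  rw [gram_eq hg0 hgg hφ hφ]
  have hm := gram_meas hg0 hgg hφ A
  have e : ∀ ξ, (∫ s in A, φ s ξ) * (starRingEnd ℂ) (∫ s in A, φ s ξ) = ((‖∫ s in A, φ s ξ‖ ^ 2 : ℝ) : ℂ) := fun ξ => by
    rw [Complex.mul_conj, Complex.normSq_eq_norm_sq]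
  simp_rw [e]
  rw [integral_complex_ofReal]
  have hI : Integrable (fun ξ => ‖∫ s in A, φ s ξ‖ ^ 2) := by
    refine (hgg.mul_const ((∫ s, m s) * ∫ s, m s)).mono' (Measurable.aestronglyMeasurable (by fun_prop)) (ae_of_all _ fun ξ => ?_)
    rw [Real.norm_of_nonneg (by positivity), sq]
    have hb : ‖∫ s in A, φ s ξ‖ ≤ g ξ * ∫ s, m s := by
      calc _ ≤ ∫ s in A, g ξ * m s := norm_integral_le_of_norm_le ((hφ.mint.const_mul _).integrableOn) (ae_of_all _ fun s => hφ.bd s ξ)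
        _ ≤ ∫ s, g ξ * m s := setIntegral_le_integral (hφ.mint.const_mul _) (ae_of_all _ fun s => mul_nonneg (hg0 _) (hφ.mnn _))
        _ = _ := integral_const_mul _ _
    calc _ ≤ (g ξ * ∫ s, m s) * (g ξ * ∫ s, m s) := mul_le_mul hb hb (norm_nonneg _) ((norm_nonneg _).trans hb)
      _ = _ := by ring
  rw [← ofReal_norm, Complex.norm_of_nonneg (integral_nonneg fun ξ => by positivity),
    ofReal_integral_eq_lintegral_ofReal hI (ae_of_all _ fun ξ => by positivity)]
  congr 1; ext ξ
  rw [ENNReal.ofReal_pow (norm_nonneg _), ofReal_norm]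

lemma gram_cs {g : V → ℝ} (hg0 : ∀ ξ, 0 ≤ g ξ) (hgg : Integrable (fun ξ => g ξ * g ξ))
    {φ ψ : ℝ → V → ℂ} {m m' : ℝ → ℝ} (hφ : Dom g φ m) (hψ : Dom g ψ m') (A A' : Set ℝ) : ‖∫ z in A ×ˢ A', GQ φ ψ z‖ₑ ^ 2 ≤ ‖∫ z in A ×ˢ A, GQ φ φ z‖ₑ * ‖∫ z in A' ×ˢ A', GQ ψ ψ z‖ₑ := by
  rw [gram_sq hg0 hgg hφ, gram_sq hg0 hgg hψ, gram_eq hg0 hgg hφ hψ]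
  exact cs_int _ _ _ (gram_meas hg0 hgg hφ A).aemeasurable (gram_meas hg0 hgg hψ A').aemeasurable

lemma gram_symm {g : V → ℝ} (hg0 : ∀ ξ, 0 ≤ g ξ) (hgg : Integrable (fun ξ => g ξ * g ξ))
    {φ ψ : ℝ → V → ℂ} {m m' : ℝ → ℝ} (hφ : Dom g φ m) (hψ : Dom g ψ m') : ‖∫ z, GQ φ ψ z‖ₑ = ‖∫ z, GQ ψ φ z‖ₑ := by
  have h1 := gram_eq hg0 hgg hφ hψ Set.univ Set.univ
  have h2 := gram_eq hg0 hgg hψ hφ Set.univ Set.univ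
  simp only [Set.univ_prod_univ, Measure.restrict_univ] at h1 h2
  rw [h1, h2, ← ofReal_norm, ← ofReal_norm, ← RCLike.norm_conj, ← integral_conj]
  congr 3; ext ξ
  simp [mul_comm]
end gram2
end DS

namespace DS

section qb
variable {V : Type*} [NormedAddCommGroup V] [InnerProductSpace ℝ V] [FiniteDimensional ℝ V]
  [MeasurableSpace V] [BorelSpace V]

lemma conj_fourier (g : V → ℂ) (ξ : V) : (starRingEnd ℂ) (𝓕 g ξ) = 𝓕⁻ (fun x => (starRingEnd ℂ) (g x)) ξ := by
  rw [Real.fourier_eq', Real.fourierInv_eq', ← integral_conj]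
  congr 1; ext x
  simp only [smul_eq_mul, map_mul, ← Complex.exp_conj, conj_I, conj_ofReal]
  congr 2
  push_cast; ring

lemma Q_disp (f g : V → ℂ) (hf : Integrable f) (hg : Integrable g) (w : ℂ) (hw : 0 < w.re) (B : ℝ)
    (hB : ∀ x : V, ‖PK w x‖ ≤ B) :
    ‖∫ ξ, cexp (-(w * ‖ξ‖)) * 𝓕 f ξ * (starRingEnd ℂ) (𝓕 g ξ)‖ ≤ B * ((∫ x, ‖f x‖) * ∫ x, ‖g x‖) := by
  have hk := integrable_cexp (V := V) w hw
  have hgc : Integrable (fun x => (starRingEnd ℂ) (g x)) := by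
    exact (Complex.conjCLE : ℂ →L[ℝ] ℂ).integrable_comp hg
  have hkg : ∀ x : V, Integrable (fun ξ : V => cexp (↑(-2 * Real.pi * inner ℝ ξ x) * I) * cexp (-(w * ‖ξ‖))) := by
    intro x
    refine hk.bdd_mul (c := 1) (Measurable.aestronglyMeasurable (by fun_prop)) (ae_of_all _ fun z => ?_)
    rw [Complex.norm_exp_ofReal_mul_I]
  have hcont : Continuous (fun ξ => (starRingEnd ℂ) (𝓕 g ξ)) := Complex.continuous_conj.comp (continuous_fourier' g hg)
  have hkG : Integrable (fun ξ : V => cexp (-(w * ‖ξ‖)) * (starRingEnd ℂ) (𝓕 g ξ)) := by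
    refine hk.mul_bdd (c := ∫ x, ‖g x‖) hcont.aestronglyMeasurable (ae_of_all _ fun ξ => ?_)
    rw [RCLike.norm_conj]; exact norm_fourier_le g ξ
  have e1 : ∫ ξ, cexp (-(w * ‖ξ‖)) * 𝓕 f ξ * (starRingEnd ℂ) (𝓕 g ξ) = ∫ x, f x * 𝓕 (fun ξ : V => cexp (-(w * ‖ξ‖)) * (starRingEnd ℂ) (𝓕 g ξ)) x := by
    rw [← fourier_mul_flip _ _ hf hkG]
    congr 1; ext ξ; ring
  have e2 : ∀ x, ‖𝓕 (fun ξ : V => cexp (-(w * ‖ξ‖)) * (starRingEnd ℂ) (𝓕 g ξ)) x‖ ≤ B * ∫ x, ‖g x‖ := by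
    intro x
    have : 𝓕 (fun ξ : V => cexp (-(w * ‖ξ‖)) * (starRingEnd ℂ) (𝓕 g ξ)) x = ∫ y, (starRingEnd ℂ) (g y) * PK w (y - x) := by
      rw [Real.fourier_eq']
      have h3 := fourierInv_mul_flip _ _ hgc (hkg x)
      have e4 : ∀ y, 𝓕⁻ (fun ξ : V => cexp (↑(-2 * Real.pi * inner ℝ ξ x) * I) * cexp (-(w * ‖ξ‖))) y = PK w (y - x) := by
        intro y
        rw [PK, Real.fourierInv_eq', Real.fourierInv_eq']
        congr 1; ext ξ
        rw [smul_eq_mul, smul_eq_mul, ← mul_assoc, ← Complex.exp_add, inner_sub_right]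
        congr 2
        push_cast; ring
      simp_rw [e4] at h3
      rw [← h3]
      congr 1; ext ξ
      rw [← conj_fourier, smul_eq_mul]
      ring
    rw [this, ← integral_const_mul]
    refine norm_integral_le_of_norm_le (hg.norm.const_mul B) (ae_of_all _ fun y => ?_)
    rw [norm_mul, RCLike.norm_conj, mul_comm]
    gcongr
    exact hB _
  rw [e1, ← mul_assoc, mul_comm B, mul_assoc, ← integral_mul_const]
  refine norm_integral_le_of_norm_le (hf.norm.mul_const _) (ae_of_all _ fun x => ?_)
  rw [norm_mul]
  gcongr
  exact e2 x

lemma plancherel_lin (f : V → ℂ) (hf : Integrable f) : ∫⁻ ξ, ‖𝓕 f ξ‖ₑ ^ 2 ≤ ∫⁻ x, ‖f x‖ₑ ^ 2 := by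
  have h := plancherel_le f hf
  rw [eLpNorm_eq_lintegral_rpow_enorm_toReal (by norm_num) (by norm_num), eLpNorm_eq_lintegral_rpow_enorm_toReal (by norm_num) (by norm_num)] at h
  have h2 := ENNReal.rpow_le_rpow h (z := 2) (by norm_num)
  rw [← ENNReal.rpow_mul, ← ENNReal.rpow_mul] at h2
  norm_num at h2
  exact h2

lemma Q_en (f g : V → ℂ) (hf : Integrable f) (hg : Integrable g) (w : ℂ) (hw : 0 < w.re) :
    ‖∫ ξ, cexp (-(w * ‖ξ‖)) * 𝓕 f ξ * (starRingEnd ℂ) (𝓕 g ξ)‖ₑ ^ 2 ≤ (∫⁻ x, ‖f x‖ₑ ^ 2) * ∫⁻ x, ‖g x‖ₑ ^ 2 := by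
  have cf := (continuous_fourier' f hf).measurable
  have cg := (continuous_fourier' g hg).measurable
  refine (cs_int volume _ _ (Measurable.aemeasurable (by fun_prop)) (Measurable.aemeasurable (by fun_prop))).trans ?_
  gcongr ?_ * ?_
  · refine le_trans (lintegral_mono fun ξ => ?_) (plancherel_lin f hf)
    rw [enorm_mul]
    have : ‖cexp (-(w * ‖ξ‖))‖ₑ ≤ 1 := by
      rw [← ofReal_norm, ← ENNReal.ofReal_one]
      apply ENNReal.ofReal_le_ofReal
      rw [Complex.norm_exp, Real.exp_le_one_iff]
      simp only [neg_re, mul_re, ofReal_re, ofReal_im, mul_zero, sub_zero]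
      have := mul_nonneg hw.le (norm_nonneg ξ)
      linarith
    calc _ ≤ (1 * ‖𝓕 f ξ‖ₑ) ^ 2 := by gcongr
      _ = _ := by rw [one_mul]
  · exact plancherel_lin g hg

/-- damped half-wave transform of a slice -/
def WV (a : ℝ) (F : ℝ → V → ℂ) (s : ℝ) (ξ : V) : ℂ := cexp (-(((a / 2 : ℝ) + s * I) * ‖ξ‖)) * 𝓕 (F s) ξ

structure Adm (F : ℝ → V → ℂ) : Prop where
  meas : Measurable (fun z : ℝ × V => F z.1 z.2)
  nice : ∀ s, Nice (F s)
  int : Integrable (fun z : ℝ × V => F z.1 z.2)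

lemma fourier_slice_meas {F : ℝ → V → ℂ} (hF : Measurable (fun z : ℝ × V => F z.1 z.2)) :
    Measurable (fun z : ℝ × V => 𝓕 (F z.1) z.2) := by
  simp_rw [Real.fourier_eq', smul_eq_mul]
  have h1 : Measurable (fun w : (ℝ × V) × V => F w.1.1 w.2) := hF.comp (by fun_prop : Measurable (fun w : (ℝ × V) × V => (w.1.1, w.2)))
  have : StronglyMeasurable (fun w : (ℝ × V) × V => cexp (↑(-2 * Real.pi * inner ℝ w.2 w.1.2) * I) * F w.1.1 w.2) :=
    Measurable.stronglyMeasurable (by fun_prop)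
  exact this.integral_prod_right'.measurable

lemma WV_dom (a : ℝ) {F : ℝ → V → ℂ} (hF : Adm F) :
    Dom (fun ξ : V => Real.exp (-(a / 2) * ‖ξ‖)) (WV a F) (fun s => ∫ x, ‖F s x‖) := by
  refine ⟨?_, ?_, ?_, ?_⟩
  · have := fourier_slice_meas hF.meas
    unfold WV
    fun_prop
  · intro s ξ
    unfold WV
    rw [norm_mul, Complex.norm_exp]
    have : (-(((a / 2 : ℝ) + s * I) * ‖ξ‖ : ℂ)).re = -(a / 2) * ‖ξ‖ := by simp
    rw [this]
    gcongr
    exact norm_fourier_le _ _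
  · exact hF.int.norm.integral_prod_left
  · intro s; positivity

lemma exp_half_sq (a : ℝ) (ha : 0 < a) : Integrable (fun ξ : V => Real.exp (-(a / 2) * ‖ξ‖) * Real.exp (-(a / 2) * ‖ξ‖)) := by
  refine (integrable_exp_neg_norm (V := V) a ha).congr (ae_of_all _ fun ξ => ?_)
  simp only
  rw [← Real.exp_add]; congr 1; ring

lemma GQ_WV (a : ℝ) (F G : ℝ → V → ℂ) (z : ℝ × ℝ) :
    GQ (WV a F) (WV a G) z = ∫ ξ, cexp (-(((a : ℂ) + ((z.1 - z.2 : ℝ) : ℂ) * I) * ‖ξ‖)) * 𝓕 (F z.1) ξ * (starRingEnd ℂ) (𝓕 (G z.2) ξ) := by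
  unfold GQ WV
  congr 1; ext ξ
  rw [map_mul, ← Complex.exp_conj]
  simp only [map_neg, map_mul, map_add, conj_ofReal, conj_I]
  have : ∀ A B C D : ℂ, A * B * (C * D) = (A * C) * B * D := fun A B C D => by ring
  rw [this, ← Complex.exp_add]
  congr 3
  push_cast; ring

lemma gram_wint {g : V → ℝ} (hg0 : ∀ ξ, 0 ≤ g ξ) (hgg : Integrable (fun ξ => g ξ * g ξ))
  {φ ψ : ℝ → V → ℂ} {m m' : ℝ → ℝ} (hφ : Dom g φ m) (hψ : Dom g ψ m') :
    Integrable (fun ξ => (∫ s, φ s ξ) * (starRingEnd ℂ) (∫ s, ψ s ξ)) := by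
  have h1 := gram_meas hg0 hgg hφ Set.univ
  have h2 := gram_meas hg0 hgg hψ Set.univ
  simp only [Measure.restrict_univ] at h1 h2
  have hb : ∀ {φ : ℝ → V → ℂ} {m : ℝ → ℝ} (_ : Dom g φ m) (ξ : V), ‖∫ s, φ s ξ‖ ≤ g ξ * ∫ s, m s := by
    intro φ m hφ ξ
    rw [← integral_const_mul]
    exact norm_integral_le_of_norm_le (hφ.mint.const_mul _) (ae_of_all _ fun s => hφ.bd s ξ)
  refine (hgg.mul_const ((∫ s, m s) * ∫ s, m' s)).mono' (Measurable.aestronglyMeasurable (by fun_prop)) (ae_of_all _ fun ξ => ?_)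
  rw [norm_mul, RCLike.norm_conj]
  calc _ ≤ (g ξ * ∫ s, m s) * (g ξ * ∫ s, m' s) := mul_le_mul (hb hφ ξ) (hb hψ ξ) (norm_nonneg _) ((norm_nonneg _).trans (hb hφ ξ))
    _ = _ := by ring

lemma sum_wave {g : V → ℝ} (hg0 : ∀ ξ, 0 ≤ g ξ) (hgg : Integrable (fun ξ => g ξ * g ξ))
    (φ : ℤ → ℝ → V → ℂ) (m : ℤ → ℝ → ℝ) (hφ : ∀ h, Dom g (φ h) (m h)) (H : Finset ℤ) :
    ∫⁻ ξ, ‖∑ h ∈ H, ∫ s, φ h s ξ‖ₑ ^ 2 ≤ ∑ h ∈ H, ∑ h' ∈ H, ‖∫ z, GQ (φ h) (φ h') z‖ₑ := by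
  set w : ℤ → V → ℂ := fun h ξ => ∫ s, φ h s ξ with hw
  have hI : ∀ h h', Integrable (fun ξ => w h ξ * (starRingEnd ℂ) (w h' ξ)) := fun h h' => gram_wint hg0 hgg (hφ h) (hφ h')
  have hpt : ∀ ξ, ((‖∑ h ∈ H, w h ξ‖ ^ 2 : ℝ) : ℂ) = ∑ h ∈ H, ∑ h' ∈ H, w h ξ * (starRingEnd ℂ) (w h' ξ) := by
    intro ξ
    rw [← Complex.normSq_eq_norm_sq, ← Complex.mul_conj, map_sum, Finset.sum_mul_sum]
  have hIs : Integrable (fun ξ => ∑ h ∈ H, ∑ h' ∈ H, w h ξ * (starRingEnd ℂ) (w h' ξ)) :=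
    integrable_finsetSum _ fun h _ => integrable_finsetSum _ fun h' _ => hI h h'
  have hIr : Integrable (fun ξ => ‖∑ h ∈ H, w h ξ‖ ^ 2) := by
    have := hIs.re
    refine this.congr (ae_of_all _ fun ξ => ?_)
    simp only [← hpt, RCLike.re_eq_complex_re, ofReal_re]
  have e1 : ∫⁻ ξ, ‖∑ h ∈ H, w h ξ‖ₑ ^ 2 = ‖∫ ξ, ((‖∑ h ∈ H, w h ξ‖ ^ 2 : ℝ) : ℂ)‖ₑ := by
    rw [integral_complex_ofReal, ← ofReal_norm, Complex.norm_of_nonneg (integral_nonneg fun ξ => by positivity),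
      ofReal_integral_eq_lintegral_ofReal hIr (ae_of_all _ fun ξ => by positivity)]
    congr 1; ext ξ
    rw [ENNReal.ofReal_pow (norm_nonneg _), ofReal_norm]
  rw [e1]
  simp_rw [hpt]
  rw [integral_finsetSum _ (fun h _ => integrable_finsetSum _ fun h' _ => hI h h')]
  refine (enorm_sum_le _ _).trans (Finset.sum_le_sum fun h _ => ?_)
  rw [integral_finsetSum _ (fun h' _ => hI h h')]
  refine (enorm_sum_le _ _).trans (Finset.sum_le_sum fun h' _ => ?_)
  have := gram_eq hg0 hgg (hφ h) (hφ h') Set.univ Set.univ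
  simp only [Set.univ_prod_univ, Measure.restrict_univ] at this
  rw [this]

end qb
end DS

namespace DS

section slicing
variable {V : Type*} [NormedAddCommGroup V] [InnerProductSpace ℝ V] [FiniteDimensional ℝ V]
  [MeasurableSpace V] [BorelSpace V]

/-- the p-th power integral -/
def Nn (p : ℝ) (f : V → ℂ) : ℝ≥0∞ := ∫⁻ x, ‖f x‖ₑ ^ p

def Rn (p : ℝ) (f : V → ℂ) : ℝ := (Nn p f).toReal ^ (1 / p)

def hidx (p : ℝ) (f : V → ℂ) (x : V) : ℤ := ⌊Real.log (‖f x‖ / Rn p f) / Real.log 2⌋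

/-- dyadic level-set piece -/
def slc (p : ℝ) (h : ℤ) (f : V → ℂ) (x : V) : ℂ := if hidx p f x = h then f x else 0

def ev (p : ℝ) (h : ℤ) (f : V → ℂ) : ℝ≥0∞ := Nn p f ^ (1 / p - 1 / 2) * Nn p (slc p h f) ^ ((1:ℝ) / 2)

lemma slc_sum (p : ℝ) (H : Finset ℤ) (f : V → ℂ) (x : V) :
    ∑ h ∈ H, slc p h f x = if hidx p f x ∈ H then f x else 0 := by
  simp only [slc]
  rw [Finset.sum_ite_eq]

lemma slc_le (p : ℝ) (h : ℤ) (f : V → ℂ) (x : V) : ‖slc p h f x‖ ≤ ‖f x‖ := by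
  unfold slc; split_ifs <;> simp

lemma slc_meas (p : ℝ) (h : ℤ) {F : ℝ → V → ℂ} (hF : Measurable (fun z : ℝ × V => F z.1 z.2)) :
    Measurable (fun z : ℝ × V => slc p h (F z.1) z.2) := by
  unfold slc
  refine Measurable.ite ?_ hF measurable_const
  have hN : Measurable (fun s : ℝ => Nn p (F s)) := by
    unfold Nn
    exact Measurable.lintegral_prod_right' (f := fun z : ℝ × V => ‖F z.1 z.2‖ₑ ^ p) (by fun_prop)
  have hR : Measurable (fun z : ℝ × V => Rn p (F z.1)) := by
    unfold Rn
    exact (hN.ennreal_toReal.pow_const _).comp measurable_fst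
  have : Measurable (fun z : ℝ × V => hidx p (F z.1) z.2) := by
    unfold hidx
    exact Measurable.floor (((Real.measurable_log.comp (hF.norm.div hR))).div_const _)
  exact this (measurableSet_singleton h)

lemma slc_nice (p : ℝ) (h : ℤ) {f : V → ℂ} (hf : Nice f) : Nice (slc p h f) := by
  have hm : Measurable (slc p h f) := by
    have h1 : Measurable (fun z : ℝ × V => slc p h f z.2) := slc_meas p h (F := fun _ : ℝ => f) (hf.meas.comp measurable_snd)
    have h2 : Measurable (fun x : V => ((0:ℝ), x)) := by fun_prop
    have h3 := h1.comp h2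
    simp only [Function.comp_def] at h3
    exact h3
  refine ⟨hm, ?_, hf.int.mono hm.aestronglyMeasurable (Filter.Eventually.of_forall (slc_le p h f))⟩
  obtain ⟨M, hM⟩ := hf.bdd
  exact ⟨M, fun x => (slc_le p h f x).trans (hM x)⟩

lemma slc_adm (p : ℝ) (h : ℤ) {F : ℝ → V → ℂ} (hF : Adm F) : Adm (fun s => slc p h (F s)) := by
  refine ⟨slc_meas p h hF.meas, fun s => slc_nice p h (hF.nice s), ?_⟩
  exact hF.int.mono (slc_meas p h hF.meas).aestronglyMeasurable (Filter.Eventually.of_forall fun z => slc_le p h _ _)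

lemma slc_Nn_le (p : ℝ) (hp : 0 ≤ p) (h : ℤ) (f : V → ℂ) : Nn p (slc p h f) ≤ Nn p f := by
  unfold Nn
  gcongr with x
  exact enorm_le_iff_norm_le.2 (slc_le p h f x)

lemma Rn_pow (p : ℝ) (hp : 1 < p) {f : V → ℂ} (hf : Nice f) : Nn p f = ENNReal.ofReal (Rn p f ^ p) := by
  have : Nn p f ≠ ⊤ := (LP_Lp_fin p hp hf).ne
  rw [Rn, ← Real.rpow_mul ENNReal.toReal_nonneg, one_div_mul_cancel (by linarith), Real.rpow_one, ENNReal.ofReal_toReal this]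

lemma Rn_zero (p : ℝ) (hp : 1 < p) {f : V → ℂ} (hf : Nice f) (h0 : Rn p f = 0) : f =ᵐ[volume] 0 := by
  have h1 := Rn_pow p hp hf
  rw [h0, Real.zero_rpow (by linarith), ENNReal.ofReal_zero, Nn, lintegral_eq_zero_iff (by have := hf.meas; fun_prop)] at h1
  filter_upwards [h1] with x hx
  have : ‖f x‖ₑ ^ p = 0 := hx
  rw [ENNReal.rpow_eq_zero_iff] at this
  rcases this with h | h
  · simpa using h.1
  · linarith [h.2]

lemma slc_bds (p : ℝ) (h : ℤ) (f : V → ℂ) (hR : 0 < Rn p f) (x : V) (hx : slc p h f x ≠ 0) :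
    (2:ℝ) ^ (h:ℝ) * Rn p f ≤ ‖slc p h f x‖ ∧ ‖slc p h f x‖ ≤ (2:ℝ) ^ ((h:ℝ) + 1) * Rn p f := by
  have hi : hidx p f x = h := by
    by_contra hc; exact hx (by simp [slc, hc])
  have hs : slc p h f x = f x := by simp [slc, hi]
  rw [hs] at hx ⊢
  have hpos : 0 < ‖f x‖ / Rn p f := div_pos (norm_pos_iff.2 hx) hR
  have hl2 : 0 < Real.log 2 := Real.log_pos (by norm_num)
  have e1 : ‖f x‖ / Rn p f = (2:ℝ) ^ (Real.log (‖f x‖ / Rn p f) / Real.log 2) := by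
    rw [Real.rpow_def_of_pos (by norm_num), mul_div_cancel₀ _ hl2.ne', Real.exp_log hpos]
  unfold hidx at hi
  rw [Int.floor_eq_iff] at hi
  rw [← le_div_iff₀ hR, ← div_le_iff₀ hR, e1]
  exact ⟨Real.rpow_le_rpow_of_exponent_le (by norm_num) hi.1, Real.rpow_le_rpow_of_exponent_le (by norm_num) hi.2.le⟩

lemma slc_sq (p : ℝ) (hp : 1 < p) (hp2 : p < 2) (H : Finset ℤ) {f : V → ℂ} (hf : Nice f) :
    ∑ h ∈ H, ev p h f * ev p h f ≤ Nn p f ^ (1 / p) * Nn p f ^ (1 / p) := by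
  have hth : 0 < 1 / p - 1 / 2 := by
    rw [sub_pos]; exact one_div_lt_one_div_of_lt (by linarith) hp2
  have e1 : ∀ h, ev p h f * ev p h f = Nn p f ^ (2 * (1 / p - 1 / 2)) * Nn p (slc p h f) := by
    intro h
    unfold ev
    rw [mul_mul_mul_comm, ← ENNReal.rpow_add_of_nonneg _ _ hth.le hth.le, ← ENNReal.rpow_add_of_nonneg _ _ (by norm_num) (by norm_num)]
    norm_num [two_mul]
  simp_rw [e1]
  rw [← Finset.mul_sum]
  have e2 : ∑ h ∈ H, Nn p (slc p h f) ≤ Nn p f := by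
    unfold Nn
    rw [← lintegral_finsetSum]
    · gcongr with x
      have : ∀ h, ‖slc p h f x‖ₑ ^ p = if hidx p f x = h then ‖f x‖ₑ ^ p else 0 := by
        intro h; unfold slc; split_ifs <;> simp; linarith
      simp_rw [this]
      rw [Finset.sum_ite_eq]
      split_ifs <;> simp
    · intro h _
      have := (slc_nice p h hf).meas
      fun_prop
  calc _ ≤ Nn p f ^ (2 * (1 / p - 1 / 2)) * Nn p f ^ (1:ℝ) := by rw [ENNReal.rpow_one]; gcongr
    _ = _ := by
      rw [← ENNReal.rpow_add_of_nonneg _ _ (by positivity) (by norm_num), ← ENNReal.rpow_add_of_nonneg _ _ (by positivity) (by positivity)]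
      congr 1; ring

lemma slc_l1 (p : ℝ) (hp : 1 < p) (hp2 : p < 2) (h : ℤ) {f : V → ℂ} (hf : Nice f) :
    ∫⁻ x, ‖slc p h f x‖ₑ ≤ ENNReal.ofReal ((2:ℝ) ^ ((h:ℝ) * (1 - p))) * ev p h f := by
  have hR0 : 0 ≤ Rn p f := Real.rpow_nonneg ENNReal.toReal_nonneg _
  rcases hR0.eq_or_lt with h0 | hR
  · have := Rn_zero p hp hf h0.symm
    rw [lintegral_congr_ae (g := fun _ => 0)]
    · simp
    · filter_upwards [this] with x hx
      simp [slc, hx]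
  set N := Rn p f
  set E := Nn p (slc p h f)
  have hE : E ≤ ENNReal.ofReal (N ^ p) := by
    rw [← Rn_pow p hp hf]; exact slc_Nn_le p (by linarith) h f
  have hEt : E ≠ ⊤ := ne_top_of_le_ne_top ENNReal.ofReal_ne_top hE
  have b1 : ∫⁻ x, ‖slc p h f x‖ₑ ≤ ENNReal.ofReal (((2:ℝ) ^ (h:ℝ) * N) ^ (1 - p)) * E := by
    unfold E Nn
    rw [← lintegral_const_mul' _ _ ENNReal.ofReal_ne_top]
    gcongr with x
    by_cases hx : slc p h f x = 0
    · simp [hx]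
    obtain ⟨h1, h2⟩ := slc_bds p h f hR x hx
    rw [← ofReal_norm_rpow _ _ (by linarith), ← ofReal_norm, ← ENNReal.ofReal_mul (by positivity)]
    apply ENNReal.ofReal_le_ofReal
    have hp0 : 0 < ‖slc p h f x‖ := norm_pos_iff.2 hx
    calc ‖slc p h f x‖ = ‖slc p h f x‖ ^ (1 - p) * ‖slc p h f x‖ ^ p := by
          rw [← Real.rpow_add hp0]; simp
      _ ≤ _ := by
          gcongr ?_ * _
          exact Real.rpow_le_rpow_of_nonpos (by positivity) h1 (by linarith)
  refine b1.trans ?_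
  have hth : 0 < 1 / p - 1 / 2 := by
    rw [sub_pos]; exact one_div_lt_one_div_of_lt (by linarith) hp2
  have e3 : E = ENNReal.ofReal E.toReal := (ENNReal.ofReal_toReal hEt).symm
  have e4 : ev p h f = ENNReal.ofReal ((N ^ p) ^ (1 / p - 1 / 2) * E.toReal ^ ((1:ℝ) / 2)) := by
    have e5 : Nn p f ^ (1 / p - 1 / 2) = ENNReal.ofReal ((N ^ p) ^ (1 / p - 1 / 2)) := by
      rw [Rn_pow p hp hf, ENNReal.ofReal_rpow_of_nonneg (by positivity) hth.le]
    have e6 : E ^ ((1:ℝ) / 2) = ENNReal.ofReal (E.toReal ^ ((1:ℝ) / 2)) := by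
      rw [← ENNReal.ofReal_rpow_of_nonneg (by positivity) (by norm_num), ← e3]
    rw [ENNReal.ofReal_mul (by positivity), ← e5, ← e6]; rfl
  rw [e4, e3, ← ENNReal.ofReal_mul (by positivity), ← ENNReal.ofReal_mul (by positivity)]
  apply ENNReal.ofReal_le_ofReal
  have hE' : E.toReal ≤ N ^ p := ENNReal.toReal_le_of_le_ofReal (by positivity) hE
  simp only [ENNReal.toReal_ofReal ENNReal.toReal_nonneg]
  set t := E.toReal
  have ht : 0 ≤ t := ENNReal.toReal_nonneg
  calc ((2:ℝ) ^ (h:ℝ) * N) ^ (1 - p) * t = 2 ^ ((h:ℝ) * (1 - p)) * (N ^ (1 - p) * t ^ ((1:ℝ)/2) * t ^ ((1:ℝ)/2)) := by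
        have : t = t ^ ((1:ℝ)/2) * t ^ ((1:ℝ)/2) := by
          rw [← Real.rpow_add' ht (by norm_num)]; norm_num
        rw [Real.mul_rpow (by positivity) hR.le, ← Real.rpow_mul (by norm_num)]
        nth_rewrite 1 [this]
        ring
    _ ≤ 2 ^ ((h:ℝ) * (1 - p)) * (N ^ (1 - p) * (N ^ p) ^ ((1:ℝ)/2) * t ^ ((1:ℝ)/2)) := by gcongr
    _ = _ := by
        congr 2
        rw [← Real.rpow_mul hR.le, ← Real.rpow_mul hR.le, ← Real.rpow_add hR]
        congr 1
        field_simp; ring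

lemma slc_l2 (p : ℝ) (hp : 1 < p) (hp2 : p < 2) (h : ℤ) {f : V → ℂ} (hf : Nice f) :
    ∫⁻ x, ‖slc p h f x‖ₑ ^ 2 ≤ (ENNReal.ofReal (2 * (2:ℝ) ^ ((h:ℝ) * (1 - p / 2))) * ev p h f) ^ 2 := by
  have hR0 : 0 ≤ Rn p f := Real.rpow_nonneg ENNReal.toReal_nonneg _
  rcases hR0.eq_or_lt with h0 | hR
  · have := Rn_zero p hp hf h0.symm
    rw [lintegral_congr_ae (g := fun _ => 0)]
    · simp
    · filter_upwards [this] with x hx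
      simp [slc, hx]
  set N := Rn p f
  set E := Nn p (slc p h f)
  have hE : E ≤ ENNReal.ofReal (N ^ p) := by
    rw [← Rn_pow p hp hf]; exact slc_Nn_le p (by linarith) h f
  have hEt : E ≠ ⊤ := ne_top_of_le_ne_top ENNReal.ofReal_ne_top hE
  have b1 : ∫⁻ x, ‖slc p h f x‖ₑ ^ 2 ≤ ENNReal.ofReal (((2:ℝ) ^ ((h:ℝ) + 1) * N) ^ (2 - p)) * E := by
    unfold E Nn
    rw [← lintegral_const_mul' _ _ ENNReal.ofReal_ne_top]
    gcongr with x
    by_cases hx : slc p h f x = 0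
    · simp [hx]
    obtain ⟨h1, h2⟩ := slc_bds p h f hR x hx
    have hp0 : 0 < ‖slc p h f x‖ := norm_pos_iff.2 hx
    rw [← ofReal_norm_rpow _ _ (by linarith), ← ofReal_norm, ← ENNReal.ofReal_pow hp0.le, ← ENNReal.ofReal_mul (by positivity)]
    apply ENNReal.ofReal_le_ofReal
    calc ‖slc p h f x‖ ^ 2 = ‖slc p h f x‖ ^ (2 - p) * ‖slc p h f x‖ ^ p := by
          rw [← Real.rpow_add hp0]; simp
      _ ≤ _ := by
          gcongr ?_ * _
          exact Real.rpow_le_rpow hp0.le h2 (by linarith)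
  refine b1.trans ?_
  have hth : 0 < 1 / p - 1 / 2 := by
    rw [sub_pos]; exact one_div_lt_one_div_of_lt (by linarith) hp2
  have e3 : E = ENNReal.ofReal E.toReal := (ENNReal.ofReal_toReal hEt).symm
  have e4 : ev p h f = ENNReal.ofReal ((N ^ p) ^ (1 / p - 1 / 2) * E.toReal ^ ((1:ℝ) / 2)) := by
    have e5 : Nn p f ^ (1 / p - 1 / 2) = ENNReal.ofReal ((N ^ p) ^ (1 / p - 1 / 2)) := by
      rw [Rn_pow p hp hf, ENNReal.ofReal_rpow_of_nonneg (by positivity) hth.le]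
    have e6 : E ^ ((1:ℝ) / 2) = ENNReal.ofReal (E.toReal ^ ((1:ℝ) / 2)) := by
      rw [← ENNReal.ofReal_rpow_of_nonneg (by positivity) (by norm_num), ← e3]
    rw [ENNReal.ofReal_mul (by positivity), ← e5, ← e6]; rfl
  rw [e4, e3, ← ENNReal.ofReal_mul (by positivity), ← ENNReal.ofReal_mul (by positivity), ← ENNReal.ofReal_pow (by positivity)]
  apply ENNReal.ofReal_le_ofReal
  simp only [ENNReal.toReal_ofReal ENNReal.toReal_nonneg]
  set t := E.toReal
  have ht : 0 ≤ t := ENNReal.toReal_nonneg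
  have hs : ((N ^ p) ^ (1 / p - 1 / 2)) ^ 2 = N ^ (2 - p) := by
    rw [← Real.rpow_mul hR.le, ← Real.rpow_natCast, ← Real.rpow_mul hR.le]
    congr 1; push_cast; field_simp
  have ht2 : (t ^ ((1:ℝ)/2)) ^ 2 = t := by
    rw [← Real.rpow_natCast, ← Real.rpow_mul ht]; norm_num
  have h2h : ((2:ℝ) ^ ((h:ℝ) * (1 - p / 2))) ^ 2 = 2 ^ ((h:ℝ) * (2 - p)) := by
    rw [← Real.rpow_natCast, ← Real.rpow_mul (by norm_num)]
    congr 1; push_cast; ring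
  rw [mul_pow, mul_pow, mul_pow, hs, ht2, h2h, Real.mul_rpow (by positivity) hR.le, ← Real.rpow_mul (by norm_num)]
  have : (2:ℝ) ^ (((h:ℝ) + 1) * (2 - p)) ≤ 2 ^ 2 * 2 ^ ((h:ℝ) * (2 - p)) := by
    rw [add_mul, Real.rpow_add (by norm_num), mul_comm]
    gcongr
    rw [← Real.rpow_natCast]
    apply Real.rpow_le_rpow_of_exponent_le (by norm_num); push_cast; linarith
  calc _ ≤ (2 ^ 2 * 2 ^ ((h:ℝ) * (2 - p))) * N ^ (2 - p) * t := by gcongr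
    _ = _ := by ring

end slicing
end DS

namespace DS

section single
variable {V : Type*} [NormedAddCommGroup V] [InnerProductSpace ℝ V] [FiniteDimensional ℝ V]
  [MeasurableSpace V] [BorelSpace V]

lemma Nn_meas (p : ℝ) {F : ℝ → V → ℂ} (hF : Measurable (fun z : ℝ × V => F z.1 z.2)) :
    Measurable (fun s : ℝ => Nn p (F s)) := by
  unfold Nn
  exact Measurable.lintegral_prod_right' (f := fun z : ℝ × V => ‖F z.1 z.2‖ₑ ^ p) (by fun_prop)

lemma ev_meas (p : ℝ) (h : ℤ) {F : ℝ → V → ℂ} (hF : Measurable (fun z : ℝ × V => F z.1 z.2)) :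
    Measurable (fun s : ℝ => ev p h (F s)) := by
  unfold ev
  have h1 := Nn_meas p hF
  have h2 : Measurable (fun s : ℝ => Nn p (slc p h (F s))) := Nn_meas p (F := fun s => slc p h (F s)) (slc_meas p h hF)
  fun_prop

lemma Q_disp_e (f g : V → ℂ) (hf : Integrable f) (hg : Integrable g) (w : ℂ) (hw : 0 < w.re) (B : ℝ)
    (hB : ∀ x : V, ‖PK w x‖ ≤ B) :
    ‖∫ ξ, cexp (-(w * ‖ξ‖)) * 𝓕 f ξ * (starRingEnd ℂ) (𝓕 g ξ)‖ₑ ≤ ENNReal.ofReal B * ((∫⁻ x, ‖f x‖ₑ) * ∫⁻ x, ‖g x‖ₑ) := by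
  have hB0 : 0 ≤ B := (norm_nonneg _).trans (hB 0)
  rw [← ofReal_norm, ← ofReal_integral_norm_eq_lintegral_enorm hf, ← ofReal_integral_norm_eq_lintegral_enorm hg,
    ← ENNReal.ofReal_mul (by positivity), ← ENNReal.ofReal_mul (by positivity)]
  exact ENNReal.ofReal_le_ofReal (Q_disp f g hf hg w hw B hB)

/-- finite truncations -/
lemma single_fin (q q' d p : ℝ) (hq : 2 ≤ q) (hqq : 1 / q + 1 / q' = 1) (hp : 1 < p) (hp2 : p < 2)
    (hd : 1 / q = d * (1 / p - 1 / 2)) (hdV : d ≤ ((Module.finrank ℝ V : ℝ) - 1) / 2) :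
    ∃ C : ℝ≥0∞, C ≠ ⊤ ∧ ∀ (a : ℝ) (_ : 0 < a) (F : ℝ → V → ℂ) (_ : Adm F) (H : Finset ℤ),
      ∫⁻ ξ, ‖∑ h ∈ H, ∫ s, WV a (fun s => slc p h (F s)) s ξ‖ₑ ^ 2 ≤
        C * ENNReal.ofReal (a ^ ((d - Module.finrank ℝ V) * (2 * (1 / p - 1 / 2)))) *
          (lq q' Set.univ (fun s => Nn p (F s) ^ (1 / p)) * lq q' Set.univ (fun s => Nn p (F s) ^ (1 / p))) := by
  set θ := 1 / p - 1 / 2 with hθd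
  have hp0 : 0 < p := by linarith
  have hθ0 : 0 < θ := by
    rw [hθd, sub_pos]; exact one_div_lt_one_div_of_lt (by linarith) hp2
  have hθ : θ < 1 / 2 := by
    have : 1 / p < 1 := by rw [div_lt_one hp0]; exact hp
    linarith
  have hθp : θ * p = 1 - p / 2 := by rw [hθd]; field_simp
  have hq0 : 0 < q := by linarith
  have hd0 : 0 < d := by
    have : 0 < d * θ := by rw [← hd]; positivity
    exact pos_of_mul_pos_left this hθ0.le
  have hq'1 : 1 / q' = 1 - 1 / q := by linarith
  have hq1 : 1 / q ≤ 1 / 2 := one_div_le_one_div_of_le (by norm_num) hq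
  have hq'0 : 0 < q' := by
    have : 0 < 1 / q' := by linarith
    exact one_div_pos.1 this
  have hq'2 : q' ≤ 2 := by
    have : 1 / 2 ≤ 1 / q' := by linarith
    exact (one_div_le_one_div (by norm_num) hq'0).1 this
  obtain ⟨C, hC, hK⟩ := kt_sum q q' d θ p hq hqq hθ0 hθ hd hp0
  set N := Module.finrank ℝ V
  have hcP : 0 < cP N := cP_pos N
  refine ⟨C * ENNReal.ofReal (4 * cP N ^ (2 * θ)), ENNReal.mul_ne_top hC ENNReal.ofReal_ne_top, ?_⟩
  intro a ha F hF H
  set A : ℝ := cP N * a ^ (d - N) with hA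
  have hA0 : 0 < A := by positivity
  set α := Real.logb 2 A
  have hα : (2:ℝ) ^ α = A := Real.rpow_logb (by norm_num) (by norm_num) hA0
  set M : ℝ := 4 * A ^ (2 * θ) with hM
  have hM0 : 0 < M := by positivity
  set Fh : ℤ → ℝ → V → ℂ := fun h s => slc p h (F s) with hFh
  have hFa : ∀ h, Adm (Fh h) := fun h => slc_adm p h hF
  have hg0 : ∀ ξ : V, 0 ≤ Real.exp (-(a / 2) * ‖ξ‖) := fun ξ => (Real.exp_pos _).le
  have hgg := exp_half_sq (V := V) a ha
  have hD : ∀ h, Dom (fun ξ : V => Real.exp (-(a / 2) * ‖ξ‖)) (WV a (Fh h)) (fun s => ∫ x, ‖Fh h s x‖) := fun h => WV_dom a (hFa h)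
  have hw : ∀ z : ℝ × ℝ, 0 < ((a : ℂ) + ((z.1 - z.2 : ℝ) : ℂ) * I).re := by intro z; simpa using ha
  have key := hK (ENNReal.ofReal M) α H (fun h s => ev p h (F s)) (fun h h' => GQ (WV a (Fh h)) (WV a (Fh h')))
    (fun h => ev_meas p h hF.meas) (fun h h' => gram_int hg0 hgg (hD h) (hD h')) (fun h h' => gram_symm hg0 hgg (hD h) (hD h'))
    (fun h h' A A' _ _ => gram_cs hg0 hgg (hD h) (hD h') A A') ?_ ?_
  · refine (sum_wave hg0 hgg (fun h => WV a (Fh h)) _ hD H).trans (key.trans ?_)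
    have hm := l2mink q' hq'0 hq'2 H (fun h s => ev p h (F s)) (fun s => Nn p (F s) ^ (1 / p)) 1
      (fun h => ev_meas p h hF.meas) ((Nn_meas p hF.meas).pow_const _)
      (fun s => ENNReal.rpow_ne_top_of_nonneg (by positivity) (LP_Lp_fin p hp (hF.nice s)).ne)
      (fun s => by rw [one_mul]; exact slc_sq p hp hp2 H (hF.nice s))
    rw [one_mul] at hm
    have eM : M = 4 * cP N ^ (2 * θ) * a ^ ((d - N) * (2 * θ)) := by
      rw [hM, hA, Real.mul_rpow hcP.le (by positivity), ← Real.rpow_mul ha.le]; ring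
    rw [eM, ENNReal.ofReal_mul (by positivity), ← mul_assoc]
    gcongr
  · intro h z
    have h1 := Q_en _ _ ((hFa h).nice z.1).int ((hFa h).nice z.2).int _ (hw z)
    rw [← GQ_WV] at h1
    have h2 := h1.trans (mul_le_mul' (slc_l2 p hp hp2 h (hF.nice z.1)) (slc_l2 p hp hp2 h (hF.nice z.2)))
    rw [← mul_pow] at h2
    have h3 := (ENNReal.pow_le_pow_left_iff (n := 2) (by norm_num)).1 h2
    refine h3.trans (le_of_eq ?_)
    have e1 : M * 2 ^ (-(2 * θ * (α - h * p))) = (2 * (2:ℝ) ^ ((h:ℝ) * (1 - p / 2))) * (2 * (2:ℝ) ^ ((h:ℝ) * (1 - p / 2))) := by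
      have : -(2 * θ * (α - h * p)) = α * (-(2 * θ)) + (h * (1 - p / 2) + h * (1 - p/2)) := by
        rw [← hθp]; ring
      rw [this, Real.rpow_add (by norm_num), Real.rpow_mul (by norm_num) α, hα, hM, Real.rpow_neg hA0.le, Real.rpow_add (by norm_num)]
      have : A ^ (2 * θ) ≠ 0 := by positivity
      field_simp
      ring
    rw [← ENNReal.ofReal_mul hM0.le, e1, ENNReal.ofReal_mul (by positivity : (0:ℝ) ≤ 2 * (2:ℝ) ^ ((h:ℝ) * (1 - p / 2)))]
    ring
  · intro h h' z hz
    have hB : ∀ x : V, ‖PK ((a : ℂ) + ((z.1 - z.2 : ℝ) : ℂ) * I) x‖ ≤ A * |z.1 - z.2| ^ (-d) := fun x => PK_bound (V := V) a (z.1 - z.2) d ha (sub_ne_zero.2 hz) hd0.le hdV x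
    have h1 := Q_disp_e _ _ ((hFa h).nice z.1).int ((hFa h').nice z.2).int _ (hw z) _ hB
    rw [← GQ_WV] at h1
    refine h1.trans ?_
    have h2 := mul_le_mul' (slc_l1 p hp hp2 h (hF.nice z.1)) (slc_l1 p hp hp2 h' (hF.nice z.2))
    refine (mul_le_mul' le_rfl h2).trans ?_
    have e1 : M * 2 ^ ((1 / 2 - θ) * ((α - h * p) + (α - h' * p))) = 4 * A * (2 ^ ((h:ℝ) * (1 - p)) * 2 ^ ((h':ℝ) * (1 - p))) := by
      have : (1 / 2 - θ) * ((α - h * p) + (α - h' * p)) = α * (1 - 2 * θ) + (h * (1 - p) + h' * (1 - p)) := by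
        have : (1/2 - θ) * p = p - 1 := by rw [sub_mul, hθp]; ring
        linear_combination (-(h:ℝ) - h') * this
      rw [this, Real.rpow_add (by norm_num), Real.rpow_mul (by norm_num) α, hα, hM, Real.rpow_add (by norm_num)]
      have : A ^ (2 * θ) * A ^ (1 - 2 * θ) = A := by
        rw [← Real.rpow_add hA0]; simp
      linear_combination 4 * (2:ℝ) ^ ((h:ℝ) * (1 - p)) * 2 ^ ((h':ℝ) * (1 - p)) * this
    rw [← ENNReal.ofReal_mul hM0.le, e1, ENNReal.ofReal_mul hA0.le, ENNReal.ofReal_mul (by positivity : 0 ≤ 4 * A), ENNReal.ofReal_mul (by norm_num : (0:ℝ) ≤ 4), ENNReal.ofReal_mul (by positivity : (0:ℝ) ≤ 2 ^ ((h:ℝ) * (1 - p)))]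
    set u := ENNReal.ofReal A
    calc _ = 1 * (u * (ENNReal.ofReal (2 ^ ((h:ℝ) * (1 - p))) * ENNReal.ofReal (2 ^ ((h':ℝ) * (1 - p)))) * (ENNReal.ofReal (|z.1 - z.2| ^ (-d)) * (ev p h (F z.1) * ev p h' (F z.2)))) := by ring
      _ ≤ ENNReal.ofReal 4 * (u * (ENNReal.ofReal (2 ^ ((h:ℝ) * (1 - p))) * ENNReal.ofReal (2 ^ ((h':ℝ) * (1 - p)))) * (ENNReal.ofReal (|z.1 - z.2| ^ (-d)) * (ev p h (F z.1) * ev p h' (F z.2)))) := by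
          gcongr; norm_num
      _ = _ := by ring

lemma meas_slice {f : ℝ → V → ℂ} (hf : Measurable (fun z : ℝ × V => f z.1 z.2)) (ξ : V) : Measurable (fun s => f s ξ) :=
  hf.comp (by fun_prop : Measurable (fun s : ℝ => (s, ξ)))

lemma single_lim (p a : ℝ) (ha : 0 < a) {F : ℝ → V → ℂ} (hF : Adm F) (ξ : V) :
    Filter.Tendsto (fun K : ℕ => ∑ h ∈ Finset.Icc (-(K:ℤ)) K, ∫ s, WV a (fun s => slc p h (F s)) s ξ) Filter.atTop
      (nhds (∫ s, WV a F s ξ)) := by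
  have hm : Integrable (fun s => ∫ x, ‖F s x‖) := hF.int.norm.integral_prod_left
  have hnorm : ∀ s : ℝ, ‖cexp (-(((a / 2 : ℝ) + s * I) * ‖ξ‖))‖ ≤ 1 := by
    intro s
    rw [Complex.norm_exp]
    have : (-(((a / 2 : ℝ) + s * I) * ‖ξ‖ : ℂ)).re = -(a / 2 * ‖ξ‖) := by simp
    rw [this]
    exact Real.exp_le_one_iff.2 (neg_nonpos.2 (by positivity))
  have hWm : ∀ {F : ℝ → V → ℂ}, Adm F → Measurable (fun s => WV a F s ξ) := fun {F} hF => by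
    exact meas_slice (f := WV a F) (WV_dom a hF).meas ξ
  have hWb : ∀ {F : ℝ → V → ℂ}, Adm F → ∀ s, ‖WV a F s ξ‖ ≤ ∫ x, ‖F s x‖ := fun {F} hF s => by
    unfold WV; rw [norm_mul]
    calc _ ≤ 1 * ‖𝓕 (F s) ξ‖ := by gcongr; exact hnorm s
      _ ≤ _ := by rw [one_mul]; exact norm_fourier_le _ _
  have hWi : ∀ {F : ℝ → V → ℂ}, Adm F → Integrable (fun s => WV a F s ξ) := fun {F} hF =>
    (hF.int.norm.integral_prod_left : Integrable (fun s => ∫ x, ‖F s x‖)).mono' (hWm hF).aestronglyMeasurable (ae_of_all _ (hWb hF))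
  have hA : ∀ h, Adm (fun s => slc p h (F s)) := fun h => slc_adm p h hF
  simp_rw [← integral_finsetSum _ (fun h _ => hWi (hA h))]
  have hsum : ∀ (K : ℕ) s, ∑ h ∈ Finset.Icc (-(K:ℤ)) K, WV a (fun s => slc p h (F s)) s ξ =
      cexp (-(((a / 2 : ℝ) + s * I) * ‖ξ‖)) * 𝓕 (fun x => ∑ h ∈ Finset.Icc (-(K:ℤ)) K, slc p h (F s) x) ξ := by
    intro K s
    simp only [WV, ← Finset.mul_sum]
    congr 1
    simp only [Real.fourier_eq']
    rw [← integral_finsetSum]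
    · congr 1; ext x; rw [Finset.smul_sum]
    · intro h _
      have := ((hA h).nice s).int
      refine this.mono ?_ (ae_of_all _ fun x => ?_)
      · have hmm := ((hA h).nice s).meas
        exact Measurable.aestronglyMeasurable (by fun_prop)
      · rw [norm_smul, Complex.norm_exp_ofReal_mul_I, one_mul]
  have hb : ∀ (K : ℕ) s x, ‖∑ h ∈ Finset.Icc (-(K:ℤ)) K, slc p h (F s) x‖ ≤ ‖F s x‖ := by
    intro K s x
    rw [slc_sum]; split_ifs <;> simp
  have hSm : ∀ (K : ℕ) s, Measurable (fun x => ∑ h ∈ Finset.Icc (-(K:ℤ)) K, slc p h (F s) x) := by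
    intro K s
    exact Finset.measurable_sum _ fun h _ => ((hA h).nice s).meas
  refine tendsto_integral_of_dominated_convergence (fun s => ∫ x, ‖F s x‖) ?_ hm ?_ ?_
  · intro K
    exact (Finset.measurable_sum _ fun h _ => hWm (hA h)).aestronglyMeasurable
  · intro K
    refine ae_of_all _ fun s => ?_
    rw [hsum, norm_mul]
    calc _ ≤ 1 * ‖𝓕 (fun x => ∑ h ∈ Finset.Icc (-(K:ℤ)) K, slc p h (F s) x) ξ‖ := by gcongr; exact hnorm s
      _ ≤ ∫ x, ‖∑ h ∈ Finset.Icc (-(K:ℤ)) K, slc p h (F s) x‖ := by rw [one_mul]; exact norm_fourier_le _ _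
      _ ≤ _ := by
        refine integral_mono_of_nonneg (ae_of_all _ fun x => norm_nonneg _) (hF.nice s).int.norm (ae_of_all _ fun x => hb K s x)
  · refine ae_of_all _ fun s => ?_
    simp_rw [hsum]
    unfold WV
    refine Filter.Tendsto.const_mul _ ?_
    simp_rw [Real.fourier_eq']
    refine tendsto_integral_of_dominated_convergence (fun x => ‖F s x‖) ?_ (hF.nice s).int.norm ?_ ?_
    · intro K
      have := hSm K s
      exact Measurable.aestronglyMeasurable (by fun_prop)
    · intro K
      refine ae_of_all _ fun x => ?_
      rw [norm_smul, Complex.norm_exp_ofReal_mul_I, one_mul]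
      exact hb K s x
    · refine ae_of_all _ fun x => ?_
      refine tendsto_const_nhds.congr' ?_
      filter_upwards [Filter.eventually_ge_atTop (hidx p (F s) x).natAbs] with K hK
      rw [slc_sum, if_pos]
      rw [Finset.mem_Icc]; omega

lemma single (q q' d p : ℝ) (hq : 2 ≤ q) (hqq : 1 / q + 1 / q' = 1) (hp : 1 < p) (hp2 : p < 2)
    (hd : 1 / q = d * (1 / p - 1 / 2)) (hdV : d ≤ ((Module.finrank ℝ V : ℝ) - 1) / 2) :
    ∃ C : ℝ≥0∞, C ≠ ⊤ ∧ ∀ (a : ℝ) (_ : 0 < a) (F : ℝ → V → ℂ) (_ : Adm F),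
      ∫⁻ ξ, ‖∫ s, WV a F s ξ‖ₑ ^ 2 ≤
        C * ENNReal.ofReal (a ^ ((d - Module.finrank ℝ V) * (2 * (1 / p - 1 / 2)))) *
          (lq q' Set.univ (fun s => Nn p (F s) ^ (1 / p)) * lq q' Set.univ (fun s => Nn p (F s) ^ (1 / p))) := by
  obtain ⟨C, hC, h⟩ := single_fin (V := V) q q' d p hq hqq hp hp2 hd hdV
  refine ⟨C, hC, fun a ha F hF => ?_⟩
  have hmw : ∀ h, Measurable (fun ξ => ∫ s, WV a (fun s => slc p h (F s)) s ξ) := by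
    intro h
    have := gram_meas (fun ξ => (Real.exp_pos _).le) (exp_half_sq (V := V) a ha) (WV_dom a (slc_adm p h hF)) Set.univ
    simpa using this
  calc ∫⁻ ξ, ‖∫ s, WV a F s ξ‖ₑ ^ 2 = ∫⁻ ξ, Filter.liminf (fun K : ℕ => ‖∑ h ∈ Finset.Icc (-(K:ℤ)) K, ∫ s, WV a (fun s => slc p h (F s)) s ξ‖ₑ ^ 2) Filter.atTop := by
        refine lintegral_congr fun ξ => ?_
        exact ((((ENNReal.continuous_pow 2).tendsto _).comp ((continuous_enorm.tendsto _).comp (single_lim p a ha hF ξ))).liminf_eq).symm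
    _ ≤ Filter.liminf (fun K : ℕ => ∫⁻ ξ, ‖∑ h ∈ Finset.Icc (-(K:ℤ)) K, ∫ s, WV a (fun s => slc p h (F s)) s ξ‖ₑ ^ 2) Filter.atTop := by
        refine lintegral_liminf_le fun K => ?_
        have := Finset.measurable_sum (Finset.Icc (-(K:ℤ)) K) fun h _ => hmw h
        fun_prop
    _ ≤ _ := by
        refine Filter.liminf_le_of_le (by isBoundedDefault) fun b hb => ?_
        obtain ⟨K, hK⟩ := hb.exists
        exact hK.trans (h a ha F hF _)

end single
end DS

namespace DS

section core
variable {V : Type*} [NormedAddCommGroup V] [InnerProductSpace ℝ V] [FiniteDimensional ℝ V]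
  [MeasurableSpace V] [BorelSpace V]

lemma Bop_adm (μ : Measure V) [IsProbabilityMeasure μ] {F : ℝ → V → ℂ} (hF : Adm F) : Adm (fun s => Bop μ (F s)) := by
  have hm : Measurable (fun z : ℝ × V => Bop μ (F z.1) z.2) := by
    unfold Bop
    have h0 := hF.meas
    have h1 : Measurable (fun w : (ℝ × V) × V => F w.1.1 (w.1.2 - w.2)) :=
      hF.meas.comp (by fun_prop : Measurable (fun w : (ℝ × V) × V => (w.1.1, w.1.2 - w.2)))
    exact h1.stronglyMeasurable.integral_prod_right'.measurable
  refine ⟨hm, fun s => Bop_nice μ (hF.nice s), hm.aestronglyMeasurable, ?_⟩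
  have h2 := hF.int.2
  rw [HasFiniteIntegral] at h2 ⊢
  have m1 : Measurable (fun z : ℝ × V => ‖F z.1 z.2‖ₑ) := hF.meas.enorm
  have m2 : Measurable (fun z : ℝ × V => ‖Bop μ (F z.1) z.2‖ₑ) := hm.enorm
  rw [Measure.volume_eq_prod, lintegral_prod _ m1.aemeasurable] at h2
  rw [Measure.volume_eq_prod, lintegral_prod _ m2.aemeasurable]
  refine lt_of_le_of_lt (lintegral_mono fun s => ?_) h2
  have hms := (hF.nice s).meas.enorm
  calc _ ≤ ∫⁻ x, ∫⁻ y, ‖F s (x - y)‖ₑ ∂μ := by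
          gcongr with x
          exact enorm_integral_le_lintegral_enorm _
      _ = ∫⁻ x, ‖F s x‖ₑ := shift_lintegral μ _ hms
      _ = _ := rfl

lemma LP_adm (j : ℤ) {F : ℝ → V → ℂ} (hF : Adm F) : Adm (fun s => LP j (F s)) := by
  have h1 : Adm (fun s => LPu j (F s)) := Bop_adm _ hF
  have h2 := Bop_adm (gm V (3 * aj (j + 1))) (Bop_adm (gm V (3 * aj (j + 1))) h1)
  exact ⟨h1.meas.sub h2.meas, fun s => LP_nice j (hF.nice s), h1.int.sub h2.int⟩

lemma WV_LP (j : ℤ) (a : ℝ) {F : ℝ → V → ℂ} (hF : Adm F) (ξ : V) :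
    ∫ s, WV a (fun s => LP j (F s)) s ξ = ((LPm j ‖ξ‖ * Real.exp (-(a / 2 * ‖ξ‖)) : ℝ) : ℂ) * ∫ s, WV 0 F s ξ := by
  rw [← integral_const_mul]
  congr 1; ext s
  unfold WV
  rw [LP_fourier j (hF.nice s)]
  push_cast
  have : cexp (-(((a:ℂ) / 2 + s * I) * ‖ξ‖)) = cexp (-(a / 2 * ‖ξ‖)) * cexp (-((0 / 2 + s * I) * ‖ξ‖)) := by
    rw [← Complex.exp_add]; congr 1; ring
  rw [this]; ring

def c0 : ℝ := Real.exp (-(4 * Real.pi ^ 2)) * (1 - Real.exp (-(6 * Real.pi ^ 2))) * Real.exp (-1)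

lemma c0_pos : 0 < c0 := by
  unfold c0
  have hpi : 0 < Real.pi ^ 2 := by have := Real.pi_pos; positivity
  have : Real.exp (-(6 * Real.pi ^ 2)) < 1 := Real.exp_zero ▸ Real.exp_lt_exp.2 (by linarith)
  have : 0 < 1 - Real.exp (-(6 * Real.pi ^ 2)) := by linarith
  positivity

lemma LPm_lower (j : ℤ) (ρ : ℝ) (h1 : (2:ℝ) ^ j ≤ ρ) (h2 : ρ < (2:ℝ) ^ (j + 1)) :
    c0 ≤ LPm j ρ * Real.exp (-((2:ℝ) ^ (-j) / 2 * ρ)) := by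
  set X : ℝ := (2:ℝ) ^ j with hX
  have hX0 : 0 < X := by positivity
  have e1 : (2:ℝ) ^ (-j) = X⁻¹ := by rw [zpow_neg]
  have e2 : aj (j + 1) = (X ^ 2)⁻¹ / 4 := by
    unfold aj
    rw [zpow_neg, zpow_add₀ (by norm_num), hX, ← zpow_natCast, ← zpow_mul, mul_comm j, zpow_mul]
    norm_num
    ring
  have e3 : (2:ℝ) ^ (j + 1) = 2 * X := by rw [zpow_add₀ (by norm_num)]; simp [hX, mul_comm]
  rw [e3] at h2
  set u : ℝ := ρ / X with hu
  have hu1 : 1 ≤ u := by rw [hu, le_div_iff₀ hX0]; linarith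
  have hu2 : u ≤ 2 := by rw [hu, div_le_iff₀ hX0]; linarith
  have hρ : ρ = u * X := by rw [hu]; field_simp
  have e4 : aj (j + 1) * ρ ^ 2 = u ^ 2 / 4 := by rw [e2, hρ]; field_simp
  have e5 : (2:ℝ) ^ (-j) / 2 * ρ = u / 2 := by rw [e1, hρ]; field_simp
  have hu3 : u ^ 2 / 4 ≤ 1 := by nlinarith
  have hu4 : 1 / 4 ≤ u ^ 2 / 4 := by nlinarith
  rw [e5]
  unfold LPm c0
  have g1 : 4 * Real.pi ^ 2 * aj (j + 1) * ρ ^ 2 = 4 * Real.pi ^ 2 * (u ^ 2 / 4) := by rw [← e4]; ring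
  have g2 : 4 * Real.pi ^ 2 * (6 * aj (j + 1)) * ρ ^ 2 = 24 * Real.pi ^ 2 * (u ^ 2 / 4) := by rw [← e4]; ring
  rw [g1, g2]
  have hpi : 0 < Real.pi ^ 2 := by have := Real.pi_pos; positivity
  have k1 : Real.exp (-(6 * Real.pi ^ 2)) < 1 := Real.exp_zero ▸ Real.exp_lt_exp.2 (by linarith)
  have k2 : Real.exp (-(24 * Real.pi ^ 2 * (u ^ 2 / 4))) ≤ Real.exp (-(6 * Real.pi ^ 2)) := by
    apply Real.exp_le_exp.2; nlinarith
  have k3 : Real.exp (-(4 * Real.pi ^ 2)) ≤ Real.exp (-(4 * Real.pi ^ 2 * (u ^ 2 / 4))) := by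
    apply Real.exp_le_exp.2; nlinarith
  have k4 : Real.exp (-1) ≤ Real.exp (-(u / 2)) := by apply Real.exp_le_exp.2; linarith
  have k5 : 0 ≤ 1 - Real.exp (-(6 * Real.pi ^ 2)) := by linarith
  have k6 : 0 ≤ 1 - Real.exp (-(24 * Real.pi ^ 2 * (u ^ 2 / 4))) := by linarith
  have k7 : 0 ≤ Real.exp (-(4 * Real.pi ^ 2 * (u ^ 2 / 4))) * (1 - Real.exp (-(24 * Real.pi ^ 2 * (u ^ 2 / 4)))) := mul_nonneg (Real.exp_pos _).le k6
  gcongr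

lemma tsum_int_le (f : ℤ → ℝ≥0∞) (B : ℝ≥0∞) (h : ∀ (J : ℤ) (K : ℕ), ∑ k ∈ Finset.range K, f (J + k) ≤ B) : ∑' j, f j ≤ B := by
  rw [ENNReal.tsum_eq_iSup_sum]
  refine iSup_le fun s => ?_
  set m : ℕ := s.sup Int.natAbs with hm
  have hs : s ⊆ (Finset.range (2 * m + 1)).image (fun k : ℕ => -(m:ℤ) + k) := by
    intro j hj
    have : j.natAbs ≤ m := Finset.le_sup (f := Int.natAbs) hj
    rw [Finset.mem_image]
    refine ⟨(j + m).toNat, ?_, ?_⟩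
    · rw [Finset.mem_range]; omega
    · omega
  calc _ ≤ ∑ j ∈ (Finset.range (2 * m + 1)).image (fun k : ℕ => -(m:ℤ) + k), f j := Finset.sum_le_sum_of_subset hs
    _ = ∑ k ∈ Finset.range (2 * m + 1), f (-(m:ℤ) + k) := by
      rw [Finset.sum_image]; intro a _ b _ hab; simp only at hab; omega
    _ ≤ B := h _ _

lemma core_bound (q q' d p γ : ℝ) (hq : 2 ≤ q) (hqq : 1 / q + 1 / q' = 1) (hp : 1 < p) (hp2 : p < 2)
    (hd : 1 / q = d * (1 / p - 1 / 2)) (hdV : d ≤ ((Module.finrank ℝ V : ℝ) - 1) / 2)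
    (hγ : γ = 1 / q - Module.finrank ℝ V * (1 / p - 1 / 2)) (hγ0 : γ < 0) :
    ∃ C : ℝ≥0∞, C ≠ ⊤ ∧ ∀ (F : ℝ → V → ℂ) (_ : Adm F),
      ∫⁻ ξ, ENNReal.ofReal (‖ξ‖ ^ (2 * γ)) * ‖∫ s, WV 0 F s ξ‖ₑ ^ 2 ≤
        C * (lq q' Set.univ (fun s => Nn p (F s) ^ (1 / p)) * lq q' Set.univ (fun s => Nn p (F s) ^ (1 / p))) := by
  obtain ⟨C, hC, h1⟩ := single (V := V) q q' d p hq hqq hp hp2 hd hdV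
  obtain ⟨C', hC', h2⟩ := LP_square (V := V) p hp hp2.le
  have hp0 : 0 < p := by linarith
  have hq'1 : 1 / q' = 1 - 1 / q := by linarith
  have hq1 : 1 / q ≤ 1 / 2 := one_div_le_one_div_of_le (by norm_num) hq
  have hq'0 : 0 < q' := by
    have : 0 < 1 / q' := by linarith
    exact one_div_pos.1 this
  have hq'2 : q' ≤ 2 := by
    have : 1 / 2 ≤ 1 / q' := by linarith
    exact (one_div_le_one_div (by norm_num) hq'0).1 this
  refine ⟨ENNReal.ofReal ((c0 ^ 2)⁻¹) * (C * C'), ENNReal.mul_ne_top ENNReal.ofReal_ne_top (ENNReal.mul_ne_top hC hC'), fun F hF => ?_⟩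
  set v : V → ℂ := fun ξ => ∫ s, WV 0 F s ξ with hv
  have hvm : Measurable v := by
    have := (WV_dom 0 hF).meas
    exact (this.comp measurable_swap).stronglyMeasurable.integral_prod_right'.measurable
  set b : ℤ → V → ℝ := fun j ξ => LPm j ‖ξ‖ * Real.exp (-((2:ℝ) ^ (-j) / 2 * ‖ξ‖)) with hb
  have hbm : ∀ j, Measurable (b j) := by intro j; simp only [hb, LPm]; fun_prop
  set T : ℤ → V → ℝ≥0∞ := fun j ξ => ENNReal.ofReal ((2:ℝ) ^ (2 * γ * j)) * ‖((b j ξ : ℝ) : ℂ) * v ξ‖ₑ ^ 2 with hT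
  have hTm : ∀ j, Measurable (T j) := by intro j; have := hbm j; simp only [hT]; fun_prop
  have hTj : ∀ j, ∫⁻ ξ, T j ξ ≤ C * (lq q' Set.univ (fun s => Nn p (LP j (F s)) ^ (1 / p)) * lq q' Set.univ (fun s => Nn p (LP j (F s)) ^ (1 / p))) := by
    intro j
    have := h1 ((2:ℝ) ^ (-j)) (by positivity) _ (LP_adm j hF)
    simp_rw [WV_LP j _ hF] at this
    simp only [hT]
    rw [lintegral_const_mul' _ _ ENNReal.ofReal_ne_top]
    refine (mul_le_mul' le_rfl this).trans (le_of_eq ?_)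
    rw [← mul_assoc, mul_left_comm (ENNReal.ofReal _) C, ← ENNReal.ofReal_mul (by positivity)]
    have : (2:ℝ) ^ (2 * γ * j) * ((2:ℝ) ^ (-j)) ^ ((d - Module.finrank ℝ V) * (2 * (1 / p - 1 / 2))) = 1 := by
      have e : (d - Module.finrank ℝ V) * (2 * (1 / p - 1 / 2)) = 2 * γ := by rw [hγ, hd]; ring
      rw [e, ← Real.rpow_intCast, ← Real.rpow_mul (by norm_num), ← Real.rpow_add (by norm_num)]
      have : 2 * γ * (j:ℝ) + ((-j : ℤ) : ℝ) * (2 * γ) = 0 := by push_cast; ring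
      rw [this, Real.rpow_zero]
    rw [this, ENNReal.ofReal_one, mul_one]
  have hsum : ∑' j, ∫⁻ ξ, T j ξ ≤ C * C' * (lq q' Set.univ (fun s => Nn p (F s) ^ (1 / p)) * lq q' Set.univ (fun s => Nn p (F s) ^ (1 / p))) := by
    refine tsum_int_le _ _ fun J K => ?_
    have hm := l2mink q' hq'0 hq'2 (Finset.range K) (fun k s => Nn p (LP (J + k) (F s)) ^ (1 / p)) (fun s => Nn p (F s) ^ (1 / p)) C'
      (fun k => (Nn_meas p (LP_adm (J + k) hF).meas).pow_const _) ((Nn_meas p hF.meas).pow_const _)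
      (fun s => ENNReal.rpow_ne_top_of_nonneg (by positivity) (LP_Lp_fin p hp (hF.nice s)).ne)
      (fun s => by
        have e : ∀ z : ℝ≥0∞, z ^ (1 / p) * z ^ (1 / p) = z ^ (2 / p) := fun z => by
          rw [← ENNReal.rpow_add_of_nonneg _ _ (by positivity) (by positivity)]; ring_nf
        simp_rw [e]
        exact h2 (hF.nice s) J K)
    calc _ ≤ ∑ k ∈ Finset.range K, C * (lq q' Set.univ (fun s => Nn p (LP (J + k) (F s)) ^ (1 / p)) * lq q' Set.univ (fun s => Nn p (LP (J + k) (F s)) ^ (1 / p))) :=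
          Finset.sum_le_sum fun k _ => hTj _
      _ ≤ _ := by
          rw [← Finset.mul_sum, mul_assoc]
          gcongr
  have hpt : ∀ ξ, ENNReal.ofReal (‖ξ‖ ^ (2 * γ)) * ‖v ξ‖ₑ ^ 2 ≤ ENNReal.ofReal ((c0 ^ 2)⁻¹) * ∑' j, T j ξ := by
    intro ξ
    by_cases hξ : ξ = 0
    · simp [hξ, Real.zero_rpow (by linarith : 2 * γ ≠ 0)]
    have hξ0 : 0 < ‖ξ‖ := norm_pos_iff.2 hξ
    obtain ⟨j, hj1, hj2⟩ := exists_mem_Ico_zpow (y := (2:ℝ)) hξ0 (by norm_num)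
    refine le_trans ?_ (mul_le_mul' le_rfl (ENNReal.le_tsum j))
    have hl := LPm_lower j ‖ξ‖ hj1 hj2
    simp only [hT]
    rw [enorm_mul, mul_pow, ← mul_assoc, ← mul_assoc]
    gcongr
    rw [← ofReal_norm, ← ENNReal.ofReal_pow (norm_nonneg _), ← ENNReal.ofReal_mul (by have := c0_pos; positivity), ← ENNReal.ofReal_mul (by have := c0_pos; positivity)]
    apply ENNReal.ofReal_le_ofReal
    have hc := c0_pos
    have k1 : ‖ξ‖ ^ (2 * γ) ≤ (2:ℝ) ^ (2 * γ * j) := by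
      rw [mul_comm (2 * γ) (j:ℝ), Real.rpow_mul (by norm_num) (j:ℝ), Real.rpow_intCast]
      exact Real.rpow_le_rpow_of_nonpos (by positivity) hj1 (by linarith)
    have k2 : c0 ^ 2 ≤ ‖((b j ξ : ℝ) : ℂ)‖ ^ 2 := by
      gcongr
      rw [Complex.norm_real]
      exact hl.trans (le_abs_self _)
    calc ‖ξ‖ ^ (2 * γ) ≤ (2:ℝ) ^ (2 * γ * j) := k1
      _ = (c0 ^ 2)⁻¹ * (2:ℝ) ^ (2 * γ * j) * c0 ^ 2 := by field_simp
      _ ≤ _ := by gcongr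
  calc _ ≤ ∫⁻ ξ, ENNReal.ofReal ((c0 ^ 2)⁻¹) * ∑' j, T j ξ := lintegral_mono hpt
    _ = ENNReal.ofReal ((c0 ^ 2)⁻¹) * ∑' j, ∫⁻ ξ, T j ξ := by
      rw [lintegral_const_mul' _ _ ENNReal.ofReal_ne_top, lintegral_tsum (fun j => (hTm j).aemeasurable)]
    _ ≤ _ := by
      rw [mul_assoc]
      gcongr

end core
end DS

namespace DS

section localb
variable {V : Type*} [NormedAddCommGroup V] [InnerProductSpace ℝ V] [FiniteDimensional ℝ V]
  [MeasurableSpace V] [BorelSpace V]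

/-- multiplier with symbol exp(-w|ξ|) -/
def Tm (w : ℂ) (f : V → ℂ) (y : V) : ℂ := 𝓕⁻ (fun ξ : V => cexp (-(w * ‖ξ‖)) * 𝓕 f ξ) y

lemma re_aux (r s : ℝ) : ((r : ℂ) + s * I).re = r := by simp
lemma im_aux (r s : ℝ) : ((r : ℂ) + s * I).im = s := by simp

lemma norm_cexp_le (w : ℂ) (hw : 0 ≤ w.re) (ξ : V) : ‖cexp (-(w * ‖ξ‖))‖ ≤ 1 := by
  rw [Complex.norm_exp]
  have : (-(w * ‖ξ‖)).re = -(w.re * ‖ξ‖) := by simp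
  rw [this]
  exact Real.exp_le_one_iff.2 (neg_nonpos.2 (by positivity))

lemma Tm_int (w : ℂ) (hw : 0 < w.re) (f : V → ℂ) (hf : Integrable f) :
    Integrable (fun ξ : V => cexp (-(w * ‖ξ‖)) * 𝓕 f ξ) :=
  (integrable_cexp (V := V) w hw).mul_bdd (c := ∫ x, ‖f x‖) (continuous_fourier' f hf).aestronglyMeasurable (ae_of_all _ fun ξ => norm_fourier_le f ξ)

lemma Tm_conv (w : ℂ) (hw : 0 < w.re) (f : V → ℂ) (hf : Integrable f) (y : V) :
    Tm w f y = ∫ x, f x * PK w (y - x) := by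
  have hk := integrable_cexp (V := V) w hw
  have hkg : Integrable (fun ξ : V => cexp (↑(2 * Real.pi * inner ℝ ξ y) * I) * cexp (-(w * ‖ξ‖))) := by
    refine hk.bdd_mul (c := 1) (Measurable.aestronglyMeasurable (by fun_prop)) (ae_of_all _ fun z => ?_)
    rw [Complex.norm_exp_ofReal_mul_I]
  have h3 := fourier_mul_flip _ _ hf hkg
  have e4 : ∀ x, 𝓕 (fun ξ : V => cexp (↑(2 * Real.pi * inner ℝ ξ y) * I) * cexp (-(w * ‖ξ‖))) x = PK w (y - x) := by
    intro x
    rw [PK, Real.fourierInv_eq', Real.fourier_eq']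
    congr 1; ext ξ
    rw [smul_eq_mul, smul_eq_mul, ← mul_assoc, ← Complex.exp_add, inner_sub_right]
    congr 2
    push_cast; ring
  simp_rw [e4] at h3
  rw [← h3, Tm, Real.fourierInv_eq']
  congr 1; ext ξ
  rw [smul_eq_mul]; ring

lemma Tm_l2 (w : ℂ) (hw : 0 < w.re) (f : V → ℂ) (hf : Integrable f) :
    ∫⁻ y, ‖Tm w f y‖ₑ ^ 2 ≤ ∫⁻ x, ‖f x‖ₑ ^ 2 := by
  have h := plancherel_inv_le _ (Tm_int w hw f hf)
  rw [eLpNorm_eq_lintegral_rpow_enorm_toReal (by norm_num) (by norm_num), eLpNorm_eq_lintegral_rpow_enorm_toReal (by norm_num) (by norm_num)] at h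
  have h2 := ENNReal.rpow_le_rpow h (z := 2) (by norm_num)
  rw [← ENNReal.rpow_mul, ← ENNReal.rpow_mul] at h2
  norm_num at h2
  refine h2.trans (le_trans ?_ (plancherel_lin f hf))
  gcongr with ξ
  calc _ ≤ 1 * ‖𝓕 f ξ‖ₑ := by
        gcongr
        rw [← ofReal_norm, ENNReal.ofReal_le_one]
        exact norm_cexp_le w hw.le ξ
    _ = _ := one_mul _

lemma Tm_cont (w : ℂ) (hw : 0 < w.re) (f : V → ℂ) (hf : Integrable f) : Continuous (Tm w f) :=
  continuous_fourierInv' _ (Tm_int w hw f hf)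

lemma Tm_near (w : ℂ) (hw : 0 < w.re) (f : V → ℂ) (hf : Integrable f) (B : Set V) :
    ∫⁻ y in B, ‖Tm w f y‖ₑ ≤ (volume B) ^ ((1:ℝ)/2) * (∫⁻ x, ‖f x‖ₑ ^ 2) ^ ((1:ℝ)/2) := by
  have hm := (Tm_cont w hw f hf).measurable.enorm
  have h := ENNReal.lintegral_mul_le_Lp_mul_Lq (volume.restrict B) (p := 2) (q := 2) ⟨by norm_num, by norm_num, by norm_num⟩
    (f := fun _ => 1) (g := fun y => ‖Tm w f y‖ₑ) aemeasurable_const hm.aemeasurable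
  simp only [Pi.mul_apply, one_mul, ENNReal.one_rpow, lintegral_one, Measure.restrict_apply_univ] at h
  have e : ((fun _ : V => (1:ℝ≥0∞)) * fun y => ‖Tm w f y‖ₑ) = fun y => ‖Tm w f y‖ₑ := by ext y; simp
  refine h.trans ?_
  refine mul_le_mul' le_rfl (ENNReal.rpow_le_rpow ((setLIntegral_le_lintegral _ _).trans ?_) (by norm_num))
  simpa using Tm_l2 w hw f hf

def farK (V : Type*) [NormedAddCommGroup V] [InnerProductSpace ℝ V] (z : V) : ℝ≥0∞ :=
  ENNReal.ofReal ((1 + ‖z‖) ^ (-((Module.finrank ℝ V : ℝ) + 1)))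

def farA (V : Type*) [NormedAddCommGroup V] [InnerProductSpace ℝ V] [FiniteDimensional ℝ V]
  [MeasurableSpace V] [BorelSpace V] (p : ℝ) : ℝ≥0∞ := (∫⁻ z : V, farK V z ^ p) ^ (1 / p)

lemma farK_le (z : V) : farK V z ≤ 1 := by
  unfold farK
  rw [ENNReal.ofReal_le_one]
  exact Real.rpow_le_one_of_one_le_of_nonpos (by linarith [norm_nonneg z]) (by linarith [(Nat.cast_nonneg (Module.finrank ℝ V) : (0:ℝ) ≤ _)])

lemma farK_meas : Measurable (farK V) := by unfold farK; fun_prop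

lemma farA_fin (p : ℝ) (hp : 1 ≤ p) : farA V p ≠ ⊤ := by
  unfold farA
  refine ENNReal.rpow_ne_top_of_nonneg (by positivity) (ne_of_lt (lt_of_le_of_lt ?_
    (finite_integral_one_add_norm (E := V) (μ := volume) (r := (Module.finrank ℝ V : ℝ) + 1) (by linarith))))
  gcongr with z
  calc farK V z ^ p ≤ farK V z ^ (1:ℝ) := ENNReal.rpow_le_rpow_of_exponent_ge (farK_le z) hp
    _ = _ := ENNReal.rpow_one _

lemma Tm_far (p : ℝ) (hp : 1 < p) (w : ℂ) (hw : 0 < w.re) (hw1 : w.re ≤ 1) (S ρ : ℝ) (hS : |w.im| ≤ S) (f : V → ℂ) (hf : Nice f)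
    (hs : ∀ x, ‖x‖ ≤ ρ + S + 1 → f x = 0) (y : V) (hy : ‖y‖ ≤ ρ) :
    ‖Tm w f y‖ₑ ≤ ENNReal.ofReal (cP (Module.finrank ℝ V) * (1 + S) * 2 ^ (Module.finrank ℝ V + 1)) * (farA V (Real.conjExponent p) * Nn p f ^ (1 / p)) := by
  set N := Module.finrank ℝ V
  have hS0 : 0 ≤ S := (abs_nonneg _).trans hS
  have hcP : 0 < cP N := cP_pos N
  rw [Tm_conv w hw f hf.int]
  refine (enorm_integral_le_lintegral_enorm _).trans ?_
  have hpt : ∀ x, ‖f x * PK w (y - x)‖ₑ ≤ ENNReal.ofReal (cP N * (1 + S) * 2 ^ (N + 1)) * (farK V (y - x) * ‖f x‖ₑ) := by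
    intro x
    by_cases hx : ‖x‖ ≤ ρ + S + 1
    · simp [hs x hx]
    push Not at hx
    have hxy : S + 1 ≤ ‖y - x‖ := by
      have := norm_sub_norm_le x y
      rw [norm_sub_rev] at this
      linarith
    rw [enorm_mul, mul_comm ‖f x‖ₑ, ← mul_assoc]
    gcongr
    unfold farK
    rw [← ofReal_norm, ← ENNReal.ofReal_mul (by positivity)]
    apply ENNReal.ofReal_le_ofReal
    refine (PK_far w hw hw1 S hS (y - x) hxy).trans ?_
    rw [mul_assoc _ (2 ^ (N + 1))]
    gcongr
    set t := ‖y - x‖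
    have e : (1 + t) ^ (-((N:ℝ) + 1)) = (1 / (1 + t)) ^ (N + 1) := by
      rw [Real.rpow_neg (by linarith)]
      have : (N:ℝ) + 1 = ((N + 1 : ℕ) : ℝ) := by push_cast; ring
      rw [this, Real.rpow_natCast, one_div, inv_pow]
    change (1 / t) ^ (N + 1) ≤ 2 ^ (N + 1) * (1 + t) ^ (-((N:ℝ) + 1))
    rw [e, ← mul_pow]
    gcongr
    rw [mul_one_div, div_le_div_iff₀ (by linarith) (by linarith)]
    linarith
  refine (lintegral_mono hpt).trans ?_
  rw [lintegral_const_mul' _ _ ENNReal.ofReal_ne_top]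
  gcongr
  have hc : p.HolderConjugate (Real.conjExponent p) := Real.HolderConjugate.conjExponent hp
  have hm : Measurable (fun x => farK V (y - x)) := farK_meas.comp (by fun_prop)
  have h := ENNReal.lintegral_mul_le_Lp_mul_Lq volume hc.symm hm.aemeasurable hf.meas.enorm.aemeasurable
  refine h.trans (le_of_eq ?_)
  unfold farA Nn
  congr 2
  exact lintegral_sub_left_eq_self (fun x => farK V x ^ (Real.conjExponent p)) y

lemma Tm_lim (s : ℝ) (f : V → ℂ) (hF : Integrable (𝓕 f)) (y : V) :
    Filter.Tendsto (fun k : ℕ => Tm (((1 / ((k:ℝ) + 1) : ℝ) : ℂ) + s * I) f y) Filter.atTop (nhds (Tm (s * I) f y)) := by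
  unfold Tm
  simp_rw [Real.fourierInv_eq']
  refine tendsto_integral_of_dominated_convergence (fun ξ => ‖𝓕 f ξ‖) ?_ hF.norm ?_ ?_
  · intro k
    have h1 : Continuous (fun ξ : V => cexp (↑(2 * Real.pi * inner ℝ ξ y) * I)) := by fun_prop
    have h2 : Continuous (fun ξ : V => cexp (-((((1 / ((k:ℝ) + 1) : ℝ) : ℂ) + s * I) * ‖ξ‖))) := by fun_prop
    exact h1.aestronglyMeasurable.smul (h2.aestronglyMeasurable.mul hF.1)
  · intro k
    refine ae_of_all _ fun ξ => ?_
    rw [norm_smul, Complex.norm_exp_ofReal_mul_I, one_mul, norm_mul]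
    calc _ ≤ 1 * ‖𝓕 f ξ‖ := by
          gcongr
          refine norm_cexp_le _ ?_ ξ
          rw [re_aux]; positivity
      _ = _ := one_mul _
  · refine ae_of_all _ fun ξ => ?_
    have h1 : Filter.Tendsto (fun k : ℕ => (((1 / ((k:ℝ) + 1) : ℝ) : ℂ) + s * I)) Filter.atTop (nhds (((0:ℝ):ℂ) + s * I)) :=
      ((Complex.continuous_ofReal.tendsto 0).comp tendsto_one_div_add_atTop_nhds_zero_nat).add_const _
    have h2 : Continuous (fun w : ℂ => cexp (↑(2 * Real.pi * inner ℝ ξ y) * I) • (cexp (-(w * ‖ξ‖)) * 𝓕 f ξ)) := by fun_prop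
    have := (h2.tendsto _).comp h1
    simpa [Function.comp_def] using this

lemma local_bound (p ρ S : ℝ) (hp : 1 < p) (hS : 0 ≤ S) : ∃ C : ℝ≥0∞, C ≠ ⊤ ∧ ∀ f : V → ℂ, Nice f → Integrable (𝓕 f) →
    ∀ s : ℝ, |s| ≤ S → ∫⁻ y in closedBall (0:V) ρ, ‖Tm (s * I) f y‖ₑ ≤
      C * ((∫⁻ x in closedBall (0:V) (ρ + S + 1), ‖f x‖ₑ ^ 2) ^ ((1:ℝ)/2) + Nn p f ^ (1 / p)) := by
  set N := Module.finrank ℝ V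
  set B := closedBall (0:V) ρ
  have hB : volume B ≠ ⊤ := measure_closedBall_lt_top.ne
  set c2 : ℝ≥0∞ := ENNReal.ofReal (cP N * (1 + S) * 2 ^ (N + 1)) * farA V (Real.conjExponent p) * volume B
  have hc2 : c2 ≠ ⊤ := by
    have : 1 ≤ Real.conjExponent p := (Real.HolderConjugate.conjExponent hp).symm.lt.le
    exact ENNReal.mul_ne_top (ENNReal.mul_ne_top ENNReal.ofReal_ne_top (farA_fin _ this)) hB
  refine ⟨volume B ^ ((1:ℝ)/2) + c2, ENNReal.add_ne_top.2 ⟨ENNReal.rpow_ne_top_of_nonneg (by norm_num) hB, hc2⟩, ?_⟩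
  intro f hf hFf s hs
  set D := closedBall (0:V) (ρ + S + 1)
  have hD : MeasurableSet D := measurableSet_closedBall
  set f1 := D.indicator f
  set f2 := Dᶜ.indicator f
  have hf1 : Integrable f1 := hf.int.indicator hD
  have hf2 : Nice f2 := by
    refine ⟨hf.meas.indicator hD.compl, ?_, hf.int.indicator hD.compl⟩
    obtain ⟨M, hM⟩ := hf.bdd
    exact ⟨M, fun x => (norm_indicator_le_norm_self _ _).trans (hM x)⟩
  have hsum : f = fun x => f1 x + f2 x := by
    ext x; exact (congrFun (Set.indicator_self_add_compl D f) x).symm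
  have hk : ∀ k : ℕ, ∫⁻ y in B, ‖Tm (((1 / ((k:ℝ) + 1) : ℝ) : ℂ) + s * I) f y‖ₑ ≤ (volume B ^ ((1:ℝ)/2) + c2) * ((∫⁻ x in D, ‖f x‖ₑ ^ 2) ^ ((1:ℝ)/2) + Nn p f ^ (1 / p)) := by
    intro k
    set w : ℂ := ((1 / ((k:ℝ) + 1) : ℝ) : ℂ) + s * I with hwd
    have hwre : w.re = 1 / ((k:ℝ) + 1) := by rw [hwd, re_aux]
    have hwim : w.im = s := by rw [hwd, im_aux]
    have hw : 0 < w.re := by rw [hwre]; positivity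
    have hw1 : w.re ≤ 1 := by
      rw [hwre, div_le_one (by positivity)]; linarith [(Nat.cast_nonneg k : (0:ℝ) ≤ k)]
    have hlin : ∀ y, Tm w f y = Tm w f1 y + Tm w f2 y := by
      intro y
      rw [Tm_conv w hw f hf.int, Tm_conv w hw f1 hf1, Tm_conv w hw f2 hf2.int, ← integral_add]
      · congr 1; ext x; rw [← add_mul, congrFun hsum x]
      · exact hf1.mul_bdd (c := ∫ ξ : V, ‖cexp (-(w * ‖ξ‖))‖) ((continuous_fourierInv' _ (integrable_cexp (V := V) w hw)).comp (continuous_const.sub continuous_id)).aestronglyMeasurable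
          (ae_of_all _ fun x => by unfold PK; rw [Real.fourierInv_eq_fourier_neg]; exact norm_fourier_le _ _)
      · exact hf2.int.mul_bdd (c := ∫ ξ : V, ‖cexp (-(w * ‖ξ‖))‖) ((continuous_fourierInv' _ (integrable_cexp (V := V) w hw)).comp (continuous_const.sub continuous_id)).aestronglyMeasurable
          (ae_of_all _ fun x => by unfold PK; rw [Real.fourierInv_eq_fourier_neg]; exact norm_fourier_le _ _)
    have b1 := Tm_near w hw f1 hf1 B
    have e1 : ∫⁻ x, ‖f1 x‖ₑ ^ 2 = ∫⁻ x in D, ‖f x‖ₑ ^ 2 := by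
      rw [← lintegral_indicator hD]
      refine lintegral_congr fun x => ?_
      by_cases hx : x ∈ D <;> simp [f1, hx]
    rw [e1] at b1
    have b2 : ∫⁻ y in B, ‖Tm w f2 y‖ₑ ≤ c2 * Nn p f ^ (1 / p) := by
      calc _ ≤ ∫⁻ y in B, ENNReal.ofReal (cP N * (1 + S) * 2 ^ (N + 1)) * (farA V (Real.conjExponent p) * Nn p f2 ^ (1 / p)) := by
            refine setLIntegral_mono measurable_const fun y hy => ?_
            refine Tm_far p hp w hw hw1 S ρ (by rw [hwim]; exact hs) f2 hf2 (fun x hx => ?_) y (by simpa [B] using hy)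
            have : x ∈ D := by simpa [D] using hx
            simp [f2, this]
        _ = c2 * Nn p f2 ^ (1 / p) := by
            rw [setLIntegral_const]; simp only [c2]; ring
        _ ≤ _ := by
            gcongr
            unfold Nn
            gcongr with x
            exact enorm_le_iff_norm_le.2 (norm_indicator_le_norm_self _ _)
    calc _ ≤ ∫⁻ y in B, (‖Tm w f1 y‖ₑ + ‖Tm w f2 y‖ₑ) := by
          refine lintegral_mono fun y => ?_
          rw [hlin]; exact enorm_add_le _ _
      _ = (∫⁻ y in B, ‖Tm w f1 y‖ₑ) + ∫⁻ y in B, ‖Tm w f2 y‖ₑ := lintegral_add_left (Tm_cont w hw f1 hf1).measurable.enorm _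
      _ ≤ volume B ^ ((1:ℝ)/2) * (∫⁻ x in D, ‖f x‖ₑ ^ 2) ^ ((1:ℝ)/2) + c2 * Nn p f ^ (1 / p) := add_le_add b1 b2
      _ ≤ _ := by
          rw [mul_add]
          gcongr <;> simp
  calc _ = ∫⁻ y in B, Filter.liminf (fun k : ℕ => ‖Tm (((1 / ((k:ℝ) + 1) : ℝ) : ℂ) + s * I) f y‖ₑ) Filter.atTop := by
        refine lintegral_congr fun y => ?_
        exact (((continuous_enorm.tendsto _).comp (Tm_lim s f hFf y)).liminf_eq).symm
    _ ≤ Filter.liminf (fun k : ℕ => ∫⁻ y in B, ‖Tm (((1 / ((k:ℝ) + 1) : ℝ) : ℂ) + s * I) f y‖ₑ) Filter.atTop := by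
        refine lintegral_liminf_le fun k => ?_
        refine (Tm_cont _ ?_ f hf.int).measurable.enorm
        rw [re_aux]; positivity
    _ ≤ _ := by
        refine Filter.liminf_le_of_le (by isBoundedDefault) fun b hb => ?_
        obtain ⟨k, hk'⟩ := hb.exists
        exact hk'.trans (hk k)

end localb
end DS

namespace DS

section weight
variable {V : Type*} [NormedAddCommGroup V] [InnerProductSpace ℝ V] [FiniteDimensional ℝ V]
  [MeasurableSpace V] [BorelSpace V]

lemma lint_scale (R : ℝ) (hR : 0 < R) (f : V → ℝ≥0∞) (hf : Measurable f) :
    ENNReal.ofReal (R ^ (Module.finrank ℝ V)) * ∫⁻ x, f (R • x) = ∫⁻ x, f x := by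
  have h := Measure.map_addHaar_smul (volume : Measure V) hR.ne'
  have h2 : ∫⁻ x, f (R • x) = ∫⁻ x, f x ∂(Measure.map (fun x => R • x) volume) :=
    (lintegral_map hf (by fun_prop)).symm
  have e : ((R • ·) : V → V) = fun x => R • x := rfl
  rw [h2, ← e, h, lintegral_smul_measure, smul_eq_mul, ← mul_assoc, ← ENNReal.ofReal_mul (by positivity)]
  rw [abs_of_pos (by positivity), mul_inv_cancel₀ (by positivity)]
  simp

lemma ball_weight (b : ℝ) (hn : 1 ≤ Module.finrank ℝ V) (hb : -(Module.finrank ℝ V : ℝ) < b) : ∃ C : ℝ≥0∞, C ≠ ⊤ ∧ ∀ ρ : ℝ, 0 < ρ →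
    ∫⁻ ξ in ball (0:V) ρ, ENNReal.ofReal (‖ξ‖ ^ b) ≤ C * ENNReal.ofReal (ρ ^ ((Module.finrank ℝ V : ℝ) + b)) := by
  have hli : LocallyIntegrable (fun ξ : V => ‖ξ‖ ^ b) := by
    refine locallyIntegrable_of_norm_le_rpow hn (C := 1) (α := -b) (by linarith) (ae_of_all _ fun x => ?_) (Measurable.aestronglyMeasurable (by fun_prop))
    rw [neg_neg, one_mul, Real.norm_of_nonneg (by positivity)]
  have hi : IntegrableOn (fun ξ : V => ‖ξ‖ ^ b) (closedBall 0 1) := hli.integrableOn_isCompact (isCompact_closedBall _ _)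
  have hi2 : IntegrableOn (fun ξ : V => ‖ξ‖ ^ b) (ball 0 1) := hi.mono_set ball_subset_closedBall
  refine ⟨∫⁻ ξ in ball (0:V) 1, ENNReal.ofReal (‖ξ‖ ^ b), ?_, ?_⟩
  · have := hi2.2
    rw [hasFiniteIntegral_iff_enorm] at this
    refine (lt_of_le_of_lt (lintegral_mono fun x => ?_) this).ne
    exact Real.ofReal_le_enorm _
  intro ρ hρ
  rw [← lintegral_indicator measurableSet_ball, ← lintegral_indicator measurableSet_ball]
  rw [← lint_scale ρ hρ _ (Measurable.indicator (by fun_prop) measurableSet_ball), mul_comm, Real.rpow_add hρ, ENNReal.ofReal_mul (by positivity), Real.rpow_natCast]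
  rw [mul_comm (ENNReal.ofReal (ρ ^ Module.finrank ℝ V)), ← mul_assoc]
  refine mul_le_mul' ?_ le_rfl
  rw [← lintegral_mul_const' _ _ ENNReal.ofReal_ne_top]
  gcongr with x
  by_cases hx : x ∈ ball (0:V) 1
  · have hx2 : ρ • x ∈ ball (0:V) ρ := by
      simp only [mem_ball_zero_iff, norm_smul, Real.norm_of_nonneg hρ.le] at hx ⊢
      nlinarith
    rw [Set.indicator_of_mem hx, Set.indicator_of_mem hx2, ← ENNReal.ofReal_mul (by positivity)]
    rw [norm_smul, Real.norm_of_nonneg hρ.le, Real.mul_rpow hρ.le (norm_nonneg _), mul_comm]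
  · have hx2 : ρ • x ∉ ball (0:V) ρ := by
      simp only [mem_ball_zero_iff, norm_smul, Real.norm_of_nonneg hρ.le] at hx ⊢
      push Not at hx ⊢
      nlinarith
    rw [Set.indicator_of_notMem hx2]; exact zero_le

/-- rescaled majorant kernel -/
def KR (V : Type*) [NormedAddCommGroup V] [InnerProductSpace ℝ V] (R : ℝ) (z : V) : ℝ≥0∞ :=
  ENNReal.ofReal (R ^ (Module.finrank ℝ V)) * farK V (R • z)

lemma KR_meas (R : ℝ) : Measurable (KR V R) := by
  unfold KR
  exact (farK_meas.comp (by fun_prop)).const_mul _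

lemma KR_mass (R : ℝ) (hR : 0 < R) : ∫⁻ z, KR V R z = ∫⁻ z, farK V z := by
  unfold KR
  rw [lintegral_const_mul' _ _ ENNReal.ofReal_ne_top, lint_scale R hR _ farK_meas]

lemma farK_mass : ∫⁻ z, farK V z ≠ ⊤ :=
  (finite_integral_one_add_norm (E := V) (μ := volume) (r := (Module.finrank ℝ V : ℝ) + 1) (by linarith)).ne

lemma KR_le (R : ℝ) (hR : 0 < R) (z : V) (hz : z ≠ 0) : KR V R z ≤ ENNReal.ofReal (‖z‖ ^ (-(Module.finrank ℝ V : ℝ))) := by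
  unfold KR farK
  rw [← ENNReal.ofReal_mul (by positivity)]
  apply ENNReal.ofReal_le_ofReal
  have hz0 : 0 < ‖z‖ := norm_pos_iff.2 hz
  rw [norm_smul, Real.norm_of_nonneg hR.le]
  set N := Module.finrank ℝ V
  have h1 : (1 + R * ‖z‖) ^ (-((N:ℝ) + 1)) ≤ (R * ‖z‖) ^ (-(N:ℝ)) := by
    calc _ ≤ (1 + R * ‖z‖) ^ (-(N:ℝ)) := Real.rpow_le_rpow_of_exponent_le (by nlinarith [mul_pos hR hz0]) (by linarith)
      _ ≤ _ := Real.rpow_le_rpow_of_nonpos (by positivity) (by linarith) (by simp)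
  calc _ ≤ R ^ N * (R * ‖z‖) ^ (-(N:ℝ)) := by gcongr
    _ = _ := by
        rw [Real.mul_rpow hR.le hz0.le, ← mul_assoc, Real.rpow_neg hR.le, Real.rpow_natCast, mul_inv_cancel₀ (by positivity), one_mul]

lemma weight_ineq (b : ℝ) (hn : 1 ≤ Module.finrank ℝ V) (hb : -(Module.finrank ℝ V : ℝ) < b) (hb0 : b < 0) : ∃ C : ℝ≥0∞, C ≠ ⊤ ∧ ∀ R : ℝ, 0 < R →
    ∀ η : V, η ≠ 0 → ∫⁻ ξ, ENNReal.ofReal (‖ξ‖ ^ b) * KR V R (η - ξ) ≤ C * ENNReal.ofReal (‖η‖ ^ b) := by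
  obtain ⟨c, hc, hball⟩ := ball_weight (V := V) b hn hb
  set N := Module.finrank ℝ V
  refine ⟨ENNReal.ofReal (2 ^ (-b)) * (∫⁻ z, farK V z) + c * ENNReal.ofReal (2 ^ (-b)), ENNReal.add_ne_top.2 ⟨ENNReal.mul_ne_top ENNReal.ofReal_ne_top farK_mass, ENNReal.mul_ne_top hc ENNReal.ofReal_ne_top⟩, ?_⟩
  intro R hR η hη
  have hη0 : 0 < ‖η‖ := norm_pos_iff.2 hη
  have e2 : (‖η‖ / 2) ^ b = 2 ^ (-b) * ‖η‖ ^ b := by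
    rw [Real.div_rpow hη0.le (by norm_num), Real.rpow_neg (by norm_num)]; field_simp
  rw [← lintegral_add_compl _ (measurableSet_ball (x := (0:V)) (ε := ‖η‖ / 2)), add_comm, add_mul]
  refine add_le_add ?_ ?_
  · calc _ ≤ ∫⁻ ξ in (ball (0:V) (‖η‖ / 2))ᶜ, ENNReal.ofReal ((‖η‖ / 2) ^ b) * KR V R (η - ξ) := by
          refine setLIntegral_mono ((KR_meas R).comp (by fun_prop) |>.const_mul _) fun ξ hξ => ?_
          simp only [Set.mem_compl_iff, mem_ball_zero_iff, not_lt] at hξ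
          gcongr ENNReal.ofReal ?_ * _
          exact Real.rpow_le_rpow_of_nonpos (by positivity) hξ hb0.le
      _ ≤ ∫⁻ ξ, ENNReal.ofReal ((‖η‖ / 2) ^ b) * KR V R (η - ξ) := setLIntegral_le_lintegral _ _
      _ = ENNReal.ofReal ((‖η‖ / 2) ^ b) * ∫⁻ ξ, KR V R (η - ξ) := lintegral_const_mul' _ _ ENNReal.ofReal_ne_top
      _ = ENNReal.ofReal ((‖η‖ / 2) ^ b) * ∫⁻ z, farK V z := by
          rw [lintegral_sub_left_eq_self (fun x => KR V R x) η, KR_mass R hR]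
      _ = _ := by rw [e2, ENNReal.ofReal_mul (by positivity)]; ring
      _ ≤ _ := le_rfl
  · calc _ ≤ ∫⁻ ξ in (ball (0:V) (‖η‖ / 2)), ENNReal.ofReal (‖ξ‖ ^ b) * ENNReal.ofReal ((‖η‖ / 2) ^ (-(N:ℝ))) := by
          refine setLIntegral_mono (by fun_prop) fun ξ hξ => ?_
          simp only [mem_ball_zero_iff] at hξ
          have h3 : ‖η‖ / 2 ≤ ‖η - ξ‖ := by have := norm_sub_norm_le η ξ; linarith
          have h4 : η - ξ ≠ 0 := by
            rw [← norm_pos_iff]; linarith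
          gcongr _ * ?_
          refine (KR_le R hR _ h4).trans (ENNReal.ofReal_le_ofReal ?_)
          exact Real.rpow_le_rpow_of_nonpos (by positivity) h3 (by simp)
      _ = (∫⁻ ξ in (ball (0:V) (‖η‖ / 2)), ENNReal.ofReal (‖ξ‖ ^ b)) * ENNReal.ofReal ((‖η‖ / 2) ^ (-(N:ℝ))) := lintegral_mul_const' _ _ ENNReal.ofReal_ne_top
      _ ≤ (c * ENNReal.ofReal ((‖η‖ / 2) ^ ((N:ℝ) + b))) * ENNReal.ofReal ((‖η‖ / 2) ^ (-(N:ℝ))) := by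
          gcongr
          exact hball _ (by positivity)
      _ = _ := by
          rw [mul_assoc, ← ENNReal.ofReal_mul (by positivity), ← Real.rpow_add (by positivity), mul_assoc, ← ENNReal.ofReal_mul (by positivity), ← e2]
          congr 3; ring

lemma cs_conv (f K : V → ℝ≥0∞) (hf : Measurable f) (hK : Measurable K) :
    (∫⁻ η, f η * K η) ^ 2 ≤ (∫⁻ η, f η ^ 2 * K η) * ∫⁻ η, K η := by
  have h := ENNReal.lintegral_mul_le_Lp_mul_Lq (volume : Measure V) (p := 2) (q := 2) ⟨by norm_num, by norm_num, by norm_num⟩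
    (f := fun η => f η * K η ^ ((1:ℝ)/2)) (g := fun η => K η ^ ((1:ℝ)/2)) (by fun_prop) (by fun_prop)
  have e1 : ∀ η, K η ^ ((1:ℝ)/2) * K η ^ ((1:ℝ)/2) = K η := fun η => by
    rw [← ENNReal.rpow_add_of_nonneg _ _ (by norm_num) (by norm_num)]; norm_num
  have e2 : ∀ η, (K η ^ ((1:ℝ)/2)) ^ (2:ℝ) = K η := fun η => by
    rw [← ENNReal.rpow_mul]; norm_num
  simp only [Pi.mul_apply, mul_assoc, e1, ENNReal.mul_rpow_of_nonneg _ _ (by norm_num : (0:ℝ) ≤ 2), e2] at h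
  have h2 := pow_le_pow_left' h 2
  refine h2.trans (le_of_eq ?_)
  rw [mul_pow, ← ENNReal.rpow_natCast, ← ENNReal.rpow_natCast, ← ENNReal.rpow_mul, ← ENNReal.rpow_mul]
  norm_num

/-- weighted L² bound for convolution with the kernels -/
lemma conv_bound (b : ℝ) (hn : 1 ≤ Module.finrank ℝ V) (hb : -(Module.finrank ℝ V : ℝ) < b) (hb0 : b < 0) : ∃ C : ℝ≥0∞, C ≠ ⊤ ∧ ∀ R : ℝ, 0 < R →
    ∀ v : V → ℂ, Measurable v → ∫⁻ ξ, ENNReal.ofReal (‖ξ‖ ^ b) * (∫⁻ η, ‖v η‖ₑ * KR V R (η - ξ)) ^ 2 ≤ C * ∫⁻ η, ENNReal.ofReal (‖η‖ ^ b) * ‖v η‖ₑ ^ 2 := by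
  obtain ⟨c, hc, hw⟩ := weight_ineq (V := V) b hn hb hb0
  refine ⟨(∫⁻ z, farK V z) * c, ENNReal.mul_ne_top farK_mass hc, ?_⟩
  intro R hR v hv
  have hKm := KR_meas (V := V) R
  haveI : Nontrivial V := Module.nontrivial_of_finrank_pos (R := ℝ) hn
  have hne : ∀ᵐ η : V, η ≠ 0 := by
    simp [ae_iff]
  calc _ ≤ ∫⁻ ξ, ENNReal.ofReal (‖ξ‖ ^ b) * ((∫⁻ η, ‖v η‖ₑ ^ 2 * KR V R (η - ξ)) * ∫⁻ z, farK V z) := by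
        gcongr with ξ
        refine (cs_conv _ _ hv.enorm (hKm.comp (by fun_prop))).trans (le_of_eq ?_)
        congr 1
        rw [← KR_mass (V := V) R hR]
        exact lintegral_sub_right_eq_self (fun x => KR V R x) ξ
    _ = (∫⁻ z, farK V z) * ∫⁻ ξ, ∫⁻ η, ENNReal.ofReal (‖ξ‖ ^ b) * (‖v η‖ₑ ^ 2 * KR V R (η - ξ)) := by
        rw [← lintegral_const_mul' _ _ farK_mass]
        refine lintegral_congr fun ξ => ?_
        rw [lintegral_const_mul' _ _ ENNReal.ofReal_ne_top]
        ring
    _ = (∫⁻ z, farK V z) * ∫⁻ η, ∫⁻ ξ, ENNReal.ofReal (‖ξ‖ ^ b) * (‖v η‖ₑ ^ 2 * KR V R (η - ξ)) := by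
        congr 1
        refine lintegral_lintegral_swap ?_
        have : Measurable (fun z : V × V => KR V R (z.2 - z.1)) := hKm.comp (by fun_prop)
        unfold Function.uncurry; fun_prop
    _ ≤ (∫⁻ z, farK V z) * ∫⁻ η, c * (ENNReal.ofReal (‖η‖ ^ b) * ‖v η‖ₑ ^ 2) := by
        gcongr 1
        refine lintegral_mono_ae ?_
        filter_upwards [hne] with η hη
        calc _ = ‖v η‖ₑ ^ 2 * ∫⁻ ξ, ENNReal.ofReal (‖ξ‖ ^ b) * KR V R (η - ξ) := by
              rw [← lintegral_const_mul' _ _ (by simp)]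
              refine lintegral_congr fun ξ => ?_
              ring
          _ ≤ ‖v η‖ₑ ^ 2 * (c * ENNReal.ofReal (‖η‖ ^ b)) := by
              gcongr; exact hw R hR η hη
          _ = _ := by ring
    _ = _ := by rw [lintegral_const_mul' _ _ hc, mul_assoc]

end weight
end DS

namespace DS
open scoped ContDiff

section cutoff
variable {V : Type*} [NormedAddCommGroup V] [InnerProductSpace ℝ V] [FiniteDimensional ℝ V]
  [MeasurableSpace V] [BorelSpace V]

lemma schwartz_farK (φ : 𝓢(V, ℂ)) : ∃ A : ℝ, 0 ≤ A ∧ ∀ z, ‖φ z‖ₑ ≤ ENNReal.ofReal A * farK V z := by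
  set N := Module.finrank ℝ V
  refine ⟨2 ^ (N + 1) * ((Finset.Iic (N + 1, 0)).sup fun m => SchwartzMap.seminorm ℝ m.1 m.2) φ, by positivity, fun z => ?_⟩
  have h := SchwartzMap.one_add_le_sup_seminorm_apply (𝕜 := ℝ) (m := (N + 1, 0)) (le_refl (N + 1)) (le_refl 0) φ z
  rw [norm_iteratedFDeriv_zero] at h
  unfold farK
  rw [← ofReal_norm, ← ENNReal.ofReal_mul (by positivity)]
  apply ENNReal.ofReal_le_ofReal
  have e : (1 + ‖z‖) ^ (-((N:ℝ) + 1)) = ((1 + ‖z‖) ^ (N + 1))⁻¹ := by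
    rw [Real.rpow_neg (by positivity)]
    have : (N:ℝ) + 1 = ((N + 1 : ℕ) : ℝ) := by push_cast; ring
    rw [this, Real.rpow_natCast]
  change _ ≤ _ * (1 + ‖z‖) ^ (-((N:ℝ) + 1))
  rw [e, ← div_eq_mul_inv, le_div_iff₀ (by positivity), mul_comm]
  exact h

/-- properties of a cutoff function -/
structure Cut (χ : V → ℂ) (A : ℝ) : Prop where
  cont : Continuous χ
  le : ∀ y, ‖χ y‖ ≤ 1
  one : ∀ y, ‖y‖ ≤ 1 → χ y = 1
  supp : ∀ y, 2 ≤ ‖y‖ → χ y = 0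
  ker : ∀ R : ℝ, 0 < R → ∀ z, ‖𝓕⁻ (fun y => χ (R⁻¹ • y)) z‖ₑ ≤ ENNReal.ofReal A * KR V R z

lemma exists_cut : ∃ (χ : V → ℂ) (A : ℝ), Cut χ A := by
  let g : ContDiffBump (0:V) := ⟨1, 2, by norm_num, by norm_num⟩
  have hcs : HasCompactSupport (fun y : V => ((g y : ℝ) : ℂ)) := g.hasCompactSupport.comp_left (g := fun r : ℝ => (r:ℂ)) (by simp)
  have hsm : ContDiff ℝ ∞ (fun y : V => ((g y : ℝ) : ℂ)) := Complex.ofRealCLM.contDiff.comp g.contDiff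
  let φ : 𝓢(V, ℂ) := hcs.toSchwartzMap hsm
  obtain ⟨A, hA, hb⟩ := schwartz_farK (𝓕⁻ φ)
  refine ⟨fun y => ((g y : ℝ) : ℂ), A, hsm.continuous, ?_, ?_, ?_, ?_⟩
  · intro y
    rw [Complex.norm_real, Real.norm_of_nonneg g.nonneg]; exact g.le_one
  · intro y hy
    rw [g.one_of_mem_closedBall (by simpa using hy)]; simp
  · intro y hy
    rw [g.zero_of_le_dist (by simpa using hy)]; simp
  · intro R hR z
    have e : 𝓕⁻ (fun y : V => ((g (R⁻¹ • y) : ℝ) : ℂ)) z = (R ^ Module.finrank ℝ V) • (𝓕⁻ φ) (R • z) := by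
      rw [SchwartzMap.fourierInv_coe, Real.fourierInv_eq', Real.fourierInv_eq']
      rw [← abs_of_nonneg (a := R ^ Module.finrank ℝ V) (by positivity), ← Measure.integral_comp_inv_smul]
      congr 1; ext y
      congr 4
      rw [inner_smul_left, inner_smul_right]; simp; field_simp
    rw [e, enorm_smul]
    unfold KR
    calc _ ≤ ‖R ^ Module.finrank ℝ V‖ₑ * (ENNReal.ofReal A * farK V (R • z)) := by gcongr; exact hb _
      _ = _ := by
        rw [Real.enorm_of_nonneg (by positivity)]; ring

end cutoff
end DS

namespace DS
open scoped ContDiff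

section src
variable {V : Type*} [NormedAddCommGroup V] [InnerProductSpace ℝ V] [FiniteDimensional ℝ V]
  [MeasurableSpace V] [BorelSpace V]

/-- admissible source terms of the theorem -/
structure Src (G : ℝ → V → ℂ) (S : ℝ) : Prop where
  sch : ∀ s, ∃ φ : 𝓢(V, ℂ), ∀ x, G s x = φ x
  cont : Continuous (fun z : ℝ × V => G z.1 z.2)
  supp : ∀ s, S < |s| → ∀ x, G s x = 0

lemma Src.meas {G : ℝ → V → ℂ} {S : ℝ} (h : Src G S) : Measurable (fun z : ℝ × V => G z.1 z.2) := h.cont.measurable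

lemma Src.nice {G : ℝ → V → ℂ} {S : ℝ} (h : Src G S) (s : ℝ) : Nice (G s) := by
  obtain ⟨φ, hφ⟩ := h.sch s
  have e : G s = φ := funext hφ
  rw [e]
  refine ⟨φ.continuous.measurable, ?_, φ.integrable⟩
  obtain ⟨M, hM⟩ := φ.decay 0 0
  exact ⟨M, fun x => by simpa using hM.2 x⟩

lemma Src.fint {G : ℝ → V → ℂ} {S : ℝ} (h : Src G S) (s : ℝ) : Integrable (𝓕 (G s)) := by
  obtain ⟨φ, hφ⟩ := h.sch s
  have e : G s = φ := funext hφ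
  rw [e, ← SchwartzMap.fourier_coe]
  exact (𝓕 φ).integrable

/-- good times -/
def Eg (G : ℝ → V → ℂ) (M : ℕ) : Set ℝ := {s | ∀ x, (1 + ‖x‖) ^ (Module.finrank ℝ V + 1) * ‖G s x‖ ≤ M}

lemma Eg_meas {G : ℝ → V → ℂ} {S : ℝ} (h : Src G S) (M : ℕ) : MeasurableSet (Eg G M) := by
  refine IsClosed.measurableSet ?_
  unfold Eg
  rw [Set.ofPred_forall]
  refine isClosed_iInter fun x => ?_
  refine isClosed_le ?_ continuous_const
  have : Continuous (fun s : ℝ => G s x) := h.cont.comp (f := fun s : ℝ => (s, x)) (by fun_prop)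
  fun_prop

lemma Eg_ex {G : ℝ → V → ℂ} {S : ℝ} (h : Src G S) (s : ℝ) : ∀ᶠ M : ℕ in Filter.atTop, s ∈ Eg G M := by
  obtain ⟨φ, hφ⟩ := h.sch s
  set N := Module.finrank ℝ V
  have h1 := fun z => SchwartzMap.one_add_le_sup_seminorm_apply (𝕜 := ℝ) (m := (N + 1, 0)) (le_refl (N + 1)) (le_refl 0) φ z
  obtain ⟨M0, hM0⟩ := exists_nat_ge (2 ^ (N + 1) * ((Finset.Iic (N + 1, 0)).sup fun m => SchwartzMap.seminorm ℝ m.1 m.2) φ)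
  filter_upwards [Filter.eventually_ge_atTop M0] with M hM x
  have := h1 x
  rw [norm_iteratedFDeriv_zero] at this
  rw [hφ]
  exact this.trans (hM0.trans (by exact_mod_cast hM))

/-- truncation to good times -/
def GM (G : ℝ → V → ℂ) (M : ℕ) : ℝ → V → ℂ := (Eg G M).indicator G

lemma GM_mem {G : ℝ → V → ℂ} {M : ℕ} {s : ℝ} (h : s ∈ Eg G M) : GM G M s = G s := Set.indicator_of_mem h _
lemma GM_not {G : ℝ → V → ℂ} {M : ℕ} {s : ℝ} (h : s ∉ Eg G M) : GM G M s = 0 := Set.indicator_of_notMem h _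

lemma GM_meas {G : ℝ → V → ℂ} {S : ℝ} (h : Src G S) (M : ℕ) : Measurable (fun z : ℝ × V => GM G M z.1 z.2) := by
  have e : (fun z : ℝ × V => GM G M z.1 z.2) = (Prod.fst ⁻¹' (Eg G M)).indicator (fun z : ℝ × V => G z.1 z.2) := by
    ext z
    by_cases hz : z.1 ∈ Eg G M
    · rw [GM_mem hz, Set.indicator_of_mem (by exact hz)]
    · rw [GM_not hz, Set.indicator_of_notMem (by exact hz)]; rfl
  rw [e]
  exact h.meas.indicator (measurable_fst (Eg_meas h M))

lemma GM_adm {G : ℝ → V → ℂ} {S : ℝ} (h : Src G S) (M : ℕ) : Adm (GM G M) := by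
  refine ⟨GM_meas h M, ?_, ?_⟩
  · intro s
    by_cases hs : s ∈ Eg G M
    · rw [GM_mem hs]; exact h.nice s
    · rw [GM_not hs]; exact ⟨measurable_const, ⟨0, by simp⟩, by simp⟩
  · have h1 : Integrable (fun s : ℝ => (Set.Icc (-S) S).indicator (fun _ => (M:ℝ)) s) :=
      (integrable_indicator_iff measurableSet_Icc).2 (by simp)
    have h2 : Integrable (fun x : V => (1 + ‖x‖) ^ (-((Module.finrank ℝ V : ℝ) + 1))) := integrable_one_add_norm (by linarith)
    refine (h1.mul_prod h2).mono' (GM_meas h M).aestronglyMeasurable (ae_of_all _ fun z => ?_)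
    have hpos : 0 ≤ (1 + ‖z.2‖) ^ (-((Module.finrank ℝ V : ℝ) + 1)) := by positivity
    have hrhs : 0 ≤ (Set.Icc (-S) S).indicator (fun _ => (M:ℝ)) z.1 * (1 + ‖z.2‖) ^ (-((Module.finrank ℝ V : ℝ) + 1)) :=
      mul_nonneg (Set.indicator_nonneg (fun _ _ => by positivity) _) hpos
    by_cases hs : z.1 ∈ Eg G M
    · rw [GM_mem hs]
      by_cases hS : S < |z.1|
      · rw [h.supp _ hS]; simpa using hrhs
      · push Not at hS
        rw [Set.indicator_of_mem (show z.1 ∈ Set.Icc (-S) S from abs_le.1 hS)]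
        have := hs z.2
        have e : (1 + ‖z.2‖) ^ (-((Module.finrank ℝ V : ℝ) + 1)) = ((1 + ‖z.2‖) ^ (Module.finrank ℝ V + 1))⁻¹ := by
          rw [Real.rpow_neg (by positivity)]
          have : (Module.finrank ℝ V:ℝ) + 1 = ((Module.finrank ℝ V + 1 : ℕ) : ℝ) := by push_cast; ring
          rw [this, Real.rpow_natCast]
        rw [e, ← div_eq_mul_inv, le_div_iff₀ (by positivity), mul_comm]
        exact this
    · rw [GM_not hs]; simpa using hrhs

lemma WV_zero (F : ℝ → V → ℂ) (s : ℝ) (ξ : V) : WV 0 F s ξ = cexp (-(s * I * ‖ξ‖)) * 𝓕 (F s) ξ := by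
  unfold WV; congr 3; simp

/-- the evolved source -/
def TT (G : ℝ → V → ℂ) (s : ℝ) (y : V) : ℂ := Tm (s * I) (G s) y

lemma TT_eq (G : ℝ → V → ℂ) (s : ℝ) (y : V) : TT G s y = 𝓕⁻ (WV 0 G s) y := by
  unfold TT Tm
  have e : WV 0 G s = fun ξ : V => cexp (-(s * I * ‖ξ‖)) * 𝓕 (G s) ξ := funext fun ξ => WV_zero G s ξ
  rw [e]

lemma TT_GM (G : ℝ → V → ℂ) (M : ℕ) (s : ℝ) (y : V) : TT (GM G M) s y = (Eg G M).indicator (fun s => TT G s y) s := by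
  by_cases hs : s ∈ Eg G M
  · rw [Set.indicator_of_mem hs]; unfold TT; rw [GM_mem hs]
  · rw [Set.indicator_of_notMem hs]; unfold TT Tm; rw [GM_not hs, Real.fourierInv_eq']
    have : 𝓕 (0 : V → ℂ) = 0 := by ext ξ; rw [Real.fourier_eq']; simp
    simp [this]

lemma TT_meas {G : ℝ → V → ℂ} (hG : Measurable (fun z : ℝ × V => G z.1 z.2)) : Measurable (fun z : ℝ × V => TT G z.1 z.2) := by
  have hf := fourier_slice_meas hG
  have hf' : Measurable (fun z : (ℝ × V) × V => 𝓕 (G z.1.1) z.2) :=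
    hf.comp (g := fun z : ℝ × V => 𝓕 (G z.1) z.2) (f := fun z : (ℝ × V) × V => (z.1.1, z.2)) (by fun_prop)
  have h1 : Measurable (fun z : (ℝ × V) × V => cexp (↑(2 * Real.pi * inner ℝ z.2 z.1.2) * I) • (cexp (-(z.1.1 * I * ‖z.2‖)) * 𝓕 (G z.1.1) z.2)) := by
    fun_prop
  have h2 := h1.stronglyMeasurable.integral_prod_right' (ν := (volume : Measure V))
  have e : (fun z : ℝ × V => TT G z.1 z.2) = fun z : ℝ × V => ∫ ξ, cexp (↑(2 * Real.pi * inner ℝ ξ z.2) * I) • (cexp (-(z.1 * I * ‖ξ‖)) * 𝓕 (G z.1) ξ) := by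
    ext z; unfold TT Tm; rw [Real.fourierInv_eq']
  rw [e]
  exact h2.measurable

lemma TT_supp {G : ℝ → V → ℂ} {S : ℝ} (h : Src G S) (s : ℝ) (hs : S < |s|) (y : V) : TT G s y = 0 := by
  have e : G s = 0 := funext (h.supp s hs)
  unfold TT Tm; rw [e, Real.fourierInv_eq']
  have : 𝓕 (0 : V → ℂ) = 0 := by ext ξ; rw [Real.fourier_eq']; simp
  simp [this]

/-- local integrability of the evolved source -/
lemma TT_loc {G : ℝ → V → ℂ} {S : ℝ} (hS : 0 ≤ S) (h : Src G S) (p q' : ℝ) (hp : 1 < p) (hq' : 1 ≤ q')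
    (hfin : lq q' Set.univ (fun s => Nn p (G s) ^ (1 / p)) ≠ ⊤) (ρ : ℝ) :
    Integrable (fun z : ℝ × V => TT G z.1 z.2) (volume.prod (volume.restrict (closedBall 0 ρ))) := by
  refine ⟨(TT_meas h.meas).aestronglyMeasurable, ?_⟩
  rw [hasFiniteIntegral_iff_enorm, lintegral_prod _ (TT_meas h.meas).enorm.aemeasurable]
  obtain ⟨C, hC, hb⟩ := local_bound (V := V) p ρ S hp hS
  have hI : ∫⁻ s, (Nn p (G s) ^ (1 / p)) ^ q' ≠ ⊤ := by
    intro hcon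
    apply hfin
    unfold lq
    rw [setLIntegral_univ, hcon, ENNReal.top_rpow_of_pos (by positivity)]
  -- bound on the compact piece
  obtain ⟨K, hK⟩ : ∃ K : ℝ≥0∞, K ≠ ⊤ ∧ ∀ s ∈ Set.Icc (-S) S, (∫⁻ x in closedBall (0:V) (ρ + S + 1), ‖G s x‖ₑ ^ 2) ^ ((1:ℝ)/2) ≤ K := by
    have hcpt : IsCompact (Set.Icc (-S) S ×ˢ closedBall (0:V) (ρ + S + 1)) := isCompact_Icc.prod (isCompact_closedBall _ _)
    obtain ⟨m, hm⟩ := hcpt.exists_bound_of_continuousOn (h.cont.continuousOn)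
    refine ⟨(ENNReal.ofReal m ^ 2 * volume (closedBall (0:V) (ρ + S + 1))) ^ ((1:ℝ)/2), ?_, ?_⟩
    · exact ENNReal.rpow_ne_top_of_nonneg (by norm_num) (ENNReal.mul_ne_top (by simp) measure_closedBall_lt_top.ne)
    · intro s hs
      refine ENNReal.rpow_le_rpow ?_ (by norm_num)
      rw [← setLIntegral_const]
      refine setLIntegral_mono measurable_const fun x hx => ?_
      gcongr
      rw [← ofReal_norm]
      exact ENNReal.ofReal_le_ofReal (hm (s, x) ⟨hs, hx⟩)
  have hpt : ∀ s, ∫⁻ y in closedBall (0:V) ρ, ‖TT G s y‖ₑ ≤ (Set.Icc (-S) S).indicator (fun s => C * (K + 1 + (Nn p (G s) ^ (1 / p)) ^ q')) s := by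
    intro s
    by_cases hs : S < |s|
    · simp [TT_supp h s hs]
    · push Not at hs
      have hs' : s ∈ Set.Icc (-S) S := abs_le.1 hs
      rw [Set.indicator_of_mem hs']
      refine (hb (G s) (h.nice s) (h.fint s) s hs).trans ?_
      rw [add_assoc K]
      gcongr
      · exact hK.2 s hs'
      · set a := Nn p (G s) ^ (1 / p)
        rcases le_total a 1 with ha | ha
        · exact ha.trans le_self_add
        · calc a = a ^ (1:ℝ) := (ENNReal.rpow_one a).symm
            _ ≤ a ^ q' := ENNReal.rpow_le_rpow_of_exponent_le ha hq'
            _ ≤ _ := le_add_self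
  refine lt_of_le_of_lt (lintegral_mono hpt) ?_
  rw [lintegral_indicator measurableSet_Icc, lintegral_const_mul' _ _ hC, lintegral_add_left measurable_const, setLIntegral_const]
  refine ENNReal.mul_lt_top hC.lt_top (ENNReal.add_lt_top.2 ⟨ENNReal.mul_lt_top (ENNReal.add_lt_top.2 ⟨hK.1.lt_top, by simp⟩) (by simp), ?_⟩)
  exact lt_of_le_of_lt (setLIntegral_le_lintegral _ _) hI.lt_top

end src
end DS

namespace DS
open scoped ContDiff

section fin
variable {V : Type*} [NormedAddCommGroup V] [InnerProductSpace ℝ V] [FiniteDimensional ℝ V]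
  [MeasurableSpace V] [BorelSpace V]

/-- local integrability hypothesis for the evolved source -/
def LocI (G : ℝ → V → ℂ) : Prop :=
  ∀ ρ : ℝ, Integrable (fun z : ℝ × V => TT G z.1 z.2) (volume.prod (volume.restrict (closedBall 0 ρ)))

lemma LocI.ind {G : ℝ → V → ℂ} (h : LocI G) (ρ : ℝ) :
    Integrable (fun z : ℝ × V => (closedBall (0:V) ρ).indicator (fun y => TT G z.1 y) z.2) (volume.prod volume) := by
  have h1 := h ρ
  have e : (volume : Measure ℝ).prod (volume.restrict (closedBall (0:V) ρ)) = (volume.prod volume).restrict (Set.univ ×ˢ closedBall (0:V) ρ) := by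
    rw [← Measure.prod_restrict, Measure.restrict_univ]
  rw [e] at h1
  have h2 := (integrable_indicator_iff (MeasurableSet.univ.prod measurableSet_closedBall)).2 h1
  refine h2.congr (ae_of_all _ fun z => ?_)
  by_cases hz : z.2 ∈ closedBall (0:V) ρ
  · rw [Set.indicator_of_mem (by exact ⟨trivial, hz⟩)]
    simp only [Set.indicator_of_mem hz]
  · rw [Set.indicator_of_notMem (by intro hh; exact hz hh.2)]
    simp only [Set.indicator_of_notMem hz]

lemma cut_zero {χ : V → ℂ} {A : ℝ} (hχ : Cut χ A) (R : ℝ) (hR : 0 < R) (y : V) (hy : y ∉ closedBall (0:V) (2 * R)) : χ (R⁻¹ • y) = 0 := by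
  apply hχ.supp
  simp only [mem_closedBall_zero_iff, not_le] at hy
  rw [norm_smul, norm_inv, Real.norm_of_nonneg hR.le, inv_mul_eq_div, le_div_iff₀ hR]
  linarith

lemma cut_int {χ : V → ℂ} {A : ℝ} (hχ : Cut χ A) (R : ℝ) (hR : 0 < R) : Integrable (fun y => χ (R⁻¹ • y)) := by
  have hc : Continuous (fun y => χ (R⁻¹ • y)) := hχ.cont.comp (by fun_prop)
  refine hc.integrable_of_hasCompactSupport (HasCompactSupport.intro (isCompact_closedBall (0:V) (2 * R)) fun y hy => cut_zero hχ R hR y hy)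

lemma ker_int {χ : V → ℂ} {A : ℝ} (hχ : Cut χ A) (R : ℝ) (hR : 0 < R) (ξ : V) : Integrable (fun η => 𝓕⁻ (fun y => χ (R⁻¹ • y)) (η - ξ)) := by
  have hc := continuous_fourierInv' _ (cut_int hχ R hR)
  have : Integrable (𝓕⁻ (fun y => χ (R⁻¹ • y))) := by
    refine ⟨hc.aestronglyMeasurable, ?_⟩
    rw [hasFiniteIntegral_iff_enorm]
    refine lt_of_le_of_lt (lintegral_mono (hχ.ker R hR)) ?_
    rw [lintegral_const_mul' _ _ ENNReal.ofReal_ne_top, KR_mass R hR]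
    exact ENNReal.mul_lt_top (by simp) farK_mass.lt_top
  exact this.comp_sub_right ξ

lemma ident {G : ℝ → V → ℂ} {S : ℝ} (h : Src G S) (hl : LocI G) {χ : V → ℂ} {A : ℝ} (hχ : Cut χ A) (M : ℕ) (R : ℝ) (hR : 0 < R) (ξ : V) :
    𝓕 (fun y => (∫ s, TT (GM G M) s y) * χ (R⁻¹ • y)) ξ =
      ∫ η, (∫ s, WV 0 (GM G M) s η) * 𝓕⁻ (fun y => χ (R⁻¹ • y)) (η - ξ) := by
  set k : V → ℂ := 𝓕⁻ (fun y => χ (R⁻¹ • y)) with hk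
  let g : V → ℂ := fun y => cexp (↑(-2 * Real.pi * inner ℝ y ξ) * I) * χ (R⁻¹ • y)
  have hχc : Continuous (fun y => χ (R⁻¹ • y)) := hχ.cont.comp (by fun_prop)
  have hg : Continuous g := by
    have : Continuous (fun y : V => cexp (↑(-2 * Real.pi * inner ℝ y ξ) * I)) := by fun_prop
    exact this.mul hχc
  have hgn : ∀ y, ‖g y‖ = ‖χ (R⁻¹ • y)‖ := fun y => by
    simp only [g]; rw [norm_mul, Complex.norm_exp_ofReal_mul_I, one_mul]
  have hgi : Integrable g := (cut_int hχ R hR).mono hg.aestronglyMeasurable (ae_of_all _ fun y => (hgn y).le)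
  have hgk : ∀ η, 𝓕⁻ g η = k (η - ξ) := by
    intro η
    rw [hk, Real.fourierInv_eq', Real.fourierInv_eq']
    congr 1; ext y
    simp only [g, smul_eq_mul]
    rw [← mul_assoc, ← Complex.exp_add, inner_sub_right]
    congr 2; push_cast; ring
  have hA := GM_adm h M
  have hTm : Measurable (fun z : ℝ × V => TT (GM G M) z.1 z.2) := TT_meas hA.meas
  have hi1 : Integrable (fun z : ℝ × V => TT (GM G M) z.1 z.2 * g z.2) (volume.prod volume) := by
    refine (hl.ind (2 * R)).mono (hTm.mul (hg.measurable.comp measurable_snd)).aestronglyMeasurable (ae_of_all _ fun z => ?_)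
    rw [norm_mul, hgn]
    by_cases hz : z.2 ∈ closedBall (0:V) (2 * R)
    · rw [Set.indicator_of_mem hz, TT_GM]
      calc _ ≤ ‖TT G z.1 z.2‖ * 1 := by
            gcongr
            · exact norm_indicator_le_norm_self _ _
            · exact hχ.le _
        _ = _ := mul_one _
    · rw [cut_zero hχ R hR _ hz]; simp
  have hWm : Measurable (fun z : ℝ × V => WV 0 (GM G M) z.1 z.2) := (WV_dom 0 hA).meas
  have hWb : ∀ s η, ‖WV 0 (GM G M) s η‖ ≤ ∫ x, ‖GM G M s x‖ := fun s η => by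
    simpa using (WV_dom 0 hA).bd s η
  have hki := ker_int hχ R hR ξ
  have hi2 : Integrable (fun z : ℝ × V => WV 0 (GM G M) z.1 z.2 * k (z.2 - ξ)) (volume.prod volume) := by
    refine ((WV_dom 0 hA).mint.mul_prod hki.norm).mono' ?_ (ae_of_all _ fun z => ?_)
    · have hkm : Measurable (fun z : ℝ × V => k (z.2 - ξ)) := (continuous_fourierInv' _ (cut_int hχ R hR)).measurable.comp (by fun_prop)
      exact (hWm.mul hkm).aestronglyMeasurable
    · rw [norm_mul]
      gcongr
      exact hWb _ _
  have hWi : ∀ s, Integrable (WV 0 (GM G M) s) := by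
    intro s
    have hF : Integrable (𝓕 (GM G M s)) := by
      by_cases hs : s ∈ Eg G M
      · rw [GM_mem hs]; exact h.fint s
      · rw [GM_not hs]
        have : 𝓕 (0 : V → ℂ) = 0 := by ext ξ; rw [Real.fourier_eq']; simp
        rw [this]; exact integrable_zero _ _ _
    have e : WV 0 (GM G M) s = fun η : V => cexp (-(s * I * ‖η‖)) * 𝓕 (GM G M s) η := funext fun η => WV_zero _ s η
    rw [e]
    have hc : Continuous (fun η : V => cexp (-(s * I * ‖η‖))) := by fun_prop
    exact hF.bdd_mul (c := 1) hc.aestronglyMeasurable (ae_of_all _ fun η => norm_cexp_le _ (by simp) η)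
  rw [Real.fourier_eq']
  calc _ = ∫ y, ∫ s, TT (GM G M) s y * g y := by
        congr 1; ext y
        rw [integral_mul_const, smul_eq_mul]
        simp only [g]; ring
    _ = ∫ s, ∫ y, TT (GM G M) s y * g y := (integral_integral_swap (f := fun s y => TT (GM G M) s y * g y) hi1).symm
    _ = ∫ s, ∫ η, WV 0 (GM G M) s η * k (η - ξ) := by
        congr 1; ext s
        simp_rw [TT_eq, ← hgk]
        exact fourierInv_mul_flip _ _ (hWi s) hgi
    _ = ∫ η, ∫ s, WV 0 (GM G M) s η * k (η - ξ) := integral_integral_swap (f := fun s η => WV 0 (GM G M) s η * k (η - ξ)) hi2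
    _ = _ := by
        congr 1; ext η; rw [integral_mul_const]

/-- Fatou for a weighted sequence -/
lemma fatou_w (w : V → ℝ≥0∞) (hw : Measurable w) (f : ℕ → V → ℂ) (g : V → ℂ) (hf : ∀ m, Measurable (f m))
    (hlim : ∀ ξ, Filter.Tendsto (fun m => f m ξ) Filter.atTop (nhds (g ξ))) (hwt : ∀ ξ, w ξ ≠ ⊤) (B : ℝ≥0∞)
    (hB : ∀ m, ∫⁻ ξ, w ξ * ‖f m ξ‖ₑ ^ 2 ≤ B) : ∫⁻ ξ, w ξ * ‖g ξ‖ₑ ^ 2 ≤ B := by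
  calc _ = ∫⁻ ξ, Filter.liminf (fun m => w ξ * ‖f m ξ‖ₑ ^ 2) Filter.atTop := by
        refine lintegral_congr fun ξ => ?_
        have h1 : Filter.Tendsto (fun m => ‖f m ξ‖ₑ ^ 2) Filter.atTop (nhds (‖g ξ‖ₑ ^ 2)) :=
          (ENNReal.continuous_pow 2).tendsto _ |>.comp ((continuous_enorm.tendsto _).comp (hlim ξ))
        exact (ENNReal.Tendsto.const_mul h1 (Or.inr (hwt ξ))).liminf_eq.symm
    _ ≤ Filter.liminf (fun m => ∫⁻ ξ, w ξ * ‖f m ξ‖ₑ ^ 2) Filter.atTop :=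
        lintegral_liminf_le fun m => hw.mul ((hf m).enorm.pow_const 2)
    _ ≤ B := by
        refine Filter.liminf_le_of_le (by isBoundedDefault) fun b hb => ?_
        obtain ⟨k, hk'⟩ := hb.exists
        exact hk'.trans (hB k)

lemma fourier_lim (f : ℕ → V → ℂ) (g : V → ℂ) (b : V → ℝ) (hf : ∀ m, AEStronglyMeasurable (f m) volume) (hb : Integrable b)
    (hle : ∀ m, ∀ᵐ y, ‖f m y‖ ≤ b y) (hlim : ∀ᵐ y, Filter.Tendsto (fun m => f m y) Filter.atTop (nhds (g y))) (ξ : V) :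
    Filter.Tendsto (fun m => 𝓕 (f m) ξ) Filter.atTop (nhds (𝓕 g ξ)) := by
  simp_rw [Real.fourier_eq']
  refine tendsto_integral_of_dominated_convergence b ?_ hb ?_ ?_
  · intro m
    have : Continuous (fun y : V => cexp (↑(-2 * Real.pi * inner ℝ y ξ) * I)) := by fun_prop
    exact this.aestronglyMeasurable.smul (hf m)
  · intro m
    filter_upwards [hle m] with y hy
    rw [norm_smul, Complex.norm_exp_ofReal_mul_I, one_mul]; exact hy
  · filter_upwards [hlim] with y hy
    exact hy.const_smul _

lemma final_bound {G : ℝ → V → ℂ} {S : ℝ} (h : Src G S) (hl : LocI G) {χ : V → ℂ} {A : ℝ} (hχ : Cut χ A)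
    (b : ℝ) (C B : ℝ≥0∞)
    (hconv : ∀ R : ℝ, 0 < R → ∀ v : V → ℂ, Measurable v → ∫⁻ ξ, ENNReal.ofReal (‖ξ‖ ^ b) * (∫⁻ η, ‖v η‖ₑ * KR V R (η - ξ)) ^ 2 ≤ C * ∫⁻ η, ENNReal.ofReal (‖η‖ ^ b) * ‖v η‖ₑ ^ 2)
    (hB : ∀ M : ℕ, ∫⁻ ξ, ENNReal.ofReal (‖ξ‖ ^ b) * ‖∫ s, WV 0 (GM G M) s ξ‖ₑ ^ 2 ≤ B)
    (hu : Integrable (fun y => ∫ s, TT G s y)) :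
    ∫⁻ ξ, ENNReal.ofReal (‖ξ‖ ^ b) * ‖𝓕 (fun y => ∫ s, TT G s y) ξ‖ₑ ^ 2 ≤ ENNReal.ofReal A ^ 2 * (C * B) := by
  have hwm : Measurable (fun ξ : V => ENNReal.ofReal (‖ξ‖ ^ b)) := by fun_prop
  have hTm := TT_meas h.meas
  -- integrability of the localized pieces
  have hdom : ∀ R : ℝ, 0 < R → Integrable (fun y => ∫ s, ‖(closedBall (0:V) (2 * R)).indicator (fun y => TT G s y) y‖) := fun R hR =>
    (hl.ind (2 * R)).norm.integral_prod_right
  have hsl : ∀ R : ℝ, 0 < R → ∀ᵐ y, Integrable (fun s => (closedBall (0:V) (2 * R)).indicator (fun y => TT G s y) y) := fun R hR =>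
    (hl.ind (2 * R)).prod_left_ae
  have huM : ∀ M, Measurable (fun y => ∫ s, TT (GM G M) s y) := fun M =>
    ((TT_meas (GM_meas h M)).stronglyMeasurable.integral_prod_left' (μ := (volume : Measure ℝ))).measurable
  have hcutm : ∀ R : ℝ, Measurable (fun y => χ (R⁻¹ • y)) := fun R => (hχ.cont.comp (by fun_prop)).measurable
  have hleM : ∀ M (R : ℝ), 0 < R → ∀ᵐ y, ‖(∫ s, TT (GM G M) s y) * χ (R⁻¹ • y)‖ ≤ ∫ s, ‖(closedBall (0:V) (2 * R)).indicator (fun y => TT G s y) y‖ := by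
    intro M R hR
    filter_upwards [hsl R hR] with y hy
    by_cases hyB : y ∈ closedBall (0:V) (2 * R)
    · simp only [Set.indicator_of_mem hyB] at hy ⊢
      rw [norm_mul]
      calc _ ≤ ‖∫ s, TT (GM G M) s y‖ * 1 := by gcongr; exact hχ.le _
        _ = ‖∫ s, TT (GM G M) s y‖ := mul_one _
        _ ≤ _ := by
          refine norm_integral_le_of_norm_le hy.norm (ae_of_all _ fun s => ?_)
          rw [TT_GM]; exact norm_indicator_le_norm_self _ _
    · rw [cut_zero hχ R hR _ hyB, mul_zero, norm_zero]
      exact integral_nonneg fun s => norm_nonneg _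
  have hlimM : ∀ R : ℝ, 0 < R → ∀ᵐ y, Filter.Tendsto (fun M => (∫ s, TT (GM G M) s y) * χ (R⁻¹ • y)) Filter.atTop (nhds ((∫ s, TT G s y) * χ (R⁻¹ • y))) := by
    intro R hR
    filter_upwards [hsl R hR] with y hy
    by_cases hyB : y ∈ closedBall (0:V) (2 * R)
    · simp only [Set.indicator_of_mem hyB] at hy
      refine Filter.Tendsto.mul_const _ ?_
      refine tendsto_integral_of_dominated_convergence (fun s => ‖TT G s y‖) ?_ hy.norm ?_ ?_
      · intro M; exact (meas_slice (TT_meas (GM_meas h M)) y).aestronglyMeasurable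
      · intro M; refine ae_of_all _ fun s => ?_
        rw [TT_GM]; exact norm_indicator_le_norm_self _ _
      · refine ae_of_all _ fun s => ?_
        refine tendsto_const_nhds.congr' ?_
        filter_upwards [Eg_ex h s] with M hM
        rw [TT_GM, Set.indicator_of_mem hM]
    · rw [cut_zero hχ R hR _ hyB]; simp
  have hiM : ∀ M (R : ℝ), 0 < R → Integrable (fun y => (∫ s, TT (GM G M) s y) * χ (R⁻¹ • y)) := fun M R hR =>
    (hdom R hR).mono' ((huM M).mul (hcutm R)).aestronglyMeasurable (hleM M R hR)
  have st1 : ∀ M (R : ℝ), 0 < R → ∫⁻ ξ, ENNReal.ofReal (‖ξ‖ ^ b) * ‖𝓕 (fun y => (∫ s, TT (GM G M) s y) * χ (R⁻¹ • y)) ξ‖ₑ ^ 2 ≤ ENNReal.ofReal A ^ 2 * (C * B) := by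
    intro M R hR
    have hvm : Measurable (fun η : V => ∫ s, WV 0 (GM G M) s η) :=
      ((WV_dom 0 (GM_adm h M)).meas.stronglyMeasurable.integral_prod_left' (μ := (volume : Measure ℝ))).measurable
    calc _ ≤ ∫⁻ ξ, ENNReal.ofReal A ^ 2 * (ENNReal.ofReal (‖ξ‖ ^ b) * (∫⁻ η, ‖∫ s, WV 0 (GM G M) s η‖ₑ * KR V R (η - ξ)) ^ 2) := by
          refine lintegral_mono fun ξ => ?_
          rw [ident h hl hχ M R hR ξ, mul_left_comm, ← mul_pow]
          gcongr
          refine (enorm_integral_le_lintegral_enorm _).trans ?_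
          rw [← lintegral_const_mul' _ _ ENNReal.ofReal_ne_top]
          refine lintegral_mono fun η => ?_
          rw [enorm_mul, mul_left_comm]
          gcongr
          exact hχ.ker R hR _
      _ = ENNReal.ofReal A ^ 2 * ∫⁻ ξ, (ENNReal.ofReal (‖ξ‖ ^ b) * (∫⁻ η, ‖∫ s, WV 0 (GM G M) s η‖ₑ * KR V R (η - ξ)) ^ 2) :=
          lintegral_const_mul' _ _ (by simp)
      _ ≤ _ := by
          gcongr
          exact (hconv R hR _ hvm).trans (by gcongr; exact hB M)
  have st2 : ∀ R : ℝ, 0 < R → ∫⁻ ξ, ENNReal.ofReal (‖ξ‖ ^ b) * ‖𝓕 (fun y => (∫ s, TT G s y) * χ (R⁻¹ • y)) ξ‖ₑ ^ 2 ≤ ENNReal.ofReal A ^ 2 * (C * B) := by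
    intro R hR
    refine fatou_w _ hwm (fun M => 𝓕 (fun y => (∫ s, TT (GM G M) s y) * χ (R⁻¹ • y))) _ (fun M => (continuous_fourier' _ (hiM M R hR)).measurable) (fun ξ => ?_) (fun ξ => ENNReal.ofReal_ne_top) _ (fun M => st1 M R hR)
    exact fourier_lim _ _ _ (fun M => (hiM M R hR).1) (hdom R hR) (fun M => hleM M R hR) (hlimM R hR) ξ
  have hiR : ∀ R : ℝ, Integrable (fun y => (∫ s, TT G s y) * χ (R⁻¹ • y)) := fun R =>
    hu.mul_bdd (c := 1) (hcutm R).aestronglyMeasurable (ae_of_all _ fun y => hχ.le _)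
  refine fatou_w _ hwm (fun m : ℕ => 𝓕 (fun y => (∫ s, TT G s y) * χ (((m:ℝ) + 1)⁻¹ • y))) _ (fun m => (continuous_fourier' _ (hiR _)).measurable) (fun ξ => ?_) (fun ξ => ENNReal.ofReal_ne_top) _ (fun m => st2 _ (by positivity))
  refine fourier_lim _ _ (fun y => ‖∫ s, TT G s y‖) (fun m => (hiR _).1) hu.norm (fun m => ae_of_all _ fun y => ?_) (ae_of_all _ fun y => ?_) ξ
  · rw [norm_mul]
    exact mul_le_of_le_one_right (norm_nonneg _) (hχ.le _)
  · refine tendsto_const_nhds.congr' ?_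
    obtain ⟨m0, hm0⟩ := exists_nat_ge ‖y‖
    filter_upwards [Filter.eventually_ge_atTop m0] with m hm
    rw [hχ.one, mul_one]
    have : (m0:ℝ) ≤ m := by exact_mod_cast hm
    rw [norm_smul, norm_inv, Real.norm_of_nonneg (by positivity), inv_mul_eq_div, div_le_one (by positivity)]
    linarith

end fin
end DS

namespace DS
open scoped ContDiff

section assemble
variable {V : Type*} [NormedAddCommGroup V] [InnerProductSpace ℝ V] [FiniteDimensional ℝ V]
  [MeasurableSpace V] [BorelSpace V]

lemma fourier_undef (f : V → ℂ) (hf : ¬ Integrable f) : 𝓕 f = 0 := by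
  ext ξ
  rw [Real.fourier_eq']
  refine integral_undef fun hc => hf ?_
  have h1 : Continuous (fun y : V => cexp (↑(2 * Real.pi * inner ℝ y ξ) * I)) := by fun_prop
  have h2 := hc.bdd_mul (c := 1) (f := fun y : V => cexp (↑(2 * Real.pi * inner ℝ y ξ) * I)) h1.aestronglyMeasurable
    (ae_of_all _ fun y => by rw [Complex.norm_exp_ofReal_mul_I])
  refine h2.congr (ae_of_all _ fun y => ?_)
  simp only [smul_eq_mul]
  rw [← mul_assoc, ← Complex.exp_add]
  have : (↑(2 * Real.pi * inner ℝ y ξ) * I + ↑(-2 * Real.pi * inner ℝ y ξ) * I : ℂ) = 0 := by push_cast; ring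
  rw [this]; simp

lemma fourierInv_undef (f : V → ℂ) (hf : ¬ Integrable f) : 𝓕⁻ f = 0 := by
  ext ξ
  rw [Real.fourierInv_eq_fourier_neg, fourier_undef f hf]; rfl

lemma Nn_GM (G : ℝ → V → ℂ) (M : ℕ) (p : ℝ) (hp : 0 < p) (s : ℝ) : Nn p (GM G M s) ≤ Nn p (G s) := by
  by_cases hs : s ∈ Eg G M
  · rw [GM_mem hs]
  · rw [GM_not hs]; unfold Nn; simp [hp]

lemma lq_mono (c : ℝ) (hc : 0 < c) (e e' : ℝ → ℝ≥0∞) (h : ∀ s, e s ≤ e' s) : lq c Set.univ e ≤ lq c Set.univ e' := by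
  unfold lq
  refine ENNReal.rpow_le_rpow (lintegral_mono fun s => ENNReal.rpow_le_rpow (h s) hc.le) (by positivity)

lemma main_V (q q' d p γ : ℝ) (hn : 1 ≤ Module.finrank ℝ V) (hq : 2 ≤ q) (hqq : 1 / q + 1 / q' = 1) (hq1 : 1 ≤ q') (hp : 1 < p) (hp2 : p < 2)
    (hd : 1 / q = d * (1 / p - 1 / 2)) (hdV : d ≤ ((Module.finrank ℝ V : ℝ) - 1) / 2)
    (hγ : γ = 1 / q - Module.finrank ℝ V * (1 / p - 1 / 2)) (hγ0 : γ < 0) (hγn : -(Module.finrank ℝ V : ℝ) < 2 * γ) :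
    ∃ C : ℝ≥0∞, C ≠ ⊤ ∧ C ≠ 0 ∧ ∀ (G : ℝ → V → ℂ) (S : ℝ), 0 ≤ S → Src G S → Integrable (fun y => ∫ s, TT G s y) →
      ∫⁻ ξ, ENNReal.ofReal (‖ξ‖ ^ (2 * γ)) * ‖𝓕 (fun y => ∫ s, TT G s y) ξ‖ₑ ^ 2 ≤
        C * (lq q' Set.univ (fun s => Nn p (G s) ^ (1 / p)) * lq q' Set.univ (fun s => Nn p (G s) ^ (1 / p))) := by
  obtain ⟨C1, hC1, h1⟩ := core_bound (V := V) q q' d p γ hq hqq hp hp2 hd hdV hγ hγ0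
  obtain ⟨C2, hC2, h2⟩ := conv_bound (V := V) (2 * γ) hn hγn (by linarith)
  obtain ⟨χ, A, hχ⟩ := exists_cut (V := V)
  refine ⟨ENNReal.ofReal A ^ 2 * (C2 * C1) + 1, ?_, by simp, ?_⟩
  · exact ENNReal.add_ne_top.2 ⟨ENNReal.mul_ne_top (by simp) (ENNReal.mul_ne_top hC2 hC1), by simp⟩
  intro G S hS hG hu
  set W := lq q' Set.univ (fun s => Nn p (G s) ^ (1 / p)) with hW
  by_cases hWt : W = ⊤
  · rw [hWt, ENNReal.top_mul_top, ENNReal.mul_top (by simp)]; exact le_top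
  have hl : LocI G := fun ρ => TT_loc hS hG p q' hp hq1 hWt ρ
  have hB : ∀ M : ℕ, ∫⁻ ξ, ENNReal.ofReal (‖ξ‖ ^ (2 * γ)) * ‖∫ s, WV 0 (GM G M) s ξ‖ₑ ^ 2 ≤ C1 * (W * W) := by
    intro M
    refine (h1 _ (GM_adm hG M)).trans ?_
    have : lq q' Set.univ (fun s => Nn p (GM G M s) ^ (1 / p)) ≤ W :=
      lq_mono q' (by linarith) _ _ fun s => ENNReal.rpow_le_rpow (Nn_GM G M p (by linarith) s) (by positivity)
    gcongr
  refine (final_bound hG hl hχ (2 * γ) C2 (C1 * (W * W)) h2 hB hu).trans ?_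
  calc _ = ENNReal.ofReal A ^ 2 * (C2 * C1) * (W * W) := by ring
    _ ≤ _ := by gcongr; exact le_self_add

end assemble
end DS

lemma ds_TT (n : ℕ) (G : EuclideanSpace ℝ (Fin n) → ℝ → ℂ) (s : ℝ) (y : EuclideanSpace ℝ (Fin n)) :
    mOp n (expMult (-s)) (fun z => G z s) y = DS.TT (fun s z => G z s) s y := by
  unfold mOp DS.TT DS.Tm expMult
  have e : (fun ξ : EuclideanSpace ℝ (Fin n) => cexp (I * ((-s : ℝ) : ℂ) * (‖ξ‖ : ℝ)) * 𝓕 (fun z => G z s) ξ) =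
      fun ξ : EuclideanSpace ℝ (Fin n) => cexp (-(s * I * ‖ξ‖)) * 𝓕 (fun z => G z s) ξ := by
    ext ξ
    congr 2
    push_cast; ring
  rw [e]

lemma ds_mixed (n : ℕ) (q' p : ℝ) (G : EuclideanSpace ℝ (Fin n) → ℝ → ℂ) :
    DS.lq q' Set.univ (fun s => DS.Nn p (fun z => G z s) ^ (1 / p)) = mixedNorm n q' p G := by
  unfold DS.lq DS.Nn mixedNorm
  rw [setLIntegral_univ]
  congr 2; ext s
  rw [← ENNReal.rpow_mul]
  congr 1
  ring

/-- Dual Strichartz estimate for the free half-wave propagator. -/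
theorem dual_strichartz_free_wave (n : ℕ) (hn : 3 ≤ n) (q r q' r' σ : ℝ)
    (hq : 2 ≤ q) (hr : 2 ≤ r)
    (hadm : 2 / q + ((n : ℝ) - 1) / r ≤ ((n : ℝ) - 1) / 2)
    (hσ : σ = 1 / q + (n : ℝ) / r - ((n : ℝ) - 1) / 2)
    (hq' : 1 / q + 1 / q' = 1) (hr' : 1 / r + 1 / r' = 1) :
    ∃ C > (0 : ℝ), ∀ G : EuclideanSpace ℝ (Fin n) → ℝ → ℂ,
      (∀ s : ℝ, IsSchwartz (fun x => G x s)) →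
      Continuous (fun z : EuclideanSpace ℝ (Fin n) × ℝ => G z.1 z.2) →
      (∃ R : ℝ, ∀ x, ∀ s : ℝ, R < |s| → G x s = 0) →
      eLpNorm (mOp n (powMult (σ - 1 / 2))
          (fun y => ∫ s : ℝ, mOp n (expMult (-s)) (fun z => G z s) y)) 2 volume ≤
        ENNReal.ofReal C * mixedNorm n q' r' G := by
  have hfr : Module.finrank ℝ (EuclideanSpace ℝ (Fin n)) = n := finrank_euclideanSpace_fin
  have hn3 : (3:ℝ) ≤ n := by exact_mod_cast hn
  -- exponents in terms of reciprocals
  set a := 1 / q with ha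
  set c := 1 / r with hc
  have hq0 : 0 < q := by linarith
  have hr0 : 0 < r := by linarith
  have ha0 : 0 < a := by positivity
  have ha2 : a ≤ 1 / 2 := one_div_le_one_div_of_le (by norm_num) hq
  have hc0 : 0 < c := by positivity
  have hadm' : 2 * a + ((n:ℝ) - 1) * c ≤ ((n:ℝ) - 1) / 2 := by
    have e1 : 2 / q = 2 * a := by rw [ha]; ring
    have e2 : ((n:ℝ) - 1) / r = ((n:ℝ) - 1) * c := by rw [hc]; ring
    rw [← e1, ← e2]; exact hadm
  have hc2 : c < 1 / 2 := by
    by_contra hcon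
    push Not at hcon
    nlinarith
  have hσ' : σ - 1 / 2 = a + n * c - n / 2 := by
    rw [hσ]; have e2 : (n:ℝ) / r = n * c := by rw [hc]; ring
    rw [e2]; ring
  have hp1 : 1 / r' = 1 - c := by linarith
  have hr'0 : 0 < r' := by
    have : 0 < 1 / r' := by rw [hp1]; linarith
    exact one_div_pos.1 this
  have hp : 1 < r' := by
    have : 1 / r' < 1 := by rw [hp1]; linarith
    rwa [div_lt_one hr'0] at this
  have hp2 : r' < 2 := by
    have : 1 / 2 < 1 / r' := by rw [hp1]; linarith
    exact (one_div_lt_one_div (by norm_num) hr'0).1 this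
  have hq'1 : 1 / q' = 1 - a := by linarith
  have hq'0 : 0 < q' := by
    have : 0 < 1 / q' := by rw [hq'1]; linarith
    exact one_div_pos.1 this
  have hq1 : 1 ≤ q' := by
    have : 1 / q' ≤ 1 := by rw [hq'1]; linarith
    rwa [div_le_one hq'0] at this
  set θ := 1 / r' - 1 / 2 with hθ
  have hθc : θ = 1 / 2 - c := by rw [hθ, hp1]; ring
  have hθ0 : 0 < θ := by rw [hθc]; linarith
  set γ := σ - 1 / 2 with hγd
  have hγ : γ = a - n * θ := by rw [hσ', hθc]; ring
  have haθ : 2 * a ≤ ((n:ℝ) - 1) * θ := by rw [hθc]; nlinarith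
  have hγ0 : γ < 0 := by rw [hγ]; nlinarith
  have hγn : -(n:ℝ) < 2 * γ := by rw [hγ]; nlinarith
  obtain ⟨C, hCt, hC0, hmain⟩ := DS.main_V (V := EuclideanSpace ℝ (Fin n)) q q' (a / θ) r' γ (by rw [hfr]; omega) hq hq' hq1 hp hp2
    (by rw [div_mul_cancel₀ _ hθ0.ne'])
    (by rw [hfr, div_le_iff₀ hθ0]; linarith) (by rw [hfr, hγ]) hγ0 (by rw [hfr]; exact hγn)
  have hCs0 : C ^ ((1:ℝ)/2) ≠ 0 := by simp [hC0]
  have hCst : C ^ ((1:ℝ)/2) ≠ ⊤ := ENNReal.rpow_ne_top_of_nonneg (by norm_num) hCt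
  refine ⟨(C ^ ((1:ℝ)/2)).toReal, ENNReal.toReal_pos hCs0 hCst, ?_⟩
  intro G hG1 hG2 ⟨S, hS⟩
  rw [ENNReal.ofReal_toReal hCst]
  have hsrc : DS.Src (fun s z => G z s) (max S 0) := by
    refine ⟨hG1, ?_, ?_⟩
    · exact hG2.comp (f := fun z : ℝ × EuclideanSpace ℝ (Fin n) => (z.2, z.1)) (by fun_prop)
    · intro s hs x
      exact hS x s (lt_of_le_of_lt (le_max_left _ _) hs)
  have eu : (fun y => ∫ s : ℝ, mOp n (expMult (-s)) (fun z => G z s) y) = fun y => ∫ s : ℝ, DS.TT (fun s z => G z s) s y := by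
    ext y; congr 1; ext s; exact ds_TT n G s y
  rw [eu]
  set u : EuclideanSpace ℝ (Fin n) → ℂ := fun y => ∫ s : ℝ, DS.TT (fun s z => G z s) s y with hu
  have em : mOp n (powMult γ) u = 𝓕⁻ (fun ξ : EuclideanSpace ℝ (Fin n) => powMult γ ‖ξ‖ * 𝓕 u ξ) := rfl
  rw [em]
  by_cases hui : Integrable u
  swap
  · have e0 : (fun ξ : EuclideanSpace ℝ (Fin n) => powMult γ ‖ξ‖ * 𝓕 u ξ) = 0 := by
      ext ξ; rw [DS.fourier_undef u hui]; simp
    have e1 : 𝓕⁻ (0 : EuclideanSpace ℝ (Fin n) → ℂ) = 0 := by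
      ext ξ; rw [Real.fourierInv_eq']; simp
    rw [e0, e1]; simp
  by_cases hmi : Integrable (fun ξ : EuclideanSpace ℝ (Fin n) => powMult γ ‖ξ‖ * 𝓕 u ξ)
  swap
  · rw [DS.fourierInv_undef _ hmi]; simp
  refine (DS.plancherel_inv_le _ hmi).trans ?_
  have hb := hmain (fun s z => G z s) (max S 0) (le_max_right _ _) hsrc hui
  rw [ds_mixed n q' r' G] at hb
  rw [eLpNorm_eq_lintegral_rpow_enorm_toReal (by norm_num) (by norm_num)]
  have e3 : ∫⁻ ξ : EuclideanSpace ℝ (Fin n), ‖powMult γ ‖ξ‖ * 𝓕 u ξ‖ₑ ^ (2 : ℝ≥0∞).toReal =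
      ∫⁻ ξ : EuclideanSpace ℝ (Fin n), ENNReal.ofReal (‖ξ‖ ^ (2 * γ)) * ‖𝓕 u ξ‖ₑ ^ 2 := by
    refine lintegral_congr fun ξ => ?_
    have e4 : ‖powMult γ ‖ξ‖‖ₑ = ENNReal.ofReal (‖ξ‖ ^ γ) := by
      unfold powMult
      rw [← ofReal_norm, Complex.norm_real, Real.norm_of_nonneg (by positivity)]
    rw [ENNReal.toReal_ofNat, ENNReal.rpow_ofNat, enorm_mul, mul_pow, e4, ← ENNReal.ofReal_pow (by positivity)]
    congr 2
    rw [mul_comm 2 γ, Real.rpow_mul (norm_nonneg _)]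
    exact (Real.rpow_ofNat _ _).symm
  rw [e3, ENNReal.toReal_ofNat]
  refine (ENNReal.rpow_le_rpow hb (by norm_num)).trans (le_of_eq ?_)
  rw [ENNReal.mul_rpow_of_nonneg _ _ (by norm_num), ENNReal.mul_rpow_of_nonneg _ _ (by norm_num), ← ENNReal.rpow_add_of_nonneg _ _ (by norm_num) (by norm_num)]
  norm_num

end
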